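/- arXiv:2211.12138 — 2 statements merged into one kernel-verified Lean document; each statement's English description precedes it below -/
import Mathlib

section
/- The polynomial F(x, m, a, b) = x⁴ + (4am² + 4bm² − 6m⁴ − 2ab)x² + (8abm² − 8am⁴ − 8bm⁴)x + (9m⁸ − 6abm⁴ + a²b²), regarded as a polynomial in the four variables x, m, a, b over ℚ, is irreducible in ℚ[x, m, a, b]. -/
open MvPolynomial

/-- The four-variable polynomial `F(x, m, a, b)` over `ℚ`, with `x = X 0`, `m = X 1`,
`a = X 2`, `b = X 3`. -/
noncomputable def Fpoly : MvPolynomial (Fin 4) ℚ :=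
  (X 0) ^ 4
    + (4 * X 2 * (X 1) ^ 2 + 4 * X 3 * (X 1) ^ 2 - 6 * (X 1) ^ 4 - 2 * X 2 * X 3) * (X 0) ^ 2
    + (8 * X 2 * X 3 * (X 1) ^ 2 - 8 * X 2 * (X 1) ^ 4 - 8 * X 3 * (X 1) ^ 4) * X 0
    + (9 * (X 1) ^ 8 - 6 * X 2 * X 3 * (X 1) ^ 4 + (X 2) ^ 2 * (X 3) ^ 2)

instance fact_five : Fact (Nat.Prime 5) := ⟨by norm_num⟩

theorem quartic_mod5 :
    Irreducible (Polynomial.X ^ 4 + 2 * Polynomial.X + 4 : Polynomial (ZMod 5)) := by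
  have hdeg : (Polynomial.X ^ 4 + 2 * Polynomial.X + 4 : Polynomial (ZMod 5)).natDegree = 4 := by
    compute_degree!
  have hmon : (Polynomial.X ^ 4 + 2 * Polynomial.X + 4 : Polynomial (ZMod 5)).Monic := by
    monicity!
  rw [hmon.irreducible_iff_natDegree']
  refine ⟨fun h => by rw [h] at hdeg; simp at hdeg, ?_⟩
  intro f g hf hg hfg hmem
  rw [hdeg, Finset.mem_Ioc] at hmem
  obtain ⟨h0, h2⟩ := hmem
  have hsum : f.natDegree + g.natDegree = 4 := by
    rw [← hf.natDegree_mul hg, hfg, hdeg]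
  have hroot : ∀ x : ZMod 5, f.eval x * g.eval x = x ^ 4 + 2 * x + 4 := by
    intro x
    rw [← Polynomial.eval_mul, hfg]
    simp
  have hcases : g.natDegree = 1 ∨ g.natDegree = 2 := by omega
  rcases hcases with h | h
  · have hge := Polynomial.eval_eq_sum_range (p := g) (-(g.coeff 0))
    have h1 : g.coeff 1 = 1 := by rw [← h]; exact hg
    rw [h] at hge
    simp [Finset.sum_range_succ, h1] at hge
    have hx := hroot (-(g.coeff 0))
    rw [hge, mul_zero] at hx
    generalize g.coeff 0 = z at hx
    revert z
    decide
  · have hf2 : f.natDegree = 2 := by omega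
    have hgc : g.coeff 2 = 1 := by rw [← h]; exact hg
    have hfc : f.coeff 2 = 1 := by rw [← hf2]; exact hf
    have hgs := g.as_sum_range_C_mul_X_pow
    have hfs := f.as_sum_range_C_mul_X_pow
    rw [h] at hgs
    rw [hf2] at hfs
    simp only [Finset.sum_range_succ, Finset.sum_range_zero, hgc, hfc] at hgs hfs
    generalize g.coeff 0 = w at hgs
    generalize g.coeff 1 = t at hgs
    generalize f.coeff 0 = v at hfs
    generalize f.coeff 1 = u at hfs
    have key : (Polynomial.X ^ 4 + Polynomial.C (u + t) * Polynomial.X ^ 3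
        + Polynomial.C (v + w + u * t) * Polynomial.X ^ 2
        + Polynomial.C (u * w + v * t) * Polynomial.X ^ 1 + Polynomial.C (v * w)
          : Polynomial (ZMod 5)) =
        Polynomial.X ^ 4 + Polynomial.C 2 * Polynomial.X ^ 1 + Polynomial.C 4 := by
      have e2 : (Polynomial.C 2 : Polynomial (ZMod 5)) = 2 := rfl
      have e4 : (Polynomial.C 4 : Polynomial (ZMod 5)) = 4 := rfl
      rw [e2, e4, pow_one, ← hfg, hgs, hfs]
      simp only [map_add, map_mul, map_one]
      ring
    have c0 := congrArg (fun p => Polynomial.coeff p 0) key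
    have c1 := congrArg (fun p => Polynomial.coeff p 1) key
    have c2 := congrArg (fun p => Polynomial.coeff p 2) key
    have c3 := congrArg (fun p => Polynomial.coeff p 3) key
    simp only [Polynomial.coeff_add, Polynomial.coeff_C_mul, Polynomial.coeff_X_pow,
      Polynomial.coeff_C] at c0 c1 c2 c3
    norm_num at c0 c1 c2 c3
    clear hgs hfs key hroot
    have ht : t = -u := by linear_combination c3
    subst ht
    clear c3
    revert u v w
    decide

theorem quartic_int :
    Irreducible (Polynomial.X ^ 4 - 8 * Polynomial.X + 4 : Polynomial ℤ) := by
  have hmon : (Polynomial.X ^ 4 - 8 * Polynomial.X + 4 : Polynomial ℤ).Monic := by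
    monicity!
  apply hmon.irreducible_of_irreducible_map (Int.castRingHom (ZMod 5))
  convert quartic_mod5 using 1
  simp only [Polynomial.map_add, Polynomial.map_sub, Polynomial.map_mul, Polynomial.map_pow,
    Polynomial.map_X, Polynomial.map_ofNat]
  have h10 : (10 : Polynomial (ZMod 5)) = 0 := by
    have : (Polynomial.C 10 : Polynomial (ZMod 5)) = Polynomial.C 0 := congrArg _ (by decide)
    rw [Polynomial.C_0] at this
    exact this
  linear_combination (-Polynomial.X) * h10

theorem quartic_rat :
    Irreducible (Polynomial.X ^ 4 - 8 * Polynomial.X + 4 : Polynomial ℚ) := by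
  have hmon : (Polynomial.X ^ 4 - 8 * Polynomial.X + 4 : Polynomial ℤ).Monic := by
    monicity!
  have h := (hmon.irreducible_iff_irreducible_map_fraction_map (K := ℚ)).1 quartic_int
  simpa using h

/-- The polynomial `F(x, m, a, b)` is irreducible in `ℚ[x, m, a, b]`. -/
theorem stmt_3 : Irreducible Fpoly := by
  rw [← MulEquiv.irreducible_iff (M := MvPolynomial (Fin 4) ℚ) (f := (finSuccEquiv ℚ 3).toMulEquiv)]
  change Irreducible (finSuccEquiv ℚ 3 Fpoly)
  have e1 : (1 : Fin 4) = Fin.succ 0 := rfl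
  have e2 : (2 : Fin 4) = Fin.succ 1 := rfl
  have e3 : (3 : Fin 4) = Fin.succ 2 := rfl
  have hF : finSuccEquiv ℚ 3 Fpoly = Polynomial.X ^ 4
      + Polynomial.C (4 * X 1 * (X 0) ^ 2 + 4 * X 2 * (X 0) ^ 2 - 6 * (X 0) ^ 4 - 2 * X 1 * X 2)
        * Polynomial.X ^ 2
      + Polynomial.C (8 * X 1 * X 2 * (X 0) ^ 2 - 8 * X 1 * (X 0) ^ 4 - 8 * X 2 * (X 0) ^ 4)
        * Polynomial.X
      + Polynomial.C (9 * (X 0) ^ 8 - 6 * X 1 * X 2 * (X 0) ^ 4 + (X 1) ^ 2 * (X 2) ^ 2) := by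
    unfold Fpoly
    rw [e1, e2, e3]
    simp only [map_add, map_sub, map_mul, map_pow, map_ofNat, finSuccEquiv_X_zero,
      finSuccEquiv_X_succ]
  rw [hF]
  apply Polynomial.Monic.irreducible_of_irreducible_map
    (MvPolynomial.eval (fun _ : Fin 3 => (1 : ℚ)))
  · monicity!
  · convert quartic_rat using 1
    simp only [Polynomial.map_add, Polynomial.map_sub, Polynomial.map_ofNat, Polynomial.map_mul, Polynomial.map_pow,
      Polynomial.map_X, Polynomial.map_C, map_add, map_sub, map_mul, map_pow, map_ofNat,
      MvPolynomial.eval_X, map_one]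
    ring
end

section
/- Let a and b be distinct coprime nonzero integers, and suppose that the two-variable polynomial F_{a,b}(x, m) = x⁴ + (4am² + 4bm² − 6m⁴ − 2ab)x² + (8abm² − 8am⁴ − 8bm⁴)x + (9m⁸ − 6abm⁴ + a²b²) is irreducible in ℚ[x, m]. Then the set of integer pairs (x, m) with F_{a,b}(x, m) = 0 is finite. -/
open MvPolynomial

/-- For fixed integers `a`, `b`, the two-variable polynomial `F_{a,b}(x, m)` over `ℚ`,
with `x = X 0`, `m = X 1`. -/
noncomputable def Fab (a b : ℤ) : MvPolynomial (Fin 2) ℚ :=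
  (X 0) ^ 4
    + (C (4 * (a : ℚ)) * (X 1) ^ 2 + C (4 * (b : ℚ)) * (X 1) ^ 2 - 6 * (X 1) ^ 4
        - C (2 * (a : ℚ) * b)) * (X 0) ^ 2
    + (C (8 * (a : ℚ) * b) * (X 1) ^ 2 - C (8 * (a : ℚ)) * (X 1) ^ 4
        - C (8 * (b : ℚ)) * (X 1) ^ 4) * X 0
    + (9 * (X 1) ^ 8 - C (6 * (a : ℚ) * b) * (X 1) ^ 4 + C ((a : ℚ) ^ 2 * b ^ 2))

namespace Polynomial

noncomputable def L1 (p : ℤ[X]) : ℝ := ∑ i ∈ p.support, |(p.coeff i : ℝ)|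

lemma L1_eq {p : ℤ[X]} {s : Finset ℕ} (h : p.support ⊆ s) : L1 p = ∑ i ∈ s, |(p.coeff i : ℝ)| := by
  unfold L1
  apply Finset.sum_subset h
  intro x _ hx
  simp [Polynomial.notMem_support_iff.mp hx]

lemma L1_nonneg (p : ℤ[X]) : 0 ≤ L1 p := Finset.sum_nonneg (fun _ _ => abs_nonneg _)

lemma L1_zero : L1 0 = 0 := by simp [L1]

lemma L1_add (p q : ℤ[X]) : L1 (p + q) ≤ L1 p + L1 q := by
  classical
  rw [L1_eq (Polynomial.support_add (p := p) (q := q)), L1_eq (Finset.subset_union_left (s₁ := p.support) (s₂ := q.support)),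
    L1_eq (Finset.subset_union_right (s₁ := p.support) (s₂ := q.support)), ← Finset.sum_add_distrib]
  apply Finset.sum_le_sum
  intro i _
  simp only [coeff_add, Int.cast_add]
  exact abs_add_le _ _

lemma L1_neg (p : ℤ[X]) : L1 (-p) = L1 p := by
  simp [L1]

lemma L1_sub (p q : ℤ[X]) : L1 (p - q) ≤ L1 p + L1 q := by
  rw [sub_eq_add_neg]
  exact (L1_add p (-q)).trans (by rw [L1_neg])

lemma L1_sum {ι : Type*} (s : Finset ι) (f : ι → ℤ[X]) : L1 (∑ i ∈ s, f i) ≤ ∑ i ∈ s, L1 (f i) := by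
  classical
  induction s using Finset.induction_on with
  | empty => simp [L1_zero]
  | insert a s ha ih =>
    rw [Finset.sum_insert ha, Finset.sum_insert ha]
    exact (L1_add _ _).trans (by linarith)

lemma L1_monomial (n : ℕ) (c : ℤ) : L1 (monomial n c) = |(c : ℝ)| := by
  rw [L1_eq (Polynomial.support_monomial_subset n c)]
  simp

lemma L1_C (c : ℤ) : L1 (C c) = |(c : ℝ)| := L1_monomial 0 c

lemma L1_monomial_mul (n : ℕ) (c : ℤ) (q : ℤ[X]) : L1 (monomial n c * q) ≤ |(c : ℝ)| * L1 q := by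
  classical
  have : monomial n c * q = ∑ i ∈ q.support, monomial (n + i) (c * q.coeff i) := by
    conv_lhs => rw [q.as_sum_support, Finset.mul_sum]
    simp [monomial_mul_monomial]
  rw [this]
  refine (L1_sum _ _).trans ?_
  rw [L1, Finset.mul_sum]
  apply Finset.sum_le_sum
  intro i _
  rw [L1_monomial, Int.cast_mul, abs_mul]

lemma L1_mul (p q : ℤ[X]) : L1 (p * q) ≤ L1 p * L1 q := by
  have : p * q = ∑ i ∈ p.support, monomial i (p.coeff i) * q := by
    conv_lhs => rw [p.as_sum_support, Finset.sum_mul]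
  rw [this]
  refine (L1_sum _ _).trans ?_
  rw [L1, Finset.sum_mul]
  exact Finset.sum_le_sum (fun i _ => L1_monomial_mul _ _ _)

lemma L1_one : L1 1 = 1 := by
  have := L1_C 1
  simpa using this

lemma L1_derivative (p : ℤ[X]) {d : ℕ} (hd : p.natDegree ≤ d) : L1 (derivative p) ≤ d * L1 p := by
  have : derivative p = ∑ i ∈ p.support, monomial (i - 1) (p.coeff i * i) := by
    conv_lhs => rw [p.as_sum_support]
    simp [derivative_monomial]
  rw [this]
  refine (L1_sum _ _).trans ?_
  rw [L1, Finset.mul_sum]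
  apply Finset.sum_le_sum
  intro i hi
  rw [L1_monomial]
  push_cast
  rw [abs_mul, mul_comm]
  have : (i:ℝ) ≤ d := by exact_mod_cast (le_natDegree_of_mem_supp i hi).trans hd
  rw [Nat.abs_cast]
  gcongr

lemma one_le_L1 {p : ℤ[X]} (hp : p ≠ 0) : 1 ≤ L1 p := by
  obtain ⟨i, hi⟩ := Polynomial.nonempty_support_iff.mpr hp
  have h1 : |(p.coeff i : ℝ)| ≤ L1 p := Finset.single_le_sum (f := fun i => |(p.coeff i : ℝ)|) (fun _ _ => abs_nonneg _) hi
  have h2 : 1 ≤ |p.coeff i| := Int.one_le_abs (mem_support_iff.mp hi)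
  have h3 : (1:ℝ) ≤ |(p.coeff i : ℝ)| := by exact_mod_cast h2
  linarith

lemma Z1 {A : ℤ[X]} (hA : A ≠ 0) {μ : ℤ} (hμ : μ ≠ 0) {E : ℕ} (h : (X - C μ) ^ E ∣ A) : |(μ:ℝ)| ^ E ≤ L1 A := by
  obtain ⟨q, rfl⟩ := h
  have hq : q ≠ 0 := right_ne_zero_of_mul hA
  have h1 : ((X - C μ) ^ E * q).trailingCoeff = (-μ) ^ E * q.trailingCoeff := by
    rw [trailingCoeff_mul]
    congr 1
    have h0 : ((X - C μ) ^ E).coeff 0 = (-μ) ^ E := by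
      rw [coeff_zero_eq_eval_zero]; simp
    have : ((X - C μ) ^ E).natTrailingDegree = 0 := by
      rw [natTrailingDegree_eq_zero]
      right
      rw [h0]; exact pow_ne_zero _ (neg_ne_zero.mpr hμ)
    rw [trailingCoeff, this, h0]
  have h2 : |(((X - C μ) ^ E * q).trailingCoeff : ℝ)| ≤ L1 ((X - C μ) ^ E * q) := by
    refine Finset.single_le_sum (f := fun i => |(((X - C μ) ^ E * q).coeff i : ℝ)|) (fun _ _ => abs_nonneg _) ?_
    exact natTrailingDegree_mem_support_of_nonzero hA
  rw [h1] at h2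
  have h3 : 1 ≤ |q.trailingCoeff| := Int.one_le_abs (by simpa using hq)
  have h4 : (1:ℝ) ≤ |(q.trailingCoeff : ℝ)| := by exact_mod_cast h3
  push_cast at h2
  rw [abs_mul, abs_pow, abs_neg] at h2
  nlinarith [pow_nonneg (abs_nonneg (μ:ℝ)) E]

lemma deg_eq_of_wronskian {H A : ℤ[X]} (hH : H ≠ 0) (hA : A ≠ 0)
    (h : derivative H * A = H * derivative A) : H.natDegree = A.natDegree := by
  -- compare coefficient at degree deg H + deg A - 1
  have key : ∀ p q : ℤ[X], (X * derivative p * q).coeff (p.natDegree + q.natDegree) = p.natDegree * p.leadingCoeff * q.leadingCoeff := by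
    intro p q
    have hd : (X * derivative p).natDegree ≤ p.natDegree := by
      by_cases hp : p.natDegree = 0
      · rw [natDegree_eq_zero.mp hp |>.choose_spec.symm]; simp
      refine natDegree_mul_le.trans ?_
      have := natDegree_derivative_le p
      rw [natDegree_X]; omega
    rw [coeff_mul_add_eq_of_natDegree_le hd le_rfl]
    congr 1
    rcases hp : p.natDegree with _ | n
    · simp
    · rw [mul_comm X, coeff_mul_X, coeff_derivative, leadingCoeff, hp]; push_cast; ring
  have h1 := key H A
  have h2 := key A H
  have h3 : X * derivative H * A = X * derivative A * H := by
    rw [mul_assoc, h]; ring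
  rw [h3, add_comm] at h1
  rw [h2] at h1
  have h4 : ((A.natDegree:ℤ) - H.natDegree) * (A.leadingCoeff * H.leadingCoeff) = 0 := by linear_combination h1
  rcases mul_eq_zero.mp h4 with h5 | h5
  · omega
  · simp [hA, hH] at h5

lemma prop_of_wronskian {H A : ℤ[X]} (hH : H ≠ 0) (hA : A ≠ 0)
    (h : derivative H * A = H * derivative A) : C A.leadingCoeff * H = C H.leadingCoeff * A := by
  by_contra hne
  have hW : C A.leadingCoeff * H - C H.leadingCoeff * A ≠ 0 := sub_ne_zero.mpr hne
  have hd := deg_eq_of_wronskian hH hA h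
  have hlH : H.leadingCoeff ≠ 0 := leadingCoeff_ne_zero.mpr hH
  have hlA : A.leadingCoeff ≠ 0 := leadingCoeff_ne_zero.mpr hA
  have h2 := deg_eq_of_wronskian hW hA (by
    simp only [derivative_sub, derivative_mul, derivative_C]
    linear_combination (C A.leadingCoeff) * h)
  have h3 : (C A.leadingCoeff * H - C H.leadingCoeff * A).leadingCoeff = 0 := by
    rw [leadingCoeff, h2, coeff_sub, coeff_C_mul, coeff_C_mul]
    nth_rw 1 [← hd]
    rw [coeff_natDegree, coeff_natDegree]; ring
  exact hW (leadingCoeff_eq_zero.mp h3)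

lemma dvd_of_dvd_C_mul {M A : ℤ[X]} (hM : M.Monic) {c : ℤ} (hc : c ≠ 0) (h : M ∣ C c * A) : M ∣ A := by
  rw [← modByMonic_eq_zero_iff_dvd hM] at h ⊢
  rw [← smul_eq_C_mul, smul_modByMonic] at h
  exact (smul_eq_zero.mp h).resolve_left hc

lemma Z2 {ι : Type*} (s : Finset ι) : ∀ (A : ι → ℤ[X]) (γ : ι → ℤ) (d : ℕ) (B : ℝ) (E : ℕ) (μ : ℤ),
    1 ≤ d → 1 ≤ B → 1 ≤ |(μ:ℝ)| → (∀ i ∈ s, L1 (A i) ≤ B) → (∀ i ∈ s, (A i).natDegree ≤ d) →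
    (∑ i ∈ s, C (γ i) * A i) ≠ 0 → (X - C μ) ^ E ∣ ∑ i ∈ s, C (γ i) * A i →
    |(μ:ℝ)| ^ E ≤ |(μ:ℝ)| ^ s.card * (4 * d * B) ^ (4 ^ s.card) := by
  classical
  induction s using Finset.induction_on with
  | empty => intro A γ d B E μ _ _ _ _ _ h; simp at h
  | insert a s ha ih =>
    intro A γ d B E μ hd hB hμ hL hdeg hH hdvd
    have hd' : (1:ℝ) ≤ d := by exact_mod_cast hd
    have hdB : (1:ℝ) ≤ d * B := by nlinarith
    have hX : 1 ≤ 4 * d * B := by nlinarith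
    have hμ0 : μ ≠ 0 := by rintro rfl; simp at hμ; linarith
    rw [Finset.card_insert_of_notMem ha]
    by_cases hAa : A a = 0
    · rw [Finset.sum_insert ha, hAa, mul_zero, zero_add] at hH hdvd
      have := ih A γ d B E μ hd hB hμ (fun i hi => hL i (Finset.mem_insert_of_mem hi)) (fun i hi => hdeg i (Finset.mem_insert_of_mem hi)) hH hdvd
      refine this.trans ?_
      gcongr <;> first | exact hμ | exact hX | omega
    set H := ∑ i ∈ insert a s, C (γ i) * A i with hHdef
    have hWr : derivative H * A a - H * derivative (A a) = ∑ i ∈ s, C (γ i) * (derivative (A i) * A a - A i * derivative (A a)) := by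
      rw [hHdef, derivative_sum, Finset.sum_mul, Finset.sum_mul, ← Finset.sum_sub_distrib, Finset.sum_insert ha]
      simp only [derivative_mul, derivative_C]
      rw [show ((0 * A a + C (γ a) * derivative (A a)) * A a - C (γ a) * A a * derivative (A a)) = 0 by ring, zero_add]
      apply Finset.sum_congr rfl
      intro i _
      ring
    by_cases hz : derivative H * A a - H * derivative (A a) = 0
    · have hp := prop_of_wronskian hH hAa (sub_eq_zero.mp hz)
      have h1 : (X - C μ) ^ E ∣ A a := by
        apply dvd_of_dvd_C_mul ((monic_X_sub_C μ).pow E) (leadingCoeff_ne_zero.mpr hH)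
        rw [← hp]
        exact hdvd.mul_left _
      have h2 := Z1 hAa hμ0 h1
      have h3 : L1 (A a) ≤ B := hL a (Finset.mem_insert_self _ _)
      have h4 : B ≤ 4 * d * B := by nlinarith
      have h5 : 4 * d * B ≤ (4 * d * B) ^ (4 ^ (s.card + 1)) := le_self_pow₀ hX (by positivity)
      have h6 : 1 ≤ |(μ:ℝ)| ^ (s.card + 1) := one_le_pow₀ hμ
      have h7 : (0:ℝ) ≤ (4 * d * B) ^ (4 ^ (s.card + 1)) := by positivity
      nlinarith
    · rcases E with _ | E
      · rw [pow_zero]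
        have h5 : 1 ≤ (4 * d * B) ^ (4 ^ (s.card + 1)) := one_le_pow₀ hX
        have h6 : 1 ≤ |(μ:ℝ)| ^ (s.card + 1) := one_le_pow₀ hμ
        nlinarith
      have hdv : (X - C μ) ^ E ∣ derivative H * A a - H * derivative (A a) := by
        obtain ⟨q, hq⟩ := hdvd
        refine dvd_sub ?_ ?_
        · apply Dvd.dvd.mul_right
          rw [hq, derivative_mul, derivative_X_sub_C_pow, Nat.add_sub_cancel]
          refine dvd_add ?_ ?_
          · exact ((Dvd.intro_left _ rfl)).mul_right _
          · exact (pow_dvd_pow _ (Nat.le_succ E)).mul_right _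
        · apply Dvd.dvd.mul_right
          rw [hq]
          exact (pow_dvd_pow _ (Nat.le_succ E)).mul_right _
      rw [hWr] at hz hdv
      have hAaB : L1 (A a) ≤ B := hL a (Finset.mem_insert_self _ _)
      have hAad := hdeg a (Finset.mem_insert_self _ _)
      have := ih (fun i => derivative (A i) * A a - A i * derivative (A a)) γ (2 * d) (2 * d * B ^ 2) E μ (by omega)
        (by nlinarith) hμ ?_ ?_ hz hdv
      · push_cast at this
        rw [show (4 * (2 * (d:ℝ)) * (2 * d * B ^ 2)) = (4 * d * B) ^ 2 by ring, ← pow_mul] at this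
        rw [pow_succ, pow_succ |(μ:ℝ)| s.card]
        have h5 : (4 * d * B) ^ (2 * 4 ^ s.card) ≤ (4 * d * B) ^ (4 ^ (s.card + 1)) := by
          apply pow_le_pow_right₀ hX
          rw [pow_succ]; omega
        calc |(μ:ℝ)| ^ E * |(μ:ℝ)| ≤ (|(μ:ℝ)| ^ s.card * (4 * d * B) ^ (2 * 4 ^ s.card)) * |(μ:ℝ)| := by gcongr
          _ ≤ (|(μ:ℝ)| ^ s.card * (4 * d * B) ^ (4 ^ (s.card + 1))) * |(μ:ℝ)| := by gcongr
          _ = _ := by ring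
      · intro i hi
        have hi1 := hL i (Finset.mem_insert_of_mem hi)
        have hi2 := hdeg i (Finset.mem_insert_of_mem hi)
        have e1 := L1_derivative (A i) hi2
        have e2 := L1_derivative (A a) hAad
        have e3 := L1_mul (derivative (A i)) (A a)
        have e4 := L1_mul (A i) (derivative (A a))
        have e5 := L1_sub (derivative (A i) * A a) (A i * derivative (A a))
        have n1 := L1_nonneg (A i)
        have n2 := L1_nonneg (A a)
        have n3 := L1_nonneg (derivative (A i))
        have n4 := L1_nonneg (derivative (A a))
        have f1 : L1 (derivative (A i)) * L1 (A a) ≤ (d * B) * B := by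
          gcongr; exact e1.trans (by gcongr)
        have f2 : L1 (A i) * L1 (derivative (A a)) ≤ B * (d * B) := by
          gcongr; exact e2.trans (by gcongr)
        nlinarith
      · intro i hi
        have hi2 := hdeg i (Finset.mem_insert_of_mem hi)
        have g1 := natDegree_derivative_le (A i)
        have g2 := natDegree_derivative_le (A a)
        refine (natDegree_sub_le _ _).trans (max_le (natDegree_mul_le.trans ?_) (natDegree_mul_le.trans ?_)) <;> omega

end Polynomial

namespace Polynomial

noncomputable def q2 (S P : ℤ) : ℤ[X] := C (4 * S) * X ^ 2 - C 6 * X ^ 4 - C (2 * P)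
noncomputable def q1 (S P : ℤ) : ℤ[X] := C (8 * P) * X ^ 2 - C (8 * S) * X ^ 4
noncomputable def q0 (P : ℤ) : ℤ[X] := C 9 * X ^ 8 - C (6 * P) * X ^ 4 + C (P ^ 2)

/-- the quartic as a polynomial in `x` over `ℤ[m]`. -/
noncomputable def FP (S P : ℤ) : ℤ[X][X] := X ^ 4 + C (q2 S P) * X ^ 2 + C (q1 S P) * X + C (q0 P)

noncomputable def comp4 {R : Type*} [CommRing R] (r2 r1 r0 : R) : Matrix (Fin 4) (Fin 4) R :=
  !![0, 0, 0, -r0; 1, 0, 0, -r1; 0, 1, 0, -r2; 0, 0, 1, 0]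

lemma comp4_zero {R : Type*} [CommRing R] (r2 r1 r0 : R) :
    aeval (comp4 r2 r1 r0) (X ^ 4 + C r2 * X ^ 2 + C r1 * X + C r0 : R[X]) = 0 := by
  simp only [map_add, map_mul, map_pow, aeval_X, aeval_C]
  have h2 : comp4 r2 r1 r0 ^ 2 = !![0, 0, -r0, 0; 0, 0, -r1, -r0; 1, 0, -r2, -r1; 0, 1, 0, -r2] := by
    rw [sq]; ext i j
    fin_cases i <;> fin_cases j <;> simp [comp4, Matrix.mul_apply, Fin.sum_univ_four]
  have h4 : comp4 r2 r1 r0 ^ 4 = (comp4 r2 r1 r0 ^ 2) * (comp4 r2 r1 r0 ^ 2) := by rw [← pow_add]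
  rw [h4, h2]
  ext i j
  fin_cases i <;> fin_cases j <;>
    simp [comp4, Matrix.mul_apply, Fin.sum_univ_four, Matrix.algebraMap_matrix_apply] <;> ring

lemma comp4_vec {R A : Type*} [CommRing R] [CommRing A] (σ : R →+* A) (r2 r1 r0 : R) (x : A)
    (hx : x ^ 4 + σ r2 * x ^ 2 + σ r1 * x + σ r0 = 0) (h : R[X]) :
    Matrix.vecMul (![1, x, x ^ 2, x ^ 3]) ((aeval (comp4 r2 r1 r0) h).map σ) =
      (h.eval₂ σ x) • ![1, x, x ^ 2, x ^ 3] := by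
  induction h using Polynomial.induction_on' with
  | add p q hp hq =>
    rw [map_add, Matrix.map_add σ (map_add σ), Matrix.vecMul_add, hp, hq, eval₂_add, add_smul]
  | monomial n c =>
    induction n with
    | zero =>
      rw [monomial_zero_left, aeval_C, eval₂_C]
      have : ((algebraMap R (Matrix (Fin 4) (Fin 4) R)) c).map σ = (σ c) • (1 : Matrix (Fin 4) (Fin 4) A) := by
        ext i j
        by_cases hij : i = j <;> simp [Matrix.algebraMap_matrix_apply, hij]
      rw [this, Matrix.vecMul_smul, Matrix.vecMul_one]
    | succ n ih =>
      rw [← monomial_mul_X, map_mul, aeval_X, Matrix.map_mul, ← Matrix.vecMul_vecMul, ih, eval₂_mul, eval₂_X,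
        Matrix.smul_vecMul, mul_smul]
      congr 1
      ext i
      fin_cases i <;> simp [comp4, Matrix.vecMul, dotProduct, Fin.sum_univ_four]
      · ring
      · ring
      · linear_combination (-1 : A) * hx

lemma comp4_det {R A : Type*} [CommRing R] [CommRing A] (σ : R →+* A) (r2 r1 r0 : R) (x : A)
    (hx : x ^ 4 + σ r2 * x ^ 2 + σ r1 * x + σ r0 = 0) (h : R[X]) :
    σ ((aeval (comp4 r2 r1 r0) h).det) = h.eval₂ σ x *
      Matrix.vecMul (![1, x, x ^ 2, x ^ 3]) (((aeval (comp4 r2 r1 r0) h).adjugate.map σ)) 0 := by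
  have h1 := congrArg (fun w => Matrix.vecMul w ((aeval (comp4 r2 r1 r0) h).adjugate.map σ)) (comp4_vec σ r2 r1 r0 x hx h)
  simp only [Matrix.vecMul_vecMul, ← Matrix.map_mul, Matrix.mul_adjugate, Matrix.smul_vecMul] at h1
  have h2 := congrFun h1 0
  rw [Pi.smul_apply, smul_eq_mul] at h2
  rw [← h2]
  simp [Matrix.vecMul, dotProduct, Fin.sum_univ_four]

lemma comp4_det_ne {R K : Type*} [CommRing R] [Field K] (σ : R →+* K) (hσ : Function.Injective σ) (r2 r1 r0 : R)
    (hirr : Irreducible ((X ^ 4 + C r2 * X ^ 2 + C r1 * X + C r0 : R[X]).map σ))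
    (h : R[X]) (h0 : h ≠ 0) (hd : h.natDegree < 4) : (aeval (comp4 r2 r1 r0) h).det ≠ 0 := by
  have hm : ((X ^ 4 + C r2 * X ^ 2 + C r1 * X + C r0 : R[X]).map σ) = (X ^ 4 + C (σ r2) * X ^ 2 + C (σ r1) * X + C (σ r0) : K[X]) := by
    simp
  rw [hm] at hirr
  have hdeg : (X ^ 4 + C (σ r2) * X ^ 2 + C (σ r1) * X + C (σ r0) : K[X]).natDegree = 4 := by
    compute_degree!
  have hh0 : h.map σ ≠ 0 := (Polynomial.map_ne_zero_iff hσ).mpr h0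
  have hc : IsCoprime (X ^ 4 + C (σ r2) * X ^ 2 + C (σ r1) * X + C (σ r0) : K[X]) (h.map σ) := by
    rw [hirr.coprime_iff_not_dvd]
    intro hdv
    have := natDegree_le_of_dvd hdv hh0
    rw [hdeg, natDegree_map_eq_of_injective hσ] at this
    omega
  obtain ⟨u, v, huv⟩ := hc
  have h1 := congrArg (aeval (comp4 (σ r2) (σ r1) (σ r0))) huv
  rw [map_add, map_mul, map_mul, comp4_zero, mul_zero, zero_add, map_one] at h1
  have hmap : aeval (comp4 (σ r2) (σ r1) (σ r0)) (h.map σ) = (aeval (comp4 r2 r1 r0) h).map σ := by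
    have hcm : comp4 (σ r2) (σ r1) (σ r0) = σ.mapMatrix (comp4 r2 r1 r0) := by
      ext i j; fin_cases i <;> fin_cases j <;> simp [comp4]
    rw [hcm, aeval_def, eval₂_map, aeval_def, ← RingHom.mapMatrix_apply, hom_eval₂]
    congr 1
    ext r i j
    by_cases hij : i = j <;> simp [Matrix.algebraMap_matrix_apply, hij]
  intro hdet
  have h2 := congrArg Matrix.det h1
  rw [Matrix.det_mul, hmap, ← RingHom.mapMatrix_apply, ← RingHom.map_det, hdet, map_zero, mul_zero, Matrix.det_one] at h2
  exact zero_ne_one h2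

lemma exists_field (a b : ℤ) (hirr : Irreducible (Fab a b)) :
    ∃ (K : Type) (_ : Field K) (σ : ℤ[X] →+* K), Function.Injective σ ∧ Irreducible ((FP (a + b) (a * b)).map σ) := by
  let τ : ℤ[X] →+* (MvPolynomial (Fin 1) ℚ) := eval₂RingHom (Int.castRingHom (MvPolynomial (Fin 1) ℚ)) (MvPolynomial.X 0)
  have hτ : Function.Injective τ := by
    have hcomp : ((MvPolynomial.aeval (fun _ : Fin 1 => (X : ℚ[X])) : MvPolynomial (Fin 1) ℚ →ₐ[ℚ] ℚ[X]) : MvPolynomial (Fin 1) ℚ →+* ℚ[X]).comp τ = mapRingHom (Int.castRingHom ℚ) := by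
      apply Polynomial.ringHom_ext
      · intro n; simp
      · simp [τ]
    apply Function.Injective.of_comp (f := ((MvPolynomial.aeval (fun _ : Fin 1 => (X : ℚ[X])) : MvPolynomial (Fin 1) ℚ →ₐ[ℚ] ℚ[X]) : MvPolynomial (Fin 1) ℚ →+* ℚ[X]))
    rw [← RingHom.coe_comp, hcomp]
    exact map_injective _ Int.cast_injective
  have hF : MvPolynomial.finSuccEquiv ℚ 1 (Fab a b) = (FP (a + b) (a * b)).map τ := by
    have h1 : (1 : Fin 2) = Fin.succ 0 := rfl
    have hC : ∀ r : ℚ, MvPolynomial.finSuccEquiv ℚ 1 (MvPolynomial.C r) = C (MvPolynomial.C r) := by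
      intro r
      have := RingHom.congr_fun (MvPolynomial.finSuccEquiv_comp_C_eq_C (R := ℚ) 1) r
      simp only [RingHom.comp_apply] at this
      rw [← this]
      exact (MvPolynomial.finSuccEquiv ℚ 1).apply_symm_apply _
    have hτX : τ X = MvPolynomial.X 0 := by simp [τ]
    have hτC : ∀ n : ℤ, τ (C n) = MvPolynomial.C (n : ℚ) := by intro n; simp [τ]
    unfold Fab FP q2 q1 q0
    rw [h1]
    simp only [map_add, map_sub, map_mul, map_pow, MvPolynomial.finSuccEquiv_X_zero, MvPolynomial.finSuccEquiv_X_succ, hC,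
      Polynomial.map_add, Polynomial.map_sub, Polynomial.map_mul, Polynomial.map_pow, Polynomial.map_X, Polynomial.map_C, hτX, hτC]
    simp only [← map_pow C, ← map_mul C, ← map_ofNat C]
    push_cast
    simp only [map_mul, map_add, map_pow]
    have e6 : (6 : MvPolynomial (Fin 1) ℚ) = MvPolynomial.C 6 := rfl
    have e9 : (9 : MvPolynomial (Fin 1) ℚ) = MvPolynomial.C 9 := rfl
    simp only [map_ofNat, map_mul, map_pow]
    ring
  have hFirr : Irreducible ((FP (a + b) (a * b)).map τ) := by
    rw [← hF]
    exact (MulEquiv.irreducible_iff (MvPolynomial.finSuccEquiv ℚ 1)).mpr hirr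
  have hmon : ((FP (a + b) (a * b)).map τ).Monic := by
    apply Monic.map
    unfold FP
    monicity!
  refine ⟨FractionRing (MvPolynomial (Fin 1) ℚ), inferInstance, (algebraMap (MvPolynomial (Fin 1) ℚ) (FractionRing (MvPolynomial (Fin 1) ℚ))).comp τ, ?_, ?_⟩
  · rw [RingHom.coe_comp]
    exact (IsFractionRing.injective (MvPolynomial (Fin 1) ℚ) (FractionRing (MvPolynomial (Fin 1) ℚ))).comp hτ
  · rw [← Polynomial.map_map]
    exact (Monic.irreducible_iff_irreducible_map_fraction_map hmon).mp hFirr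

end Polynomial

namespace Polynomial

noncomputable def MM (S P : ℤ) (h : ℤ[X][X]) : Matrix (Fin 4) (Fin 4) ℤ[X] :=
  aeval (comp4 (q2 S P) (q1 S P) (q0 P)) h

lemma L1_prod {ι : Type*} (s : Finset ι) (f : ι → ℤ[X]) : L1 (∏ i ∈ s, f i) ≤ ∏ i ∈ s, L1 (f i) := by
  classical
  induction s using Finset.induction_on with
  | empty => simp [L1_one]
  | insert a s ha ih =>
    rw [Finset.prod_insert ha, Finset.prod_insert ha]
    exact (L1_mul _ _).trans (mul_le_mul_of_nonneg_left ih (L1_nonneg _))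

lemma L1_det {T : Matrix (Fin 4) (Fin 4) ℤ[X]} {B : ℝ} (hB : ∀ i j, L1 (T i j) ≤ B) : L1 T.det ≤ 24 * B ^ 4 := by
  rw [Matrix.det_apply]
  refine (L1_sum _ _).trans ?_
  have : ∀ σ ∈ (Finset.univ : Finset (Equiv.Perm (Fin 4))), L1 (Equiv.Perm.sign σ • ∏ i, T (σ i) i) ≤ B ^ 4 := by
    intro σ _
    have h1 : L1 (Equiv.Perm.sign σ • ∏ i, T (σ i) i) = L1 (∏ i, T (σ i) i) := by
      rcases Int.units_eq_one_or (Equiv.Perm.sign σ) with h | h <;> rw [h]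
      · simp
      · rw [Units.neg_smul, one_smul, L1_neg]
    rw [h1]
    refine (L1_prod _ _).trans ?_
    refine (Finset.prod_le_prod (fun i _ => L1_nonneg _) (fun i _ => hB (σ i) i)).trans ?_
    simp
  refine (Finset.sum_le_sum this).trans ?_
  rw [Finset.sum_const, Finset.card_univ, Fintype.card_perm]
  simp [Nat.factorial]

lemma natDegree_det4 {T : Matrix (Fin 4) (Fin 4) ℤ[X]} {d : ℕ} (hd : ∀ i j, (T i j).natDegree ≤ d) : T.det.natDegree ≤ 4 * d := by
  rw [Matrix.det_apply]
  apply natDegree_sum_le_of_forall_le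
  intro σ _
  have h1 : (Equiv.Perm.sign σ • ∏ i, T (σ i) i).natDegree = (∏ i, T (σ i) i).natDegree := by
    rcases Int.units_eq_one_or (Equiv.Perm.sign σ) with h | h <;> rw [h]
    · simp
    · rw [Units.neg_smul, one_smul, natDegree_neg]
  rw [h1]
  refine (natDegree_prod_le _ _).trans ?_
  refine (Finset.sum_le_sum (fun i _ => hd (σ i) i)).trans ?_
  simp

lemma det_expand {J : Type*} [Fintype J] (S P : ℤ) (A : J → ℤ[X][X]) (γ : J → ℤ) :
    (MM S P (∑ j, C (C (γ j)) * A j)).det =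
      ∑ φ : Fin 4 → J, C (∏ i, γ (φ i)) * Matrix.det (fun i => MM S P (A (φ i)) i) := by
  classical
  have h1 : MM S P (∑ j, C (C (γ j)) * A j) = fun i => ∑ j, (C (γ j) : ℤ[X]) • MM S P (A j) i := by
    funext i
    ext1 k
    rw [MM, map_sum]
    simp only [map_mul, aeval_C, Matrix.sum_apply, Finset.sum_apply, Pi.smul_apply, Algebra.algebraMap_eq_smul_one, Matrix.smul_mul, one_mul, Matrix.smul_apply, smul_mul_assoc]
    rfl
  rw [h1]
  have h2 := (Matrix.detRowAlternating (R := ℤ[X]) (n := Fin 4)).toMultilinearMap.map_sum (fun i j => (C (γ j) : ℤ[X]) • MM S P (A j) i)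
  change Matrix.det _ = _ at h2
  rw [h2]
  apply Finset.sum_congr rfl
  intro φ _
  have h3 := (Matrix.detRowAlternating (R := ℤ[X]) (n := Fin 4)).toMultilinearMap.map_smul_univ (fun i => (C (γ (φ i)) : ℤ[X])) (fun i => MM S P (A (φ i)) i)
  rw [h3, map_prod]
  rfl

lemma MM_bound (S P : ℤ) : ∃ C0 : ℝ, ∃ D0 : ℕ, 1 ≤ C0 ∧ ∀ (h : ℤ[X][X]) (n : ℕ) (B : ℝ), h.natDegree < 4 →
    (∀ k, L1 (h.coeff k) ≤ B) → (∀ k, (h.coeff k).natDegree ≤ n) →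
    ∀ i j, L1 (MM S P h i j) ≤ C0 * B ∧ (MM S P h i j).natDegree ≤ n + D0 := by
  classical
  set W := comp4 (q2 S P) (q1 S P) (q0 P) with hW
  refine ⟨1 + ∑ k ∈ Finset.range 4, ∑ i, ∑ j, L1 ((W ^ k) i j), ∑ k ∈ Finset.range 4, ∑ i, ∑ j, ((W ^ k) i j).natDegree, ?_, ?_⟩
  · have : 0 ≤ ∑ k ∈ Finset.range 4, ∑ i, ∑ j, L1 ((W ^ k) i j) :=
      Finset.sum_nonneg (fun _ _ => Finset.sum_nonneg (fun _ _ => Finset.sum_nonneg (fun _ _ => L1_nonneg _)))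
    linarith
  intro h n B hd hB hn i j
  have hB0 : 0 ≤ B := (L1_nonneg _).trans (hB 0)
  have he : MM S P h i j = ∑ k ∈ Finset.range 4, h.coeff k * (W ^ k) i j := by
    rw [MM, aeval_eq_sum_range' hd, Matrix.sum_apply]
    simp [Matrix.smul_apply, hW]
  rw [he]
  have nn1 : ∀ k i, 0 ≤ ∑ j, L1 ((W ^ k) i j) := fun k i => Finset.sum_nonneg (fun _ _ => L1_nonneg _)
  constructor
  · refine (L1_sum _ _).trans ?_
    have : ∀ k ∈ Finset.range 4, L1 (h.coeff k * (W ^ k) i j) ≤ B * ∑ i, ∑ j, L1 ((W ^ k) i j) := by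
      intro k _
      refine (L1_mul _ _).trans ?_
      have e1 : L1 ((W ^ k) i j) ≤ ∑ j, L1 ((W ^ k) i j) :=
        Finset.single_le_sum (f := fun j => L1 ((W ^ k) i j)) (fun _ _ => L1_nonneg _) (Finset.mem_univ j)
      have e2 : ∑ j, L1 ((W ^ k) i j) ≤ ∑ i, ∑ j, L1 ((W ^ k) i j) :=
        Finset.single_le_sum (f := fun i => ∑ j, L1 ((W ^ k) i j)) (fun _ _ => nn1 _ _) (Finset.mem_univ i)
      exact mul_le_mul (hB k) (e1.trans e2) (L1_nonneg _) hB0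
    refine (Finset.sum_le_sum this).trans ?_
    rw [← Finset.mul_sum]
    nlinarith
  · apply natDegree_sum_le_of_forall_le
    intro k hk
    refine natDegree_mul_le.trans (add_le_add (hn k) ?_)
    have e1 : ((W ^ k) i j).natDegree ≤ ∑ j, ((W ^ k) i j).natDegree :=
        Finset.single_le_sum (f := fun j => ((W ^ k) i j).natDegree) (fun _ _ => Nat.zero_le _) (Finset.mem_univ j)
    have e2 : ∑ j, ((W ^ k) i j).natDegree ≤ ∑ i, ∑ j, ((W ^ k) i j).natDegree :=
        Finset.single_le_sum (f := fun i => ∑ j, ((W ^ k) i j).natDegree) (fun _ _ => Nat.zero_le _) (Finset.mem_univ i)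
    have e3 : ∑ i, ∑ j, ((W ^ k) i j).natDegree ≤ ∑ k ∈ Finset.range 4, ∑ i, ∑ j, ((W ^ k) i j).natDegree :=
        Finset.single_le_sum (f := fun k => ∑ i, ∑ j, ((W ^ k) i j).natDegree) (fun _ _ => Nat.zero_le _) hk
    exact e1.trans (e2.trans e3)

/-- irreducibility, in the form in which it is used. -/
def GoodSP (S P : ℤ) : Prop := ∀ h : ℤ[X][X], h ≠ 0 → h.natDegree < 4 → (MM S P h).det ≠ 0

lemma goodSP (a b : ℤ) (hirr : Irreducible (Fab a b)) : GoodSP (a + b) (a * b) := by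
  obtain ⟨K, _, σ, hσ, h⟩ := exists_field a b hirr
  intro g g0 gd
  exact comp4_det_ne σ hσ _ _ _ h g g0 gd

/-- zero estimate. -/
lemma zero_est (S P : ℤ) (hg : GoodSP S P) {J : Type*} [Fintype J] : ∃ C0 : ℝ, ∃ D0 : ℕ, 1 ≤ C0 ∧ ∀ (A : J → ℤ[X][X]) (γ : J → ℤ) (n : ℕ) (B : ℝ)
    (μ : ℤ) (E : ℕ), 1 ≤ B → 1 ≤ |(μ : ℝ)| →
    (∀ j, (A j).natDegree < 4) → (∀ j k, L1 ((A j).coeff k) ≤ B) → (∀ j k, ((A j).coeff k).natDegree ≤ n) →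
    (∑ j, C (C (γ j)) * A j) ≠ 0 → (X - C μ) ^ E ∣ (MM S P (∑ j, C (C (γ j)) * A j)).det →
    |(μ:ℝ)| ^ E ≤ |(μ:ℝ)| ^ (Fintype.card (Fin 4 → J)) * (((n + D0 + 1 : ℕ) : ℝ) * (C0 * B ^ 4)) ^ (4 ^ (Fintype.card (Fin 4 → J))) := by
  classical
  obtain ⟨C0, D0, hC0, hb⟩ := MM_bound S P
  refine ⟨16 * (24 * C0 ^ 4), D0, by nlinarith [one_le_pow₀ hC0 (n := 4)], ?_⟩
  intro A γ n B μ E hB hμ hdeg hL hn hne hdvd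
  have hdet : (MM S P (∑ j, C (C (γ j)) * A j)).det ≠ 0 := by
    apply hg _ hne
    rw [Nat.lt_iff_le_pred (by norm_num)]
    apply natDegree_sum_le_of_forall_le
    intro j _
    refine (natDegree_C_mul_le _ _).trans ?_
    have := hdeg j
    omega
  rw [det_expand] at hdet hdvd
  have := Z2 Finset.univ (fun φ : Fin 4 → J => Matrix.det (fun i => MM S P (A (φ i)) i)) (fun φ => ∏ i, γ (φ i)) (4 * (n + D0 + 1))
    (24 * (C0 * B) ^ 4) E μ (by omega) (by nlinarith [one_le_pow₀ (n := 4) (show 1 ≤ C0 * B by nlinarith)]) hμ ?_ ?_ hdet hdvd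
  · rw [Finset.card_univ] at this
    refine this.trans (le_of_eq ?_)
    congr 2
    push_cast
    ring
  · intro φ _
    apply L1_det
    intro i j
    exact (hb (A (φ i)) n B (hdeg _) (hL _) (hn _) i j).1
  · intro φ _
    refine (natDegree_det4 (d := n + D0) ?_).trans (by omega)
    intro i j
    exact (hb (A (φ i)) n B (hdeg _) (hL _) (hn _) i j).2

end Polynomial

namespace Polynomial

/-- evaluation at `m`, `x`. -/
noncomputable def EV {A : Type*} [CommRing A] (m x : A) : ℤ[X][X] →+* A :=
  eval₂RingHom (eval₂RingHom (Int.castRingHom A) m) x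

lemma EV_X {A : Type*} [CommRing A] (m x : A) : EV m x X = x := by simp [EV]
lemma EV_CX {A : Type*} [CommRing A] (m x : A) : EV m x (C X) = m := by simp [EV]
lemma EV_CC {A : Type*} [CommRing A] (m x : A) (c : ℤ) : EV m x (C (C c)) = c := by simp [EV]
lemma EV_map {A B : Type*} [CommRing A] [CommRing B] (f : A →+* B) (m x : A) (h : ℤ[X][X]) :
    f (EV m x h) = EV (f m) (f x) h := by
  have : f.comp (EV m x) = EV (f m) (f x) := by
    apply Polynomial.ringHom_ext'
    · apply Polynomial.ringHom_ext'
      · exact RingHom.ext_int _ _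
      · simp [EV]
    · simp [EV]
  rw [← this]; rfl

lemma EV_FP {A : Type*} [CommRing A] (m x : A) (S P : ℤ) : EV m x (FP S P) =
    x ^ 4 + (4 * S * m ^ 2 - 6 * m ^ 4 - 2 * P) * x ^ 2 + (8 * P * m ^ 2 - 8 * S * m ^ 4) * x + (9 * m ^ 8 - 6 * P * m ^ 4 + P ^ 2) := by
  simp only [FP, q2, q1, q0, map_add, map_sub, map_mul, map_pow, EV_X, EV_CX, EV_CC]
  push_cast
  simp [EV]

lemma EV_det {A : Type*} [CommRing A] (m x : A) (S P : ℤ) (hF : EV m x (FP S P) = 0) (h : ℤ[X][X]) :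
    eval₂ (Int.castRingHom A) m (MM S P h).det = EV m x h *
      Matrix.vecMul (![1, x, x ^ 2, x ^ 3]) ((MM S P h).adjugate.map (eval₂RingHom (Int.castRingHom A) m)) 0 := by
  refine comp4_det (eval₂RingHom (Int.castRingHom A) m) _ _ _ x ?_ h
  rw [← hF]
  simp [FP, EV]

lemma nonvan (S P : ℤ) (hg : GoodSP S P) : ∃ C0 : ℝ, 1 ≤ C0 ∧ ∀ (h : ℤ[X][X]) (B : ℝ) (μ ξ : ℤ), h ≠ 0 → h.natDegree < 4 →
    (∀ k, L1 (h.coeff k) ≤ B) → μ ≠ 0 → EV μ ξ (FP S P) = 0 → EV μ ξ h = 0 → |(μ:ℝ)| ≤ C0 * B ^ 4 := by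
  obtain ⟨C0, D0, hC0, hb⟩ := MM_bound S P
  refine ⟨24 * C0 ^ 4, by nlinarith [one_le_pow₀ hC0 (n := 4)], ?_⟩
  intro h B μ ξ h0 hd hB hμ hF hz
  have hdet := hg h h0 hd
  have hdv : (X - C μ) ^ 1 ∣ (MM S P h).det := by
    rw [pow_one, dvd_iff_isRoot, IsRoot]
    have := EV_det μ ξ S P hF h
    rw [hz, zero_mul] at this
    rw [← this, eval]
    congr 1
  have h1 := Z1 hdet hμ hdv
  rw [pow_one] at h1
  have h2 : L1 (MM S P h).det ≤ 24 * (C0 * B) ^ 4 := L1_det (fun i j => by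
    obtain ⟨n, hn⟩ : ∃ n, ∀ k, (h.coeff k).natDegree ≤ n := by
      refine ⟨∑ k ∈ h.support, (h.coeff k).natDegree, fun k => ?_⟩
      by_cases hk : k ∈ h.support
      · exact Finset.single_le_sum (f := fun k => (h.coeff k).natDegree) (fun _ _ => Nat.zero_le _) hk
      · simp [notMem_support_iff.mp hk]
    exact (hb h n B hd hB hn i j).1)
  calc _ ≤ _ := h1
    _ ≤ _ := h2
    _ = _ := by ring

noncomputable def QQ (S P : ℤ) (x1 : ℤ) : ℤ[X][X] :=
  X ^ 3 + X ^ 2 * C (C x1) + X * C (C x1) ^ 2 + C (C x1) ^ 3 + C (q2 S P) * (X + C (C x1)) + C (q1 S P)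

lemma div_gen (m1 x1 : ℤ) (h : ℤ[X][X]) (hz : EV m1 x1 h = 0) :
    ∃ β α : ℤ[X][X], h = (X - C (C x1)) * β + C (X - C m1) * α := by
  obtain ⟨β, hβ⟩ := X_sub_C_dvd_sub_C_eval (a := (C x1 : ℤ[X])) (p := h)
  have : (h.eval (C x1)).IsRoot m1 := by
    rw [IsRoot, ← hz]
    have : ((evalRingHom m1).comp (evalRingHom (C x1))) = EV m1 x1 := by
      apply Polynomial.ringHom_ext'
      · apply Polynomial.ringHom_ext'
        · exact RingHom.ext_int _ _
        · simp [EV]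
      · simp [EV]
    rw [← this]; rfl
  obtain ⟨α, hα⟩ := dvd_iff_isRoot.mpr this
  refine ⟨β, C α, ?_⟩
  rw [← C_mul, ← hα, ← hβ]; ring

lemma FP_div (S P m1 x1 : ℤ) (hF : EV m1 x1 (FP S P) = 0) :
    ∃ α : ℤ[X][X], FP S P = (X - C (C x1)) * QQ S P x1 + C (X - C m1) * α := by
  have : ((C x1) ^ 4 + q2 S P * (C x1) ^ 2 + q1 S P * C x1 + q0 P).IsRoot m1 := by
    rw [IsRoot, ← hF, EV_FP]
    simp [q2, q1, q0]
  obtain ⟨α, hα⟩ := dvd_iff_isRoot.mpr this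
  refine ⟨C α, ?_⟩
  rw [← C_mul, ← hα]
  simp only [FP, QQ, C_add, C_mul, C_pow]
  ring

lemma div_step (S P m1 x1 : ℤ) (hF : EV m1 x1 (FP S P) = 0) (h : ℤ[X][X]) (hz : EV m1 x1 h = 0) :
    ∃ h' : ℤ[X][X], FP S P ∣ QQ S P x1 * h - C (X - C m1) * h' := by
  obtain ⟨α', hα'⟩ := FP_div S P m1 x1 hF
  obtain ⟨β, α, hh⟩ := div_gen m1 x1 h hz
  refine ⟨QQ S P x1 * α - α' * β, β, ?_⟩
  rw [hα']
  conv_lhs => rw [hh]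
  ring

lemma div_chain (S P m1 x1 : ℤ) (hF : EV m1 x1 (FP S P) = 0) (h : ℤ[X][X]) (E : ℕ) :
    (∃ e < E, ∃ h' : ℤ[X][X], FP S P ∣ QQ S P x1 ^ e * h - C (X - C m1) ^ e * h' ∧ EV m1 x1 h' ≠ 0) ∨
    (∃ h' : ℤ[X][X], FP S P ∣ QQ S P x1 ^ E * h - C (X - C m1) ^ E * h') := by
  induction E with
  | zero => right; exact ⟨h, by simp⟩
  | succ E ih =>
    rcases ih with ⟨e, he, h', h1, h2⟩ | ⟨h', h1⟩
    · left; exact ⟨e, by omega, h', h1, h2⟩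
    · by_cases hz : EV m1 x1 h' = 0
      · right
        obtain ⟨h'', h2⟩ := div_step S P m1 x1 hF h' hz
        refine ⟨h'', ?_⟩
        have := dvd_add (h1.mul_left (QQ S P x1)) (h2.mul_left (C (X - C m1) ^ E))
        convert this using 1
        ring
      · left; exact ⟨E, by omega, h', h1, hz⟩

lemma EV_continuousAt (h : ℤ[X][X]) (f : ℂ → ℂ) (z : ℂ) (hf : ContinuousAt f z) :
    ContinuousAt (fun m => EV m (f m) h) z := by
  induction h using Polynomial.induction_on' with
  | add p q hp hq => simp only [map_add]; exact hp.add hq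
  | monomial n c =>
    simp only [← C_mul_X_pow_eq_monomial, map_mul, map_pow, EV_X]
    refine ContinuousAt.mul ?_ (hf.pow n)
    simp only [EV, coe_eval₂RingHom, eval₂_C]
    simp only [eval₂_eq_sum_range]
    fun_prop

lemma EV_differentiableAt (h : ℤ[X][X]) (f : ℂ → ℂ) (z : ℂ) (hf : DifferentiableAt ℂ f z) :
    DifferentiableAt ℂ (fun m => EV m (f m) h) z := by
  induction h using Polynomial.induction_on' with
  | add p q hp hq => simp only [map_add]; exact hp.add hq
  | monomial n c =>
    simp only [← C_mul_X_pow_eq_monomial, map_mul, map_pow, EV_X]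
    refine DifferentiableAt.mul ?_ (hf.pow n)
    simp only [EV, coe_eval₂RingHom, eval₂_C]
    simp only [eval₂_eq_sum_range]
    fun_prop

lemma order_det (S P m1 x1 : ℤ) (h h' : ℤ[X][X]) (E : ℕ) (f : ℂ → ℂ)
    (hd : FP S P ∣ QQ S P x1 ^ E * h - C (X - C m1) ^ E * h')
    (hf : ContinuousAt f m1) (hf1 : f m1 = x1) (hF : ∀ᶠ m in nhds (m1 : ℂ), EV m (f m) (FP S P) = 0)
    (hQ : EV m1 x1 (QQ S P x1) ≠ 0) : (X - C m1) ^ E ∣ (MM S P h).det := by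
  by_cases hdet : (MM S P h).det = 0
  · rw [hdet]; exact dvd_zero _
  obtain ⟨q, hq1, hq2⟩ := exists_eq_pow_rootMultiplicity_mul_and_not_dvd _ hdet m1
  set k := rootMultiplicity m1 (MM S P h).det
  by_cases hk : E ≤ k
  · rw [hq1]; exact (pow_dvd_pow _ hk).mul_right _
  exfalso
  push Not at hk
  have hq0 : eval₂ (Int.castRingHom ℂ) (m1 : ℂ) q ≠ 0 := by
    have : eval₂ (Int.castRingHom ℂ) (m1 : ℂ) q = ((q.eval m1 : ℤ) : ℂ) := by
      rw [← eq_intCast (Int.castRingHom ℂ) m1, eval₂_at_apply]; simp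
    rw [this]
    intro h0
    exact hq2 (dvd_iff_isRoot.mpr (by exact_mod_cast h0))
  have hQ0 : EV (m1:ℂ) (f m1) (QQ S P x1) ≠ 0 := by
    rw [hf1]
    have := EV_map (Int.castRingHom ℂ) m1 x1 (QQ S P x1)
    simp only [eq_intCast] at this
    rw [← this]
    exact_mod_cast hQ
  let w : ℂ → ℂ := fun m => Matrix.vecMul (![1, f m, f m ^ 2, f m ^ 3]) ((MM S P h).adjugate.map (eval₂RingHom (Int.castRingHom ℂ) m)) 0
  have hw : ContinuousAt w m1 := by
    simp only [w, Matrix.vecMul, dotProduct, Fin.sum_univ_four, Matrix.map_apply, coe_eval₂RingHom, eval₂_eq_sum_range]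
    simp
    fun_prop
  have hqc : ContinuousAt (fun m : ℂ => eval₂ (Int.castRingHom ℂ) m q) m1 := by
    simp only [eval₂_eq_sum_range]; fun_prop
  have heq : ∀ᶠ m in nhdsWithin (m1 : ℂ) {(m1 : ℂ)}ᶜ, eval₂ (Int.castRingHom ℂ) m q * EV m (f m) (QQ S P x1) ^ E =
      (m - m1) ^ (E - k) * (EV m (f m) h' * w m) := by
    filter_upwards [hF.filter_mono nhdsWithin_le_nhds, self_mem_nhdsWithin] with m hm hne
    have hne' : m - m1 ≠ 0 := sub_ne_zero.mpr hne
    have e1 := EV_det m (f m) S P hm h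
    have e2 : EV m (f m) (QQ S P x1) ^ E * EV m (f m) h = (m - m1) ^ E * EV m (f m) h' := by
      obtain ⟨r, hr⟩ := hd
      have := congrArg (EV m (f m)) hr
      rw [map_mul, hm, zero_mul] at this
      simp only [map_sub, map_mul, map_pow, EV_CX, EV_CC] at this
      linear_combination this
    rw [hq1] at e1
    simp only [eval₂_mul, eval₂_pow, eval₂_sub, eval₂_X, eval₂_C] at e1
    rw [eq_intCast (Int.castRingHom ℂ) m1] at e1
    change _ = _ * w m at e1
    apply mul_left_cancel₀ (pow_ne_zero k hne')
    rw [← mul_assoc, ← mul_assoc, ← pow_add, Nat.add_sub_cancel' hk.le]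
    linear_combination EV m (f m) (QQ S P x1) ^ E * e1 + w m * e2
  have l1 : Filter.Tendsto (fun m : ℂ => eval₂ (Int.castRingHom ℂ) m q * EV m (f m) (QQ S P x1) ^ E) (nhdsWithin (m1 : ℂ) {(m1 : ℂ)}ᶜ)
      (nhds (eval₂ (Int.castRingHom ℂ) m1 q * EV (m1:ℂ) (f m1) (QQ S P x1) ^ E)) :=
    (hqc.mul ((EV_continuousAt _ f _ hf).pow E)).tendsto.mono_left nhdsWithin_le_nhds
  have l2 : Filter.Tendsto (fun m : ℂ => (m - m1) ^ (E - k) * (EV m (f m) h' * w m)) (nhdsWithin (m1 : ℂ) {(m1 : ℂ)}ᶜ)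
      (nhds (((m1:ℂ) - m1) ^ (E - k) * (EV (m1:ℂ) (f m1) h' * w m1))) := by
    have hc : ContinuousAt (fun m : ℂ => (m - m1) ^ (E - k)) m1 := by fun_prop
    exact (hc.mul ((EV_continuousAt _ f _ hf).mul hw)).tendsto.mono_left nhdsWithin_le_nhds
  rw [sub_self, zero_pow (by omega), zero_mul] at l2
  have := tendsto_nhds_unique (l1.congr' heq) l2
  exact (mul_ne_zero hq0 (pow_ne_zero E hQ0)) this

end Polynomial

namespace Ser

variable {O : Type*} [CommRing O] (N : RingSeminorm O)

/-- weighted norm bound for power series. -/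
def Bd (R : ℝ) (p : PowerSeries O) (c : ℝ) : Prop := ∀ n, ∑ i ∈ Finset.range n, N (PowerSeries.coeff i p) * R ^ i ≤ c

variable {N}

lemma Bd.mono {R : ℝ} {p : PowerSeries O} {c d : ℝ} (h : Bd N R p c) (hcd : c ≤ d) : Bd N R p d :=
  fun n => (h n).trans hcd

lemma Bd.monoR {R R' : ℝ} (hR : 0 ≤ R) (hRR : R ≤ R') {p : PowerSeries O} {c : ℝ} (h : Bd N R' p c) : Bd N R p c :=
  fun n => le_trans (Finset.sum_le_sum (fun i _ => mul_le_mul_of_nonneg_left (pow_le_pow_left₀ hR hRR i) (apply_nonneg N _))) (h n)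

lemma Bd.nonneg {R : ℝ} {p : PowerSeries O} {c : ℝ} (h : Bd N R p c) : 0 ≤ c := by simpa using h 0

lemma Bd.add {R : ℝ} (hR : 0 ≤ R) {p q : PowerSeries O} {c d : ℝ} (hp : Bd N R p c) (hq : Bd N R q d) : Bd N R (p + q) (c + d) := by
  intro n
  refine le_trans ?_ (add_le_add (hp n) (hq n))
  rw [← Finset.sum_add_distrib]
  apply Finset.sum_le_sum
  intro i _
  rw [map_add, ← add_mul]
  exact mul_le_mul_of_nonneg_right (map_add_le_add N _ _) (pow_nonneg hR i)

lemma Bd.neg {R : ℝ} {p : PowerSeries O} {c : ℝ} (hp : Bd N R p c) : Bd N R (-p) c := by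
  intro n
  have := hp n
  simpa only [map_neg, map_neg_eq_map] using this

lemma Bd.zero (R : ℝ) : Bd N R (0 : PowerSeries O) 0 := by
  intro n; simp

lemma Bd.C {R : ℝ} (hR : 0 ≤ R) (o : O) : Bd N R (PowerSeries.C o) (N o) := by
  intro n
  rcases n with _ | n
  · simp
  rw [Finset.sum_range_succ']
  simp [PowerSeries.coeff_C]

lemma Bd.one {R : ℝ} (hR : 0 ≤ R) : Bd N R (1 : PowerSeries O) (N 1) := by
  have := Bd.C (N := N) hR (1 : O)
  rwa [map_one] at this

lemma Bd.X {R : ℝ} (hR : 0 ≤ R) : Bd N R (PowerSeries.X : PowerSeries O) (N 1 * R) := by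
  intro n
  have h1 : ∀ i ∈ Finset.range n, N (PowerSeries.coeff i (PowerSeries.X : PowerSeries O)) * R ^ i = if i = 1 then N 1 * R else 0 := by
    intro i _
    rw [PowerSeries.coeff_X]
    by_cases h : i = 1
    · simp [h]
    · simp [h]
  rw [Finset.sum_congr rfl h1, Finset.sum_ite_eq']
  split_ifs
  · exact le_rfl
  · exact mul_nonneg (apply_nonneg N _) hR

lemma Bd.mul {R : ℝ} (hR : 0 ≤ R) {p q : PowerSeries O} {c d : ℝ} (hp : Bd N R p c) (hq : Bd N R q d) : Bd N R (p * q) (c * d) := by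
  intro n
  have hc := hp.nonneg
  have h1 : ∀ i ∈ Finset.range n, N (PowerSeries.coeff i (p * q)) * R ^ i ≤
      ∑ x ∈ Finset.HasAntidiagonal.antidiagonal i, (N (PowerSeries.coeff x.1 p) * R ^ x.1) * (N (PowerSeries.coeff x.2 q) * R ^ x.2) := by
    intro i _
    rw [PowerSeries.coeff_mul]
    have : N (∑ x ∈ Finset.HasAntidiagonal.antidiagonal i, PowerSeries.coeff x.1 p * PowerSeries.coeff x.2 q) ≤ ∑ x ∈ Finset.HasAntidiagonal.antidiagonal i, N (PowerSeries.coeff x.1 p) * N (PowerSeries.coeff x.2 q) := by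
      refine (Finset.le_sum_of_subadditive N (map_zero N).le (map_add_le_add N) _ _).trans ?_
      exact Finset.sum_le_sum (fun x _ => map_mul_le_mul N _ _)
    refine (mul_le_mul_of_nonneg_right this (pow_nonneg hR i)).trans (le_of_eq ?_)
    rw [Finset.sum_mul]
    apply Finset.sum_congr rfl
    intro x hx
    rw [← Finset.HasAntidiagonal.mem_antidiagonal.mp hx, pow_add]
    ring
  refine (Finset.sum_le_sum h1).trans ?_
  rw [Finset.sum_sigma']
  have h2 : ∑ x ∈ (Finset.range n).sigma (fun i => Finset.HasAntidiagonal.antidiagonal i), (N (PowerSeries.coeff x.2.1 p) * R ^ x.2.1) * (N (PowerSeries.coeff x.2.2 q) * R ^ x.2.2)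
      ≤ ∑ y ∈ (Finset.range n ×ˢ Finset.range n), (N (PowerSeries.coeff y.1 p) * R ^ y.1) * (N (PowerSeries.coeff y.2 q) * R ^ y.2) := by
    have hinj : Set.InjOn (fun x : (_ : ℕ) × ℕ × ℕ => x.2) ((Finset.range n).sigma (fun i => Finset.HasAntidiagonal.antidiagonal i) : Finset ((_ : ℕ) × ℕ × ℕ)) := by
      rintro ⟨i, x⟩ hx ⟨j, y⟩ hy hxy
      simp only [Finset.coe_sigma, Set.mem_sigma_iff, Finset.mem_coe, Finset.HasAntidiagonal.mem_antidiagonal] at hx hy hxy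
      subst hxy
      have : i = j := by rw [← hx.2, ← hy.2]
      subst this; rfl
    rw [← Finset.sum_image (g := fun x : (_ : ℕ) × ℕ × ℕ => x.2) (f := fun y : ℕ × ℕ => (N (PowerSeries.coeff y.1 p) * R ^ y.1) * (N (PowerSeries.coeff y.2 q) * R ^ y.2)) hinj]
    apply Finset.sum_le_sum_of_subset_of_nonneg
    · intro y hy
      simp only [Finset.mem_image, Finset.mem_sigma, Finset.mem_range, Finset.HasAntidiagonal.mem_antidiagonal] at hy
      obtain ⟨x, ⟨h1, h2⟩, rfl⟩ := hy
      simp only [Finset.mem_product, Finset.mem_range]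
      omega
    · intro y _ _
      exact mul_nonneg (mul_nonneg (apply_nonneg N _) (pow_nonneg hR _)) (mul_nonneg (apply_nonneg N _) (pow_nonneg hR _))
  refine h2.trans ?_
  rw [Finset.sum_product]
  dsimp only
  rw [← Finset.sum_mul_sum]
  exact mul_le_mul (hp n) (hq n) (Finset.sum_nonneg fun i _ => mul_nonneg (apply_nonneg N _) (pow_nonneg hR _)) hc

lemma Bd.sum {R : ℝ} (hR : 0 ≤ R) {ι : Type*} (s : Finset ι) (f : ι → PowerSeries O) (c : ι → ℝ) (h : ∀ i ∈ s, Bd N R (f i) (c i)) :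
    Bd N R (∑ i ∈ s, f i) (∑ i ∈ s, c i) := by
  classical
  induction s using Finset.induction_on with
  | empty => simpa using Bd.zero R
  | insert a s ha ih =>
    rw [Finset.sum_insert ha, Finset.sum_insert ha]
    exact Bd.add hR (h a (Finset.mem_insert_self _ _)) (ih (fun i hi => h i (Finset.mem_insert_of_mem hi)))

lemma Bd.pow {R : ℝ} (hR : 0 ≤ R) (h1 : N 1 ≤ 1) {p : PowerSeries O} {c : ℝ} (hp : Bd N R p c) (n : ℕ) : Bd N R (p ^ n) (c ^ n) := by
  induction n with
  | zero => simpa using (Bd.one hR).mono h1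
  | succ n ih => rw [pow_succ, pow_succ]; exact Bd.mul hR ih hp

lemma Bd.coeff {R : ℝ} (hR : 0 ≤ R) {p : PowerSeries O} {c : ℝ} (hp : Bd N R p c) (i : ℕ) : N (PowerSeries.coeff i p) * R ^ i ≤ c :=
  le_trans (Finset.single_le_sum (f := fun i => N (PowerSeries.coeff i p) * R ^ i) (fun i _ => mul_nonneg (apply_nonneg N _) (pow_nonneg hR _))
    (Finset.self_mem_range_succ i)) (hp (i + 1))

variable (N)

/-- the ring of power series with finite weighted norm. -/
def good (R : ℝ) (hR : 0 ≤ R) : Subring (PowerSeries O) where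
  carrier := {p | ∃ c, Bd N R p c}
  mul_mem' := by rintro a b ⟨c, hc⟩ ⟨d, hd⟩; exact ⟨_, hc.mul hR hd⟩
  one_mem' := ⟨_, Bd.one hR⟩
  add_mem' := by rintro a b ⟨c, hc⟩ ⟨d, hd⟩; exact ⟨_, hc.add hR hd⟩
  zero_mem' := ⟨_, Bd.zero R⟩
  neg_mem' := by rintro a ⟨c, hc⟩; exact ⟨_, hc.neg⟩

variable {N}

lemma good_C {R : ℝ} (hR : 0 ≤ R) (o : O) : PowerSeries.C o ∈ good N R hR := ⟨_, Bd.C hR o⟩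
lemma good_X {R : ℝ} (hR : 0 ≤ R) : (PowerSeries.X : PowerSeries O) ∈ good N R hR := ⟨_, Bd.X hR⟩
lemma good_mono {R R' : ℝ} (hR : 0 ≤ R) (h : R ≤ R') (hR' : 0 ≤ R') {p : PowerSeries O} (hp : p ∈ good N R' hR') : p ∈ good N R hR := by
  obtain ⟨c, hc⟩ := hp
  exact ⟨c, hc.monoR hR h⟩

/-- fixed points of contractions. -/
lemma fix (h1 : N 1 ≤ 1) (κ : O) (w : PowerSeries O) (L : Polynomial (PowerSeries O)) (hw : w ∈ good N 1 zero_le_one)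
    (hL : ∀ i, L.coeff i ∈ good N 1 zero_le_one) : ∃ z : PowerSeries O, ∃ R : ℝ, ∃ hR : 0 < R, R ≤ 1 ∧ PowerSeries.X ∣ z ∧
      z = PowerSeries.C κ * z ^ 2 + PowerSeries.X * w * L.eval z ∧ z ∈ good N R hR.le := by
  classical
  obtain ⟨cw, hcw⟩ := hw
  choose cL hcL using hL
  have hcw0 := hcw.nonneg
  have hcL0 : ∀ i, 0 ≤ cL i := fun i => (hcL i).nonneg
  set K : ℝ := cw * ∑ i ∈ Finset.range (L.natDegree + 1), cL i with hK
  have hK0 : 0 ≤ K := mul_nonneg hcw0 (Finset.sum_nonneg fun i _ => hcL0 i)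
  have hκ0 : 0 ≤ N κ := apply_nonneg N _
  set r : ℝ := 1 / (2 * N κ + 1) with hr
  have hr0 : 0 < r := by positivity
  have hr1 : r ≤ 1 := by rw [hr, div_le_one (by positivity)]; linarith
  have hrκ : N κ * r ≤ 1 / 2 := by
    rw [hr, mul_one_div, div_le_iff₀ (by positivity)]; linarith
  set R : ℝ := r / (2 * K + 1) with hRdef
  have hR0 : 0 < R := by positivity
  have hRr : R ≤ r := by rw [hRdef]; exact div_le_self hr0.le (by linarith)
  have hR1 : R ≤ 1 := hRr.trans hr1
  have hRK : R * K ≤ r / 2 := by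
    rw [hRdef, div_mul_eq_mul_div, div_le_iff₀ (by positivity)]; nlinarith
  let Ψ : PowerSeries O → PowerSeries O := fun z => PowerSeries.C κ * z ^ 2 + PowerSeries.X * w * L.eval z
  have hΨB : ∀ z, Bd N R z r → Bd N R (Ψ z) r := by
    intro z hz
    have e1 : Bd N R (PowerSeries.C κ * z ^ 2) (N κ * r ^ 2) := (Bd.C hR0.le κ).mul hR0.le (hz.pow hR0.le h1 2)
    have e2 : Bd N R (L.eval z) (∑ i ∈ Finset.range (L.natDegree + 1), cL i) := by
      rw [Polynomial.eval_eq_sum_range]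
      apply Bd.sum hR0.le
      intro i _
      refine (((hcL i).monoR hR0.le hR1).mul hR0.le (hz.pow hR0.le h1 i)).mono ?_
      exact mul_le_of_le_one_right (hcL0 i) (pow_le_one₀ hr0.le hr1)
    have e3 : Bd N R (PowerSeries.X * w * L.eval z) (1 * R * cw * ∑ i ∈ Finset.range (L.natDegree + 1), cL i) :=
      ((((Bd.X hR0.le).mono (mul_le_mul_of_nonneg_right h1 hR0.le)).mul hR0.le (hcw.monoR hR0.le hR1)).mul hR0.le e2)
    refine (e1.add hR0.le e3).mono ?_
    have : 1 * R * cw * ∑ i ∈ Finset.range (L.natDegree + 1), cL i = R * K := by rw [hK]; ring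
    rw [this]
    nlinarith
  have hΨX : ∀ z, PowerSeries.X ∣ z → PowerSeries.X ∣ Ψ z := by
    intro z hz
    refine dvd_add ?_ ?_
    · rw [sq]; exact (hz.mul_right z).mul_left _
    · exact ((dvd_refl _).mul_right _).mul_right _
  have hΨd : ∀ k u v, PowerSeries.X ∣ u → PowerSeries.X ∣ v → PowerSeries.X ^ k ∣ u - v → PowerSeries.X ^ (k + 1) ∣ Ψ u - Ψ v := by
    intro k u v hu hv huv
    have e : Ψ u - Ψ v = PowerSeries.C κ * ((u - v) * (u + v)) + (L.eval u - L.eval v) * PowerSeries.X * w := by simp only [Ψ]; ring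
    rw [e, pow_succ]
    refine dvd_add ?_ ?_
    · exact (mul_dvd_mul huv (dvd_add hu hv)).mul_left _
    · exact (mul_dvd_mul (huv.trans (Polynomial.sub_dvd_eval_sub u v L)) (dvd_refl _)).mul_right _
  let zs : ℕ → PowerSeries O := fun k => Ψ^[k] 0
  have zs_succ : ∀ k, zs (k + 1) = Ψ (zs k) := fun k => Function.iterate_succ_apply' Ψ k 0
  have zsX : ∀ k, PowerSeries.X ∣ zs k := by
    intro k
    induction k with
    | zero => exact dvd_zero _
    | succ k ih => rw [zs_succ]; exact hΨX _ ih
  have zsB : ∀ k, Bd N R (zs k) r := by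
    intro k
    induction k with
    | zero => exact (Bd.zero R).mono hr0.le
    | succ k ih => rw [zs_succ]; exact hΨB _ ih
  have zsd : ∀ k, PowerSeries.X ^ (k + 1) ∣ zs (k + 1) - zs k := by
    intro k
    induction k with
    | zero => rw [zero_add, pow_one]; exact dvd_sub (zsX _) (zsX _)
    | succ k ih => rw [zs_succ (k + 1), zs_succ k]; rw [zs_succ k] at ih; exact hΨd _ _ _ (by rw [← zs_succ]; exact zsX _) (zsX _) ih
  have zst : ∀ k l, k ≤ l → PowerSeries.X ^ (k + 1) ∣ zs l - zs k := by
    intro k l hkl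
    induction l, hkl using Nat.le_induction with
    | base => simp
    | succ l hl ih =>
      have := dvd_add ((pow_dvd_pow _ (by omega)).trans (zsd l)) ih
      simpa using this
  let z : PowerSeries O := PowerSeries.mk (fun i => PowerSeries.coeff i (zs i))
  have hzk : ∀ k, PowerSeries.X ^ (k + 1) ∣ z - zs k := by
    intro k
    rw [PowerSeries.X_pow_dvd_iff]
    intro i hi
    rw [map_sub, PowerSeries.coeff_mk, sub_eq_zero]
    have := PowerSeries.X_pow_dvd_iff.mp (zst i k (by omega)) i (by omega)
    rw [map_sub, sub_eq_zero] at this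
    exact this.symm
  have hzX : PowerSeries.X ∣ z := by
    have := hzk 0
    simpa [zs] using this
  refine ⟨z, R, hR0, hR1, hzX, ?_, r, ?_⟩
  · have : z - Ψ z = 0 := by
      ext i
      have e : PowerSeries.X ^ (i + 1) ∣ z - Ψ z := by
        have a1 := (pow_dvd_pow PowerSeries.X (by omega : i + 1 ≤ i + 1 + 1)).trans (hzk (i + 1))
        have a2 := (pow_dvd_pow PowerSeries.X (by omega : i + 1 ≤ i + 1 + 1)).trans (hΨd _ _ _ hzX (zsX i) (hzk i))
        rw [zs_succ] at a1
        have := dvd_sub a1 a2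
        simpa using this
      simpa using PowerSeries.X_pow_dvd_iff.mp e i (by omega)
    exact sub_eq_zero.mp this
  · intro n
    have := zsB n n
    refine le_trans (le_of_eq ?_) this
    apply Finset.sum_congr rfl
    intro i hi
    rw [Finset.mem_range] at hi
    have := PowerSeries.X_pow_dvd_iff.mp (hzk n) i (by omega)
    rw [map_sub, sub_eq_zero] at this
    rw [this]

end Ser

namespace Ser

variable {O : Type*} [CommRing O] {N : RingSeminorm O}

/-- evaluation of a power series under an embedding. -/
noncomputable def ev (ρ : O →+* ℂ) (τ : ℂ) (p : PowerSeries O) : ℂ := ∑' i, ρ (PowerSeries.coeff i p) * τ ^ i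

lemma term_le {ρ : O →+* ℂ} (hρ : ∀ o, ‖ρ o‖ ≤ N o) {R : ℝ} {τ : ℂ} (hτ : ‖τ‖ ≤ R) (p : PowerSeries O) (i : ℕ) :
    ‖ρ (PowerSeries.coeff i p) * τ ^ i‖ ≤ N (PowerSeries.coeff i p) * R ^ i := by
  rw [norm_mul, norm_pow]
  exact mul_le_mul (hρ _) (pow_le_pow_left₀ (norm_nonneg _) hτ i) (by positivity) (apply_nonneg N _)

lemma Bd.summable {R : ℝ} (hR : 0 ≤ R) {p : PowerSeries O} {c : ℝ} (hp : Bd N R p c) :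
    Summable (fun i => N (PowerSeries.coeff i p) * R ^ i) :=
  summable_of_sum_range_le (fun i => mul_nonneg (apply_nonneg N _) (pow_nonneg hR i)) hp

lemma Bd.tsum_le {R : ℝ} (hR : 0 ≤ R) {p : PowerSeries O} {c : ℝ} (hp : Bd N R p c) :
    ∑' i, N (PowerSeries.coeff i p) * R ^ i ≤ c :=
  Real.tsum_le_of_sum_range_le (fun i => mul_nonneg (apply_nonneg N _) (pow_nonneg hR i)) hp

lemma ev_summable {ρ : O →+* ℂ} (hρ : ∀ o, ‖ρ o‖ ≤ N o) {R : ℝ} (hR : 0 ≤ R) {τ : ℂ} (hτ : ‖τ‖ ≤ R) {p : PowerSeries O}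
    (hp : p ∈ good N R hR) : Summable (fun i => ‖ρ (PowerSeries.coeff i p) * τ ^ i‖) := by
  obtain ⟨c, hc⟩ := hp
  exact Summable.of_nonneg_of_le (fun i => norm_nonneg _) (term_le hρ hτ p) (hc.summable hR)

lemma ev_vanish {ρ : O →+* ℂ} (hρ : ∀ o, ‖ρ o‖ ≤ N o) {R : ℝ} (hR : 0 < R) {τ : ℂ} (hτ : ‖τ‖ ≤ R) {p : PowerSeries O} {c : ℝ}
    (hp : Bd N R p c) {k : ℕ} (hk : ∀ i < k, PowerSeries.coeff i p = 0) : ‖ev ρ τ p‖ ≤ c * (‖τ‖ / R) ^ k := by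
  have hle : ∀ i, ‖ρ (PowerSeries.coeff i p) * τ ^ i‖ ≤ (N (PowerSeries.coeff i p) * R ^ i) * (‖τ‖ / R) ^ k := by
    intro i
    by_cases hi : i < k
    · rw [hk i hi]; simp
    · rw [norm_mul, norm_pow]
      have h1 : ‖τ‖ ^ i = R ^ i * (‖τ‖ / R) ^ i := by rw [← mul_pow]; field_simp
      have h2 : (‖τ‖ / R) ^ i ≤ (‖τ‖ / R) ^ k :=
        pow_le_pow_of_le_one (by positivity) (by rw [div_le_one hR]; exact hτ) (by omega)
      rw [h1, mul_assoc]
      exact mul_le_mul (hρ _) (mul_le_mul_of_nonneg_left h2 (by positivity)) (by positivity) (apply_nonneg N _)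
  have hs := (hp.summable hR.le).mul_right ((‖τ‖ / R) ^ k)
  refine (tsum_of_norm_bounded hs.hasSum hle).trans ?_
  rw [tsum_mul_right]
  exact mul_le_mul_of_nonneg_right (hp.tsum_le hR.le) (by positivity)

lemma ev_norm {ρ : O →+* ℂ} (hρ : ∀ o, ‖ρ o‖ ≤ N o) {R : ℝ} (hR : 0 < R) {τ : ℂ} (hτ : ‖τ‖ ≤ R) {p : PowerSeries O} {c : ℝ}
    (hp : Bd N R p c) : ‖ev ρ τ p‖ ≤ c := by
  simpa using ev_vanish hρ hR hτ hp (k := 0) (by simp)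

lemma ev_C (ρ : O →+* ℂ) (τ : ℂ) (o : O) : ev ρ τ (PowerSeries.C o) = ρ o := by
  rw [ev, tsum_eq_single 0]
  · simp
  · intro i hi; simp [PowerSeries.coeff_C, hi]

lemma ev_X (ρ : O →+* ℂ) (τ : ℂ) : ev ρ τ (PowerSeries.X) = τ := by
  rw [ev, tsum_eq_single 1]
  · simp
  · intro i hi; simp [PowerSeries.coeff_X, hi]

/-- evaluation as a ring homomorphism. -/
noncomputable def evHom {ρ : O →+* ℂ} (hρ : ∀ o, ‖ρ o‖ ≤ N o) {R : ℝ} (hR : 0 ≤ R) {τ : ℂ} (hτ : ‖τ‖ ≤ R) : good N R hR →+* ℂ where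
  toFun p := ev ρ τ p
  map_one' := by
    have := ev_C ρ τ 1
    rw [map_one, map_one] at this
    exact this
  map_zero' := by simp [ev]
  map_add' p q := by
    have hp := (ev_summable hρ hR hτ p.2).of_norm
    have hq := (ev_summable hρ hR hτ q.2).of_norm
    simp only [ev]
    rw [← hp.tsum_add hq]
    congr 1
    funext i
    simp [add_mul]
  map_mul' p q := by
    have hp := (ev_summable hρ hR hτ p.2)
    have hq := (ev_summable hρ hR hτ q.2)
    simp only [ev]
    rw [tsum_mul_tsum_eq_tsum_sum_antidiagonal_of_summable_norm hp hq]
    congr 1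
    funext i
    simp only [Subring.coe_mul, PowerSeries.coeff_mul, map_sum, map_mul, Finset.sum_mul]
    apply Finset.sum_congr rfl
    intro x hx
    rw [← Finset.HasAntidiagonal.mem_antidiagonal.mp hx, pow_add]
    ring

lemma evHom_apply {ρ : O →+* ℂ} (hρ : ∀ o, ‖ρ o‖ ≤ N o) {R : ℝ} (hR : 0 ≤ R) {τ : ℂ} (hτ : ‖τ‖ ≤ R) (p : good N R hR) :
    evHom hρ hR hτ p = ev ρ τ p := rfl

lemma ev_mul {ρ : O →+* ℂ} (hρ : ∀ o, ‖ρ o‖ ≤ N o) {R : ℝ} (hR : 0 ≤ R) {τ : ℂ} (hτ : ‖τ‖ ≤ R) {p q : PowerSeries O} (hp : p ∈ good N R hR) (hq : q ∈ good N R hR) : ev ρ τ (p * q) = ev ρ τ p * ev ρ τ q := by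
  have h := map_mul (evHom hρ hR hτ) ⟨p, hp⟩ ⟨q, hq⟩
  rw [evHom_apply, evHom_apply, evHom_apply, Subring.coe_mul] at h
  exact h
lemma ev_add {ρ : O →+* ℂ} (hρ : ∀ o, ‖ρ o‖ ≤ N o) {R : ℝ} (hR : 0 ≤ R) {τ : ℂ} (hτ : ‖τ‖ ≤ R) {p q : PowerSeries O} (hp : p ∈ good N R hR) (hq : q ∈ good N R hR) : ev ρ τ (p + q) = ev ρ τ p + ev ρ τ q := by
  have h := map_add (evHom hρ hR hτ) ⟨p, hp⟩ ⟨q, hq⟩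
  rw [evHom_apply, evHom_apply, evHom_apply, Subring.coe_add] at h
  exact h
lemma ev_sub {ρ : O →+* ℂ} (hρ : ∀ o, ‖ρ o‖ ≤ N o) {R : ℝ} (hR : 0 ≤ R) {τ : ℂ} (hτ : ‖τ‖ ≤ R) {p q : PowerSeries O} (hp : p ∈ good N R hR) (hq : q ∈ good N R hR) : ev ρ τ (p - q) = ev ρ τ p - ev ρ τ q := by
  have h := map_sub (evHom hρ hR hτ) ⟨p, hp⟩ ⟨q, hq⟩
  rw [evHom_apply, evHom_apply, evHom_apply, AddSubgroupClass.coe_sub] at h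
  exact h
lemma ev_pow {ρ : O →+* ℂ} (hρ : ∀ o, ‖ρ o‖ ≤ N o) {R : ℝ} (hR : 0 ≤ R) {τ : ℂ} (hτ : ‖τ‖ ≤ R) {p : PowerSeries O} (hp : p ∈ good N R hR) (n : ℕ) : ev ρ τ (p ^ n) = ev ρ τ p ^ n := by
  have h := map_pow (evHom hρ hR hτ) ⟨p, hp⟩ n
  rw [evHom_apply, evHom_apply, Subring.coe_pow] at h
  exact h
lemma ev_sum {ρ : O →+* ℂ} (hρ : ∀ o, ‖ρ o‖ ≤ N o) {R : ℝ} (hR : 0 ≤ R) {τ : ℂ} (hτ : ‖τ‖ ≤ R) {ι : Type*} (s : Finset ι) (f : ι → PowerSeries O) (hf : ∀ i, f i ∈ good N R hR) :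
    ev ρ τ (∑ i ∈ s, f i) = ∑ i ∈ s, ev ρ τ (f i) := by
  have := map_sum (evHom hρ hR hτ) (fun i => (⟨f i, hf i⟩ : good N R hR)) s
  simp only [evHom_apply] at this
  rw [← this]
  congr 1
  simp

lemma ev_differentiableOn {ρ : O →+* ℂ} (hρ : ∀ o, ‖ρ o‖ ≤ N o) {R : ℝ} (hR : 0 ≤ R) {p : PowerSeries O}
    (hp : p ∈ good N R hR) : DifferentiableOn ℂ (fun τ => ev ρ τ p) (Metric.ball 0 R) := by
  obtain ⟨c, hc⟩ := hp
  apply Complex.differentiableOn_tsum_of_summable_norm (hc.summable hR) (fun i => by fun_prop) Metric.isOpen_ball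
  intro i w hw
  exact term_le hρ (by simpa using (Metric.mem_ball.mp hw).le) p i

end Ser

namespace Polynomial

/-- bivariate polynomial with prescribed monomials. -/
noncomputable def bip {ι : Type*} [Fintype ι] (k l : ι → ℕ) (c : ι → ℤ) : ℤ[X][X] := ∑ i, monomial (k i) (monomial (l i) (c i))

lemma EV_bip {ι : Type*} [Fintype ι] (k l : ι → ℕ) (c : ι → ℤ) {A : Type*} [CommRing A] (m x : A) :
    EV m x (bip k l c) = ∑ i, (c i : A) * m ^ l i * x ^ k i := by
  rw [bip, map_sum]
  apply Finset.sum_congr rfl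
  intro i _
  rw [← C_mul_X_pow_eq_monomial, ← C_mul_X_pow_eq_monomial]
  simp only [map_mul, map_pow, EV_X, EV_CX, EV_CC]

lemma natDegree_bip {ι : Type*} [Fintype ι] {k l : ι → ℕ} {c : ι → ℤ} (hk : ∀ i, k i < 4) : (bip k l c).natDegree < 4 := by
  rw [Nat.lt_iff_le_pred (by norm_num)]
  apply natDegree_sum_le_of_forall_le
  intro i _
  refine (natDegree_monomial_le _).trans ?_
  have := hk i
  omega

lemma bip_coeff {ι : Type*} [Fintype ι] (k l : ι → ℕ) (c : ι → ℤ) (n : ℕ) :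
    (bip k l c).coeff n = ∑ i, if k i = n then monomial (l i) (c i) else 0 := by
  rw [bip, finsetSum_coeff]
  simp [coeff_monomial]

lemma L1_bip {ι : Type*} [Fintype ι] {k l : ι → ℕ} {c : ι → ℤ} {B : ℝ} (hc : ∀ i, |(c i : ℝ)| ≤ B) (n : ℕ) :
    L1 ((bip k l c).coeff n) ≤ Fintype.card ι * B := by
  rw [bip_coeff]
  refine (L1_sum _ _).trans ?_
  have : ∀ i ∈ Finset.univ, L1 (if k i = n then monomial (l i) (c i) else 0) ≤ B := by
    intro i _
    split_ifs
    · rw [L1_monomial]; exact hc i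
    · rw [L1_zero]; exact (abs_nonneg _).trans (hc i)
  refine (Finset.sum_le_sum this).trans ?_
  simp

lemma natDegree_bip_coeff {ι : Type*} [Fintype ι] {k l : ι → ℕ} {c : ι → ℤ} {d : ℕ} (hl : ∀ i, l i ≤ d) (n : ℕ) :
    ((bip k l c).coeff n).natDegree ≤ d := by
  rw [bip_coeff]
  apply natDegree_sum_le_of_forall_le
  intro i _
  split_ifs
  · exact (natDegree_monomial_le _).trans (hl i)
  · simp

lemma bip_ne_zero {ι : Type*} [Fintype ι] {k l : ι → ℕ} {c : ι → ℤ} (hinj : ∀ i j, k i = k j → l i = l j → i = j) (i : ι) (hi : c i ≠ 0) :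
    bip k l c ≠ 0 := by
  classical
  intro h
  apply hi
  have h1 : ((bip k l c).coeff (k i)).coeff (l i) = c i := by
    rw [bip_coeff, finsetSum_coeff, Finset.sum_eq_single i]
    · simp
    · intro j _ hj
      by_cases hk : k j = k i
      · rw [if_pos hk, coeff_monomial]
        by_cases hl : l j = l i
        · exact absurd (hinj _ _ hk hl) hj
        · simp [hl]
      · simp [hk]
    · simp
  rw [← h1, h]; simp

lemma bip_lin {ι J : Type*} [Fintype ι] [Fintype J] (k l : ι → ℕ) (c : J → ι → ℤ) (γ : J → ℤ) :
    ∑ j, C (C (γ j)) * bip k l (c j) = bip k l (fun i => ∑ j, γ j * c j i) := by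
  simp only [bip, Finset.mul_sum, map_sum]
  rw [Finset.sum_comm]
  refine Finset.sum_congr rfl fun i _ => Finset.sum_congr rfl fun j _ => ?_
  rw [C_mul_monomial, C_mul_monomial]

end Polynomial

namespace Ser

/-- exponents of the second-variable monomials. -/
abbrev JJ := {p : Fin 4 × Fin 7 // (p.2 : ℕ) + 2 * p.1 ≤ 6}

lemma card_JJ : Fintype.card JJ = 16 := by decide

variable {O : Type*} [CommRing O] {N : RingSeminorm O}

/-- the series of `t^(d+6) m^l x^k`. -/
noncomputable def PS (y : PowerSeries O) (δ d k l : ℕ) : PowerSeries O :=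
  (PowerSeries.C (δ : O) * PowerSeries.X) ^ (d + 6 - l - 2 * k) * y ^ k

lemma Nnat (hN1 : N 1 ≤ 1) (n : ℕ) : N (n : O) ≤ n := by
  induction n with
  | zero => simp
  | succ n ih =>
    push_cast
    exact (map_add_le_add N _ _).trans (add_le_add ih hN1)

lemma Nint (hN1 : N 1 ≤ 1) (n : ℤ) : N (n : O) ≤ |(n : ℝ)| := by
  rcases Int.eq_nat_or_neg n with ⟨k, rfl | rfl⟩
  · simpa using Nnat hN1 k
  · simpa using Nnat hN1 k

lemma Bd_PS (hN1 : N 1 ≤ 1) {R : ℝ} (hR : 0 ≤ R) (hR1 : R ≤ 1) {y : PowerSeries O} {Y : ℝ} (hY : 1 ≤ Y) (hy : Bd N R y Y) {δ : ℕ} (hδ : 1 ≤ δ)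
    {d k l : ℕ} (hk : k < 4) : Bd N R (PS y δ d k l) ((δ:ℝ) ^ (d + 6) * Y ^ 3) := by
  have hδ' : (1:ℝ) ≤ δ := by exact_mod_cast hδ
  have h1 : Bd N R (PowerSeries.C (δ : O) * PowerSeries.X) (δ : ℝ) := by
    refine ((Bd.C hR _).mul hR (Bd.X hR)).mono ?_
    have := Nnat hN1 δ
    have h2 : N 1 * R ≤ 1 := mul_le_one₀ hN1 hR hR1
    calc N (δ : O) * (N 1 * R) ≤ δ * 1 := mul_le_mul this h2 (mul_nonneg (apply_nonneg N _) hR) (by positivity)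
      _ = δ := mul_one _
  refine ((h1.pow hR hN1 _).mul hR (hy.pow hR hN1 k)).mono ?_
  gcongr <;> omega

section
attribute [local instance] Matrix.seminormedAddCommGroup
open Int.Matrix Matrix in
lemma siegel_step (hN1 : N 1 ≤ 1) (π : Fin 4 → O →+ ℤ) (hπ : ∀ o, (∀ c, π c o = 0) → o = 0) (hπN : ∀ c o, |(π c o : ℝ)| ≤ N o)
    {R : ℝ} (hR : 0 < R) (hR1 : R ≤ 1) (y : PowerSeries O) {Y : ℝ} (hY : 1 ≤ Y) (hy : Bd N R y Y) {δ : ℕ} (hδ : 1 ≤ δ) :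
    ∃ C2 : ℝ, 1 ≤ C2 ∧ ∀ ν : ℕ, 1 ≤ ν → ∃ t : JJ → (Fin 4 × Fin (6 * ν)) → ℤ, t ≠ 0 ∧ (∀ j i, |(t j i : ℝ)| ≤ C2 ^ ν) ∧
      ∀ r : ℕ, ∀ i < (13 - r) * ν, PowerSeries.coeff i (∑ j, ∑ s : Fin 4 × Fin (6 * ν),
        PowerSeries.C ((t j s : O) * PowerSeries.coeff r (PS y δ 0 j.1.1 j.1.2)) * PS y δ (6 * ν) s.1 s.2) = 0 := by
  classical
  set W : ℝ := (δ:ℝ) ^ 12 * Y ^ 3 with hW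
  have hδ' : (1:ℝ) ≤ δ := by exact_mod_cast hδ
  have hW1 : 1 ≤ W := one_le_mul_of_one_le_of_one_le (one_le_pow₀ hδ') (one_le_pow₀ hY)
  have hRi : 1 ≤ R⁻¹ := (one_le_inv₀ hR).mpr hR1
  set C1 : ℝ := W ^ 2 * R⁻¹ ^ 26 with hC1
  have hC11 : 1 ≤ C1 := one_le_mul_of_one_le_of_one_le (one_le_pow₀ hW1) (one_le_pow₀ hRi)
  refine ⟨(768 * C1) ^ 19, one_le_pow₀ (by linarith), ?_⟩
  intro ν hν
  let A : Matrix (Fin 4 × (Σ r : Fin 13, Fin ((13 - r) * ν))) (JJ × (Fin 4 × Fin (6 * ν))) ℤ :=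
    fun e v => π e.1 (PowerSeries.coeff e.2.1 (PS y δ 0 v.1.1.1 v.1.1.2) * PowerSeries.coeff e.2.2 (PS y δ (6 * ν) v.2.1 v.2.2))
  have hcoef : ∀ (d k l i : ℕ), k < 4 → N (PowerSeries.coeff i (PS y δ d k l)) ≤ (δ:ℝ) ^ (d + 6) * Y ^ 3 * R⁻¹ ^ i := by
    intro d k l i hk
    have := (Bd_PS hN1 hR.le hR1 hY hy hδ (d := d) (l := l) hk).coeff hR.le i
    rw [inv_pow, ← div_eq_mul_inv, le_div_iff₀ (by positivity)]
    exact this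
  have hA : ∀ e v, |((A e v : ℤ) : ℝ)| ≤ C1 ^ ν := by
    rintro ⟨c, r, i⟩ ⟨j, s⟩
    refine (hπN _ _).trans ((map_mul_le_mul N _ _).trans ?_)
    have h1 := hcoef 0 j.1.1 j.1.2 r j.1.1.2
    have h2 := hcoef (6 * ν) s.1 s.2 i s.1.2
    refine (mul_le_mul h1 h2 (apply_nonneg N _) (by positivity)).trans ?_
    have hi : (i:ℕ) ≤ 13 * ν := i.2.le.trans (Nat.mul_le_mul_right _ (by omega))
    have hr : (r:ℕ) ≤ 13 * ν := by have := r.2; nlinarith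
    have e1 : (δ:ℝ) ^ (0 + 6) * Y ^ 3 * R⁻¹ ^ (r:ℕ) ≤ W ^ ν * R⁻¹ ^ (13 * ν) := by
      have : (δ:ℝ) ^ (0 + 6) * Y ^ 3 ≤ W ^ ν := by
        refine le_trans ?_ (le_self_pow₀ hW1 (by omega))
        rw [hW]
        gcongr
        norm_num
      gcongr
    have e2 : (δ:ℝ) ^ (6 * ν + 6) * Y ^ 3 * R⁻¹ ^ (i:ℕ) ≤ W ^ ν * R⁻¹ ^ (13 * ν) := by
      have : (δ:ℝ) ^ (6 * ν + 6) * Y ^ 3 ≤ W ^ ν := by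
        rw [hW, mul_pow, ← pow_mul, ← pow_mul]
        gcongr <;> omega
      gcongr
    refine (mul_le_mul e1 e2 (by positivity) (by positivity)).trans (le_of_eq ?_)
    rw [hC1, mul_pow, ← pow_mul, ← pow_mul]; ring
  have card1 : Fintype.card (Fin 4 × (Σ r : Fin 13, Fin ((13 - r) * ν))) = 364 * ν := by
    rw [Fintype.card_prod, Fintype.card_sigma]
    simp only [Fintype.card_fin, ← Finset.sum_mul]
    have : ∑ r : Fin 13, (13 - (r:ℕ)) = 91 := by decide
    rw [this]; ring
  have card2 : Fintype.card (JJ × (Fin 4 × Fin (6 * ν))) = 384 * ν := by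
    rw [Fintype.card_prod, card_JJ, Fintype.card_prod, Fintype.card_fin, Fintype.card_fin]; ring
  obtain ⟨t, ht0, hAt, htn⟩ := Int.Matrix.exists_ne_zero_int_vec_norm_le A (by rw [card1, card2]; omega) (by rw [card1]; omega)
  rw [card1, card2] at htn
  have hν' : (1:ℝ) ≤ ν := by exact_mod_cast hν
  have hnA : max 1 ‖A‖ ≤ C1 ^ ν := by
    apply max_le (one_le_pow₀ hC11)
    rw [Matrix.norm_le_iff (by positivity)]
    intro e v
    rw [Int.norm_eq_abs]; exact hA e v
  have htn2 : ‖t‖ ≤ ((768 * C1) ^ 19) ^ ν := by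
    refine htn.trans ?_
    have b1 : (1:ℝ) ≤ ((384 * ν : ℕ) : ℝ) * max 1 ‖A‖ := by
      push_cast
      have : (1:ℝ) ≤ max 1 ‖A‖ := le_max_left _ _
      nlinarith
    have b2 : ((384 * ν : ℕ) : ℝ) * max 1 ‖A‖ ≤ (768 * C1) ^ ν := by
      have h2 : (ν:ℝ) ≤ 2 ^ ν := by exact_mod_cast (Nat.lt_two_pow_self).le
      have h3 : (384:ℝ) ≤ 384 ^ ν := le_self_pow₀ (by norm_num) (by omega)
      rw [show (768 * C1) = 384 * 2 * C1 by ring, mul_pow, mul_pow]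
      push_cast
      gcongr
    have b3 : ((364 * ν : ℕ) : ℝ) / (((384 * ν : ℕ) : ℝ) - ((364 * ν : ℕ) : ℝ)) ≤ (19 : ℕ) := by
      push_cast
      rw [div_le_iff₀ (by linarith)]; linarith
    calc _ ≤ (((384 * ν : ℕ) : ℝ) * max 1 ‖A‖) ^ ((19 : ℕ) : ℝ) := Real.rpow_le_rpow_of_exponent_le b1 b3
      _ = (((384 * ν : ℕ) : ℝ) * max 1 ‖A‖) ^ 19 := Real.rpow_natCast _ _
      _ ≤ ((768 * C1) ^ ν) ^ 19 := pow_le_pow_left₀ (by linarith) b2 19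
      _ = ((768 * C1) ^ 19) ^ ν := by rw [← pow_mul, ← pow_mul, mul_comm ν 19]
  refine ⟨fun j s => t (j, s), ?_, ?_, ?_⟩
  · intro h
    apply ht0
    funext v
    exact congrFun (congrFun h v.1) v.2
  · intro j s
    have := (norm_le_pi_norm t (j, s)).trans htn2
    rwa [Int.norm_eq_abs] at this
  · intro r i hi
    have hr : r < 13 := by
      by_contra hr
      rw [Nat.sub_eq_zero_of_le (by omega)] at hi; omega
    apply hπ
    intro c
    have h1 := congrFun hAt (c, ⟨⟨r, hr⟩, ⟨i, hi⟩⟩)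
    rw [Matrix.mulVec, dotProduct, Fintype.sum_prod_type] at h1
    rw [map_sum, map_sum]
    refine Eq.trans ?_ h1
    apply Finset.sum_congr rfl
    intro j _
    rw [map_sum, map_sum]
    apply Finset.sum_congr rfl
    intro s _
    rw [PowerSeries.coeff_C_mul, mul_assoc, ← zsmul_eq_mul, map_zsmul, smul_eq_mul, mul_comm]
end

end Ser

namespace Ser

variable {O : Type*} [CommRing O] {N : RingSeminorm O}

lemma ev_PS {ρ : O →+* ℂ} (hρ : ∀ o, ‖ρ o‖ ≤ N o) {R : ℝ} (hR : 0 ≤ R) {y : PowerSeries O} (hy : y ∈ good N R hR)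
    {δ : ℕ} (hδ : 1 ≤ δ) {m : ℂ} (hm : m ≠ 0) (hτ : ‖1 / ((δ : ℂ) * m)‖ ≤ R) {d k l : ℕ} (hl : l + 2 * k ≤ d + 6) :
    m ^ (d + 6) * ev ρ (1 / ((δ : ℂ) * m)) (PS y δ d k l) = m ^ l * (m ^ 2 * ev ρ (1 / ((δ : ℂ) * m)) y) ^ k := by
  have hδ' : (δ : ℂ) ≠ 0 := by exact_mod_cast (by omega : δ ≠ 0)
  have g1 : (PowerSeries.C (δ : O) * PowerSeries.X) ∈ good N R hR := mul_mem (good_C _ _) (good_X _)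
  rw [PS, ev_mul hρ hR hτ (pow_mem g1 _) (pow_mem hy _), ev_pow hρ hR hτ g1, ev_pow hρ hR hτ hy,
    ev_mul hρ hR hτ (good_C _ _) (good_X _), ev_C, ev_X, map_natCast]
  have h1 : (δ : ℂ) * (1 / (δ * m)) = m⁻¹ := by field_simp
  rw [h1]
  obtain ⟨u, hu⟩ := Nat.exists_eq_add_of_le hl
  have h2 : d + 6 - l - 2 * k = u := by omega
  rw [h2, hu, pow_add, pow_add, pow_mul, mul_pow]
  have h3 : m ^ u * m⁻¹ ^ u = 1 := by rw [← mul_pow, mul_inv_cancel₀ hm, one_pow]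
  linear_combination (m ^ l * (m ^ 2) ^ k * ev ρ (1 / ((δ : ℂ) * m)) y ^ k) * h3

lemma aux_bound {ρ : O →+* ℂ} (hN1 : N 1 ≤ 1) (hρ : ∀ o, ‖ρ o‖ ≤ N o) {R : ℝ} (hR : 0 < R) {J I : Type*} [Fintype J] [Fintype I]
    (G : J → PowerSeries O) (H : I → PowerSeries O) (t : J → I → ℤ) {T W0 W1 : ℝ} (hW1 : 0 ≤ W1)
    (hT0 : 0 ≤ T)
    (hG : ∀ j, Bd N R (G j) W0) (hH : ∀ i, Bd N R (H i) W1) (ht : ∀ j i, |(t j i : ℝ)| ≤ T) {ν : ℕ} {q : ℝ} (hq0 : 0 ≤ q) (hq1 : q ≤ 1)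
    (hv : ∀ r : ℕ, ∀ i < (13 - r) * ν, PowerSeries.coeff i (∑ j, ∑ s, PowerSeries.C ((t j s : O) * PowerSeries.coeff r (G j)) * H s) = 0)
    {τ1 τ2 : ℂ} (h1 : ‖τ1‖ / R ≤ q) (h2 : ‖τ2‖ / R ≤ q ^ ν) :
    ‖∑ j, ∑ s, (t j s : ℂ) * ev ρ τ2 (G j) * ev ρ τ1 (H s)‖ ≤ (Fintype.card J * W0) * ((Fintype.card I * T * W1) * q ^ (13 * ν)) := by
  have hτ1 : ‖τ1‖ ≤ R := by
    have := h1.trans hq1; rwa [div_le_one hR] at this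
  have hτ2 : ‖τ2‖ ≤ R := by
    have := h2.trans (pow_le_one₀ hq0 hq1); rwa [div_le_one hR] at this
  have gH : ∀ s, H s ∈ good N R hR.le := fun s => ⟨_, hH s⟩
  have gG : ∀ s, G s ∈ good N R hR.le := fun s => ⟨_, hG s⟩
  set φ : ℕ → PowerSeries O := fun r => ∑ j, ∑ s, PowerSeries.C ((t j s : O) * PowerSeries.coeff r (G j)) * H s with hφ
  have evφ : ∀ r, ev ρ τ1 (φ r) = ∑ j, ρ (PowerSeries.coeff r (G j)) * ∑ s, (t j s : ℂ) * ev ρ τ1 (H s) := by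
    intro r
    rw [hφ]
    simp only
    rw [ev_sum hρ hR.le hτ1 _ _ (fun j => sum_mem (fun s _ => mul_mem (good_C _ _) (gH s)))]
    apply Finset.sum_congr rfl
    intro j _
    rw [ev_sum hρ hR.le hτ1 _ _ (fun s => mul_mem (good_C _ _) (gH s)), Finset.mul_sum]
    apply Finset.sum_congr rfl
    intro s _
    rw [ev_mul hρ hR.le hτ1 (good_C _ _) (gH s), ev_C, map_mul, map_intCast]
    ring
  have hsum : HasSum (fun r => τ2 ^ r * ev ρ τ1 (φ r)) (∑ j, ∑ s, (t j s : ℂ) * ev ρ τ2 (G j) * ev ρ τ1 (H s)) := by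
    have : ∀ j ∈ (Finset.univ : Finset J), HasSum (fun r => (ρ (PowerSeries.coeff r (G j)) * τ2 ^ r) * ∑ s, (t j s : ℂ) * ev ρ τ1 (H s))
        (∑ s, (t j s : ℂ) * ev ρ τ2 (G j) * ev ρ τ1 (H s)) := by
      intro j _
      have h3 := ((ev_summable hρ hR.le hτ2 (gG j)).of_norm.hasSum).mul_right (∑ s, (t j s : ℂ) * ev ρ τ1 (H s))
      have e : (∑ s, (t j s : ℂ) * ev ρ τ2 (G j) * ev ρ τ1 (H s)) = ev ρ τ2 (G j) * ∑ s, (t j s : ℂ) * ev ρ τ1 (H s) := by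
        rw [Finset.mul_sum]
        apply Finset.sum_congr rfl
        intro s _
        ring
      rw [e]
      exact h3
    have e : (fun r => τ2 ^ r * ev ρ τ1 (φ r)) = fun r => ∑ j, (ρ (PowerSeries.coeff r (G j)) * τ2 ^ r) * ∑ s, (t j s : ℂ) * ev ρ τ1 (H s) := by
      funext r
      rw [evφ, Finset.mul_sum]
      apply Finset.sum_congr rfl
      intro j _
      ring
    rw [e]
    exact hasSum_sum this
  have hb : ∀ r, ‖τ2 ^ r * ev ρ τ1 (φ r)‖ ≤ (∑ j, N (PowerSeries.coeff r (G j)) * R ^ r) * ((Fintype.card I * T * W1) * q ^ (13 * ν)) := by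
    intro r
    have hB : Bd N R (φ r) (∑ j, ∑ s : I, T * N (PowerSeries.coeff r (G j)) * W1) := by
      apply Bd.sum hR.le
      intro j _
      apply Bd.sum hR.le
      intro s _
      refine ((Bd.C hR.le _).mul hR.le (hH s)).mono ?_
      gcongr
      refine (map_mul_le_mul N _ _).trans ?_
      gcongr
      exact (Nint hN1 _).trans (ht j s)
    have h3 := ev_vanish hρ hR hτ1 hB (hv r)
    have h4 : (‖τ1‖ / R) ^ ((13 - r) * ν) ≤ q ^ ((13 - r) * ν) := pow_le_pow_left₀ (by positivity) h1 _
    have h5 : ‖τ2‖ ^ r ≤ R ^ r * q ^ (ν * r) := by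
      rw [pow_mul, ← mul_pow]
      apply pow_le_pow_left₀ (norm_nonneg _)
      rw [div_le_iff₀ hR] at h2; linarith
    have h6 : q ^ (ν * r) * q ^ ((13 - r) * ν) ≤ q ^ (13 * ν) := by
      rw [← pow_add]
      apply pow_le_pow_of_le_one hq0 hq1
      rw [mul_comm ν r, ← add_mul]
      exact Nat.mul_le_mul_right _ (by omega)
    have hS : (∑ j, ∑ s : I, T * N (PowerSeries.coeff r (G j)) * W1) = (∑ j, N (PowerSeries.coeff r (G j))) * (Fintype.card I * T * W1) := by
      simp only [Finset.sum_const, Finset.card_univ, nsmul_eq_mul, Finset.sum_mul]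
      apply Finset.sum_congr rfl
      intro j _; ring
    rw [hS] at h3
    have hn : 0 ≤ ∑ j, N (PowerSeries.coeff r (G j)) := Finset.sum_nonneg (fun j _ => apply_nonneg N _)
    rw [norm_mul, norm_pow]
    calc ‖τ2‖ ^ r * ‖ev ρ τ1 (φ r)‖ ≤ (R ^ r * q ^ (ν * r)) * ((∑ j, N (PowerSeries.coeff r (G j))) * (Fintype.card I * T * W1) * q ^ ((13 - r) * ν)) := by
          refine mul_le_mul h5 (h3.trans ?_) (norm_nonneg _) (by positivity)
          gcongr
      _ = ((∑ j, N (PowerSeries.coeff r (G j))) * R ^ r * (Fintype.card I * T * W1)) * (q ^ (ν * r) * q ^ ((13 - r) * ν)) := by ring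
      _ ≤ ((∑ j, N (PowerSeries.coeff r (G j))) * R ^ r * (Fintype.card I * T * W1)) * q ^ (13 * ν) := by gcongr
      _ = _ := by rw [Finset.sum_mul]; ring
  have hs1 : Summable (fun r => ∑ j, N (PowerSeries.coeff r (G j)) * R ^ r) := summable_sum (fun j _ => (hG j).summable hR.le)
  rw [← hsum.tsum_eq]
  refine (tsum_of_norm_bounded (hs1.mul_right _).hasSum hb).trans ?_
  rw [tsum_mul_right]
  apply mul_le_mul_of_nonneg_right _ (by positivity)
  rw [Summable.tsum_finsetSum (fun j _ => (hG j).summable hR.le)]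
  refine (Finset.sum_le_sum (fun j _ => (hG j).tsum_le hR.le)).trans ?_
  simp

end Ser

namespace Ser

variable {O : Type*} [CommRing O] {N : RingSeminorm O}

/-- the branch function. -/
noncomputable def Xf (ρ : O →+* ℂ) (y : PowerSeries O) (δ : ℕ) (m : ℂ) : ℂ := m ^ 2 * ev ρ (1 / ((δ : ℂ) * m)) y

lemma num_lemma {M V : ℝ} {A B p ν : ℕ} (hM : 1 ≤ M) (hV : 1 ≤ V) (hν : 1 ≤ ν) (h : M ^ A ≤ M ^ B * V ^ ν) (hp : p * B + ν ≤ p * A) :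
    M ≤ V ^ p := by
  have h1 := pow_le_pow_left₀ (by positivity) h p
  rw [mul_pow, ← pow_mul, ← pow_mul, ← pow_mul] at h1
  have h2 : M ^ (B * p) * M ^ ν ≤ M ^ (B * p) * V ^ (ν * p) := by
    refine le_trans ?_ h1
    rw [← pow_add]
    apply pow_le_pow_right₀ hM
    rw [mul_comm B p, mul_comm A p]; exact hp
  have h3 : M ^ ν ≤ (V ^ p) ^ ν := by
    rw [← pow_mul, mul_comm p ν]
    exact le_of_mul_le_mul_left h2 (by positivity)
  exact le_of_pow_le_pow_left₀ (by omega) (by positivity) h3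

lemma tau_bound {R : ℝ} (hR : 0 < R) {δ : ℕ} (hδ : 1 ≤ δ) {m : ℂ} {b : ℝ} (hb : 0 < b) (hm : b ≤ ‖m‖) :
    ‖1 / ((δ : ℂ) * m)‖ / R ≤ 1 / (b * R) := by
  have hδ' : (1:ℝ) ≤ δ := by exact_mod_cast hδ
  rw [norm_div, norm_one, norm_mul, Complex.norm_natCast, div_div]
  apply one_div_le_one_div_of_le (by positivity)
  have : b ≤ δ * ‖m‖ := by nlinarith
  gcongr

lemma upper {ρ : O →+* ℂ} (hN1 : N 1 ≤ 1) (hρ : ∀ o, ‖ρ o‖ ≤ N o) {R : ℝ} (hR : 0 < R) (hR1 : R ≤ 1)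
    (y : PowerSeries O) {Y : ℝ} (hY : 1 ≤ Y) (hy : Bd N R y Y) {δ : ℕ} (hδ : 1 ≤ δ) {C2 : ℝ} (hC2 : 1 ≤ C2) :
    ∃ C3 : ℝ, 1 ≤ C3 ∧ ∀ ν : ℕ, 1 ≤ ν → ∀ t : JJ → (Fin 4 × Fin (6 * ν)) → ℤ, (∀ j i, |(t j i : ℝ)| ≤ C2 ^ ν) →
      (∀ r : ℕ, ∀ i < (13 - r) * ν, PowerSeries.coeff i (∑ j, ∑ s : Fin 4 × Fin (6 * ν),
        PowerSeries.C ((t j s : O) * PowerSeries.coeff r (PS y δ 0 j.1.1 j.1.2)) * PS y δ (6 * ν) s.1 s.2) = 0) →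
      ∀ (M : ℝ) (m m2 : ℂ), 2 / R ≤ M → M / 2 ≤ ‖m‖ → ‖m‖ ≤ 2 * M → M ^ ν ≤ ‖m2‖ → ‖m2‖ ≤ M ^ (ν + 1) →
      ‖∑ j, ∑ s, (t j s : ℂ) * (m2 ^ (j.1.2 : ℕ) * Xf ρ y δ m2 ^ (j.1.1 : ℕ)) * (m ^ (s.2 : ℕ) * Xf ρ y δ m ^ (s.1 : ℕ))‖ * M ^ ν ≤ C3 ^ ν * M ^ 12 := by
  have hδ' : (1:ℝ) ≤ δ := by exact_mod_cast hδ
  have hc : 1 ≤ 2 / R := by rw [le_div_iff₀ hR]; linarith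
  set c := 2 / R with hcdef
  set W := (δ:ℝ) ^ 12 * Y ^ 3 with hW
  have hW1 : 1 ≤ W := one_le_mul_of_one_le_of_one_le (one_le_pow₀ hδ') (one_le_pow₀ hY)
  have hC3 : 1 ≤ (2:ℝ) ^ 12 * (16 * W) * (48 * C2 * W) * c ^ 13 := by
    have : 1 ≤ c ^ 13 := one_le_pow₀ hc
    have h1 : 1 ≤ 48 * C2 * W := by nlinarith
    refine one_le_mul_of_one_le_of_one_le (one_le_mul_of_one_le_of_one_le ?_ h1) this
    linarith
  refine ⟨_, hC3, ?_⟩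
  intro ν hν t ht hv M m m2 hM hm hm' hm2 hm2'
  have hM0 : 0 < M := by linarith
  have hm0 : m ≠ 0 := by rw [← norm_pos_iff]; linarith
  have hm20 : m2 ≠ 0 := by rw [← norm_pos_iff]; exact lt_of_lt_of_le (by positivity) hm2
  have hq0 : 0 ≤ c / M := by positivity
  have hq1 : c / M ≤ 1 := by rw [div_le_one hM0]; exact hM
  have h1 : ‖1 / ((δ : ℂ) * m)‖ / R ≤ c / M := by
    refine (tau_bound hR hδ (b := M / 2) (by positivity) hm).trans (le_of_eq ?_)
    rw [hcdef]; field_simp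
  have h2 : ‖1 / ((δ : ℂ) * m2)‖ / R ≤ (c / M) ^ ν := by
    refine (tau_bound hR hδ (b := M ^ ν) (by positivity) hm2).trans ?_
    have : 1 / (M ^ ν * R) = (1 / R) / M ^ ν := by field_simp
    rw [this, div_pow]
    gcongr
    calc 1 / R ≤ c := by rw [hcdef]; gcongr; norm_num
      _ ≤ c ^ ν := le_self_pow₀ hc (by omega)
  have hτ1 : ‖1 / ((δ : ℂ) * m)‖ ≤ R := by
    have := h1.trans hq1; rwa [div_le_one hR] at this
  have hτ2 : ‖1 / ((δ : ℂ) * m2)‖ ≤ R := by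
    have := h2.trans (pow_le_one₀ hq0 hq1); rwa [div_le_one hR] at this
  have gy : y ∈ good N R hR.le := ⟨_, hy⟩
  have key := aux_bound hN1 hρ hR (fun j : JJ => PS y δ 0 j.1.1 j.1.2) (fun s : Fin 4 × Fin (6 * ν) => PS y δ (6 * ν) s.1 s.2) t
    (T := C2 ^ ν) (W0 := (δ:ℝ) ^ (0 + 6) * Y ^ 3) (W1 := (δ:ℝ) ^ (6 * ν + 6) * Y ^ 3) (by positivity) (by positivity)
    (fun j => Bd_PS hN1 hR.le hR1 hY hy hδ j.1.1.2) (fun s => Bd_PS hN1 hR.le hR1 hY hy hδ s.1.2) ht hq0 hq1 hv h1 h2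
  have e1 : (∑ j, ∑ s, (t j s : ℂ) * (m2 ^ (j.1.2 : ℕ) * Xf ρ y δ m2 ^ (j.1.1 : ℕ)) * (m ^ (s.2 : ℕ) * Xf ρ y δ m ^ (s.1 : ℕ)))
      = m2 ^ 6 * m ^ (6 * ν + 6) * ∑ j : JJ, ∑ s : Fin 4 × Fin (6 * ν), (t j s : ℂ) * ev ρ (1 / ((δ : ℂ) * m2)) (PS y δ 0 j.1.1 j.1.2) * ev ρ (1 / ((δ : ℂ) * m)) (PS y δ (6 * ν) s.1 s.2) := by
    rw [Finset.mul_sum]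
    refine Finset.sum_congr rfl fun j _ => ?_
    rw [Finset.mul_sum]
    refine Finset.sum_congr rfl fun s _ => ?_
    have a1 := ev_PS hρ hR.le gy hδ hm20 hτ2 (d := 0) (k := j.1.1) (l := j.1.2) (by have := j.2; omega)
    have a2 := ev_PS hρ hR.le gy hδ hm0 hτ1 (d := 6 * ν) (k := s.1) (l := s.2) (by have := s.1.2; have := s.2.2; omega)
    rw [Xf, Xf, ← a1, ← a2]
    ring
  rw [e1, norm_mul, norm_mul, norm_pow, norm_pow]
  have n1 : ‖m2‖ ^ 6 ≤ (M ^ (ν + 1)) ^ 6 := by gcongr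
  have n2 : ‖m‖ ^ (6 * ν + 6) ≤ (2 * M) ^ (6 * ν + 6) := by gcongr
  have hcard : (Fintype.card (Fin 4 × Fin (6 * ν)) : ℝ) = 24 * ν := by
    rw [Fintype.card_prod, Fintype.card_fin, Fintype.card_fin]; push_cast; ring
  rw [hcard, card_JJ] at key
  have w0 : (16:ℕ) * ((δ:ℝ) ^ (0 + 6) * Y ^ 3) ≤ (16 * W) ^ ν := by
    refine le_trans ?_ (le_self_pow₀ (by linarith) (by omega))
    rw [hW]
    push_cast
    gcongr
    norm_num
  have w1 : (24 * ν * C2 ^ ν * ((δ:ℝ) ^ (6 * ν + 6) * Y ^ 3)) ≤ (48 * C2 * W) ^ ν := by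
    have h2 : (ν:ℝ) ≤ 2 ^ ν := by exact_mod_cast (Nat.lt_two_pow_self).le
    have h3 : (24:ℝ) ≤ 24 ^ ν := le_self_pow₀ (by norm_num) (by omega)
    rw [show 48 * C2 * W = 24 * 2 * C2 * W by ring, mul_pow, mul_pow, mul_pow, hW, mul_pow, ← pow_mul, ← pow_mul]
    gcongr <;> omega
  have w2 : (2:ℝ) ^ (6 * ν + 6) ≤ (2 ^ 12) ^ ν := by
    rw [← pow_mul]; exact pow_le_pow_right₀ (by norm_num) (by omega)
  calc ‖m2‖ ^ 6 * ‖m‖ ^ (6 * ν + 6) * _ * M ^ ν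
      ≤ (M ^ (ν + 1)) ^ 6 * (2 * M) ^ (6 * ν + 6) * ((16 * W) ^ ν * ((48 * C2 * W) ^ ν * (c / M) ^ (13 * ν))) * M ^ ν := by
        refine mul_le_mul_of_nonneg_right (mul_le_mul (mul_le_mul n1 n2 (by positivity) (by positivity)) (key.trans ?_) (norm_nonneg _) (by positivity)) (by positivity)
        gcongr
    _ = 2 ^ (6 * ν + 6) * ((16 * W) ^ ν * (48 * C2 * W) ^ ν * (c ^ 13) ^ ν) * M ^ 12 * ((M ^ (13 * ν)) * (1 / M) ^ (13 * ν)) := by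
        rw [div_eq_mul_one_div c M, mul_pow c, mul_pow (2:ℝ) M, ← pow_mul, ← pow_mul]
        ring
    _ = 2 ^ (6 * ν + 6) * ((16 * W) ^ ν * (48 * C2 * W) ^ ν * (c ^ 13) ^ ν) * M ^ 12 := by
        rw [← mul_pow M (1 / M), mul_one_div_cancel hM0.ne', one_pow, mul_one]
    _ ≤ (2 ^ 12) ^ ν * ((16 * W) ^ ν * (48 * C2 * W) ^ ν * (c ^ 13) ^ ν) * M ^ 12 := by gcongr
    _ = _ := by simp only [mul_pow]; ring

lemma Q_bound (S P : ℤ) {Y : ℝ} (hY : 1 ≤ Y) : ∃ C5 : ℝ, 1 ≤ C5 ∧ ∀ (M : ℝ) (m x : ℂ) (x1 : ℤ), 1 ≤ M → ‖m‖ ≤ 2 * M → ‖x‖ ≤ 4 * Y * M ^ 2 →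
    ‖(x1 : ℂ)‖ ≤ 4 * Y * M ^ 2 → ‖Polynomial.EV m x (Polynomial.QQ S P x1)‖ ≤ C5 * M ^ 6 := by
  set s : ℝ := ‖(S : ℂ)‖
  set p : ℝ := ‖(P : ℂ)‖
  have hs : 0 ≤ s := norm_nonneg _
  have hp : 0 ≤ p := norm_nonneg _
  refine ⟨4 * (4 * Y) ^ 3 + (16 * s + 96 + 2 * p) * (8 * Y) + (32 * p + 128 * s), ?_, ?_⟩
  · have : 1 ≤ (4 * Y) ^ 3 := one_le_pow₀ (by linarith)
    have : 0 ≤ (16 * s + 96 + 2 * p) * (8 * Y) := by positivity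
    linarith
  · intro M m x x1 hM hm hx hx1
    have e : Polynomial.EV m x (Polynomial.QQ S P x1) = x ^ 3 + x ^ 2 * x1 + x * x1 ^ 2 + x1 ^ 3
        + (4 * S * m ^ 2 - 6 * m ^ 4 - 2 * P) * (x + x1) + (8 * P * m ^ 2 - 8 * S * m ^ 4) := by
      simp only [Polynomial.QQ, Polynomial.q2, Polynomial.q1, map_add, map_sub, map_mul, map_pow, Polynomial.EV_X, Polynomial.EV_CX, Polynomial.EV_CC]
      push_cast
      simp [Polynomial.EV]
    rw [e]
    have hMM : M ^ 2 ≤ M ^ 4 := pow_le_pow_right₀ hM (by norm_num)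
    have hM6 : M ^ 4 ≤ M ^ 6 := pow_le_pow_right₀ hM (by norm_num)
    have hM4 : 1 ≤ M ^ 4 := one_le_pow₀ hM
    set X1 : ℝ := 4 * Y * M ^ 2 with hX1
    have t1 : ‖x ^ 3‖ ≤ X1 ^ 3 := by rw [norm_pow]; gcongr
    have t2 : ‖x ^ 2 * x1‖ ≤ X1 ^ 2 * X1 := by rw [norm_mul, norm_pow]; gcongr
    have t3 : ‖x * x1 ^ 2‖ ≤ X1 * X1 ^ 2 := by rw [norm_mul, norm_pow]; gcongr
    have t4 : ‖(x1 : ℂ) ^ 3‖ ≤ X1 ^ 3 := by rw [norm_pow]; gcongr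
    have t5 : ‖x + x1‖ ≤ 2 * X1 := (norm_add_le _ _).trans (by linarith)
    have m2 : ‖m‖ ^ 2 ≤ (2 * M) ^ 2 := by gcongr
    have m4 : ‖m‖ ^ 4 ≤ (2 * M) ^ 4 := by gcongr
    have t6 : ‖4 * (S:ℂ) * m ^ 2 - 6 * m ^ 4 - 2 * P‖ ≤ (16 * s + 96 + 2 * p) * M ^ 4 := by
      refine (norm_sub_le _ _).trans ?_
      have := norm_sub_le (4 * (S:ℂ) * m ^ 2) (6 * m ^ 4)
      simp only [norm_mul, norm_pow, Complex.norm_ofNat] at *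
      nlinarith [mul_le_mul_of_nonneg_left m2 hs, mul_le_mul_of_nonneg_left hMM hs, mul_le_mul_of_nonneg_left hM4 hp]
    have t7 : ‖8 * (P:ℂ) * m ^ 2 - 8 * S * m ^ 4‖ ≤ (32 * p + 128 * s) * M ^ 6 := by
      refine (norm_sub_le _ _).trans ?_
      simp only [norm_mul, norm_pow, Complex.norm_ofNat] at *
      nlinarith [mul_le_mul_of_nonneg_left m2 hp, mul_le_mul_of_nonneg_left (hMM.trans hM6) hp, mul_le_mul_of_nonneg_left m4 hs, mul_le_mul_of_nonneg_left hM6 hs]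
    have t8 : ‖(4 * (S:ℂ) * m ^ 2 - 6 * m ^ 4 - 2 * P) * (x + x1)‖ ≤ (16 * s + 96 + 2 * p) * M ^ 4 * (2 * X1) := by
      rw [norm_mul]; gcongr
    refine (norm_add_le _ _).trans ?_
    have := norm_add_le (x ^ 3 + x ^ 2 * x1 + x * x1 ^ 2 + x1 ^ 3) ((4 * (S:ℂ) * m ^ 2 - 6 * m ^ 4 - 2 * P) * (x + x1))
    have := norm_add_le (x ^ 3 + x ^ 2 * x1 + x * x1 ^ 2) ((x1:ℂ) ^ 3)
    have := norm_add_le (x ^ 3 + x ^ 2 * x1) (x * x1 ^ 2)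
    have := norm_add_le (x ^ 3) (x ^ 2 * x1)
    have E : 4 * X1 ^ 3 + (16 * s + 96 + 2 * p) * M ^ 4 * (2 * X1) + (32 * p + 128 * s) * M ^ 6
      = (4 * (4 * Y) ^ 3 + (16 * s + 96 + 2 * p) * (8 * Y) + (32 * p + 128 * s)) * M ^ 6 := by rw [hX1]; ring
    rw [← E]
    linarith

end Ser

namespace Ser

variable {O : Type*} [CommRing O] {N : RingSeminorm O}

lemma EV_int_ne {m x : ℤ} {h : Polynomial (Polynomial ℤ)} (hne : Polynomial.EV m x h ≠ 0) : 1 ≤ ‖Polynomial.EV (m : ℂ) (x : ℂ) h‖ := by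
  have := Polynomial.EV_map (Int.castRingHom ℂ) m x h
  simp only [eq_intCast] at this
  rw [← this, Complex.norm_intCast]
  exact_mod_cast Int.one_le_abs hne

lemma EV_int_zero {m x : ℤ} {h : Polynomial (Polynomial ℤ)} (h0 : Polynomial.EV (m : ℂ) (x : ℂ) h = 0) : Polynomial.EV m x h = 0 := by
  by_contra hne
  have := EV_int_ne hne
  rw [h0, norm_zero] at this
  linarith

lemma maxmod (S P m1 x1 : ℤ) (f : ℂ → ℂ) (h h' : Polynomial (Polynomial ℤ)) (e : ℕ) {M Bh Bq : ℝ} (hM : (m1 : ℝ) = M) (hM0 : 0 < M)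
    (hd : ∀ m : ℂ, M / 2 ≤ ‖m‖ → DifferentiableAt ℂ f m) (hf1 : f m1 = x1)
    (hF : ∀ m : ℂ, M / 2 ≤ ‖m‖ → ‖m‖ ≤ 2 * M → Polynomial.EV m (f m) (Polynomial.FP S P) = 0)
    (hdv : Polynomial.FP S P ∣ Polynomial.QQ S P x1 ^ e * h - Polynomial.C (Polynomial.X - Polynomial.C m1) ^ e * h')
    (hne : Polynomial.EV m1 x1 h' ≠ 0)
    (hq : ∀ m : ℂ, M / 2 ≤ ‖m‖ → ‖m‖ ≤ 2 * M → ‖Polynomial.EV m (f m) (Polynomial.QQ S P x1)‖ ≤ Bq)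
    (hh : ∀ m : ℂ, M / 2 ≤ ‖m‖ → ‖m‖ ≤ 2 * M → ‖Polynomial.EV m (f m) h‖ ≤ Bh) :
    (M / 2) ^ e ≤ Bq ^ e * Bh := by
  have hn1 : ‖(m1 : ℂ)‖ = M := by
    rw [Complex.norm_intCast, hM, abs_of_pos hM0]
  have hball : ∀ m : ℂ, m ∈ Metric.closedBall (m1 : ℂ) (M / 2) → M / 2 ≤ ‖m‖ ∧ ‖m‖ ≤ 2 * M := by
    intro m hm
    rw [mem_closedBall_iff_norm] at hm
    have h1 := norm_sub_norm_le (m1 : ℂ) m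
    rw [norm_sub_rev] at h1
    have h2 := norm_sub_norm_le m (m1 : ℂ)
    constructor <;> linarith
  have hD : DifferentiableOn ℂ (fun m => Polynomial.EV m (f m) h') (Metric.closedBall (m1 : ℂ) (M / 2)) := by
    intro m hm
    exact (Polynomial.EV_differentiableAt h' f m (hd m (hball m hm).1)).differentiableWithinAt
  have hb : ∀ m ∈ frontier (Metric.ball (m1 : ℂ) (M / 2)), ‖Polynomial.EV m (f m) h'‖ ≤ Bq ^ e * Bh / (M / 2) ^ e := by
    intro m hm
    have hs := Metric.frontier_ball_subset_sphere hm
    obtain ⟨b1, b2⟩ := hball m (Metric.sphere_subset_closedBall hs)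
    rw [mem_sphere_iff_norm] at hs
    have h3 := map_dvd (Polynomial.EV m (f m)) hdv
    rw [hF m b1 b2, zero_dvd_iff, map_sub, map_mul, map_mul, map_pow, map_pow, map_sub, map_sub, Polynomial.EV_CX, Polynomial.EV_CC, sub_eq_zero] at h3
    have h4 := congrArg norm h3
    rw [norm_mul, norm_mul, norm_pow, norm_pow, hs] at h4
    rw [le_div_iff₀ (by positivity), mul_comm, ← h4]
    have := hq m b1 b2
    have := hh m b1 b2
    have : 0 ≤ Bq := (norm_nonneg _).trans (hq m b1 b2)
    gcongr
  have h5 := Complex.norm_le_of_forall_mem_frontier_norm_le Metric.isBounded_ball (hD.diffContOnCl_ball subset_rfl) hb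
    (z := (m1 : ℂ)) (subset_closure (Metric.mem_ball_self (by positivity)))
  simp only [hf1] at h5
  have h6 := (EV_int_ne hne).trans h5
  rwa [le_div_iff₀ (by positivity), one_mul] at h6

lemma Xf_diff {ρ : O →+* ℂ} (hρ : ∀ o, ‖ρ o‖ ≤ N o) {R : ℝ} (hR : 0 < R) {y : PowerSeries O} (hy : y ∈ good N R hR.le)
    {δ : ℕ} {m : ℂ} (hδ : 1 ≤ δ) (hm : m ≠ 0) (hτ : ‖1 / ((δ : ℂ) * m)‖ < R) : DifferentiableAt ℂ (Xf ρ y δ) m := by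
  have hδ' : (δ : ℂ) ≠ 0 := by exact_mod_cast (by omega : δ ≠ 0)
  have h1 : DifferentiableAt ℂ (fun τ => ev ρ τ y) (1 / ((δ : ℂ) * m)) :=
    (ev_differentiableOn hρ hR.le hy).differentiableAt (Metric.isOpen_ball.mem_nhds (by simpa using hτ))
  have h2 : DifferentiableAt ℂ (fun m : ℂ => 1 / ((δ : ℂ) * m)) m :=
    (differentiableAt_const _).div (by fun_prop) (mul_ne_zero hδ' hm)
  have h3 : DifferentiableAt ℂ (fun m : ℂ => ev ρ (1 / ((δ : ℂ) * m)) y) m := DifferentiableAt.comp (g := fun τ => ev ρ τ y) m h1 h2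
  exact (differentiableAt_pow 2).mul h3

lemma Xf_norm {ρ : O →+* ℂ} (hρ : ∀ o, ‖ρ o‖ ≤ N o) {R : ℝ} (hR : 0 < R) {y : PowerSeries O} {Y : ℝ} (hy : Bd N R y Y)
    {δ : ℕ} {m : ℂ} {M : ℝ} (hm : ‖m‖ ≤ 2 * M) (hτ : ‖1 / ((δ : ℂ) * m)‖ ≤ R) : ‖Xf ρ y δ m‖ ≤ 4 * Y * M ^ 2 := by
  rw [Xf, norm_mul, norm_pow]
  calc ‖m‖ ^ 2 * ‖ev ρ (1 / ((δ : ℂ) * m)) y‖ ≤ (2 * M) ^ 2 * Y := by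
        have := ev_norm hρ hR hτ hy
        gcongr
    _ = _ := by ring

lemma h_ne_zero (S P : ℤ) {C0 C2 : ℝ} (hC0 : 1 ≤ C0) (hC2 : 1 ≤ C2)
    (hnv : ∀ (h : Polynomial (Polynomial ℤ)) (B : ℝ) (μ ξ : ℤ), h ≠ 0 → h.natDegree < 4 → (∀ k, (h.coeff k).L1 ≤ B) → μ ≠ 0 →
      Polynomial.EV μ ξ (Polynomial.FP S P) = 0 → Polynomial.EV μ ξ h = 0 → |(μ : ℝ)| ≤ C0 * B ^ 4)
    {ν : ℕ} (hν : 1 ≤ ν) (t : JJ → (Fin 4 × Fin (6 * ν)) → ℤ) (ht0 : t ≠ 0) (ht : ∀ j i, |(t j i : ℝ)| ≤ C2 ^ ν)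
    (m2 x2 : ℤ) (hF : Polynomial.EV m2 x2 (Polynomial.FP S P) = 0) {M : ℝ} (hM : C0 * (16 * C2) ^ 4 < M) (hm2 : M ^ ν ≤ m2) :
    ∑ j : JJ, Polynomial.C (Polynomial.C (m2 ^ (j.1.2 : ℕ) * x2 ^ (j.1.1 : ℕ))) * Polynomial.bip (fun s => (s.1 : ℕ)) (fun s => (s.2 : ℕ)) (t j) ≠ 0 := by
  have hM0 : 0 < M := lt_of_le_of_lt (by positivity) hM
  obtain ⟨j0, hj0⟩ := Function.ne_iff.mp ht0
  obtain ⟨s0, hs0⟩ := Function.ne_iff.mp hj0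
  rw [Polynomial.bip_lin]
  apply Polynomial.bip_ne_zero (i := s0)
  · intro i j h1 h2
    exact Prod.ext (Fin.ext h1) (Fin.ext h2)
  · intro hz
    set g := Polynomial.bip (fun j : JJ => (j.1.1 : ℕ)) (fun j : JJ => (j.1.2 : ℕ)) (fun j => t j s0) with hg
    have hg0 : g ≠ 0 := by
      apply Polynomial.bip_ne_zero (i := j0)
      · intro i j h1 h2
        exact Subtype.ext (Prod.ext (Fin.ext h1) (Fin.ext h2))
      · exact hs0
    have hz2 : Polynomial.EV m2 x2 g = 0 := by
      rw [hg, Polynomial.EV_bip, ← hz]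
      refine Finset.sum_congr rfl fun j _ => ?_
      simp only [Int.cast_id]; ring
    have hm0 : m2 ≠ 0 := by
      intro h
      have h1 : (0:ℝ) < m2 := lt_of_lt_of_le (by positivity) hm2
      rw [h] at h1; simp at h1
    have hb := hnv g (16 * C2 ^ ν) m2 x2 hg0 (Polynomial.natDegree_bip (fun j => j.1.1.2)) (fun k => by
      have := Polynomial.L1_bip (k := fun j : JJ => (j.1.1 : ℕ)) (l := fun j : JJ => (j.1.2 : ℕ)) (c := fun j => t j s0) (fun j => ht j s0) k
      rw [card_JJ] at this
      exact_mod_cast this) hm0 hF hz2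
    have h1 : M ^ ν ≤ C0 * (16 * C2 ^ ν) ^ 4 := hm2.trans ((le_abs_self _).trans hb)
    have h2 : C0 * (16 * C2 ^ ν) ^ 4 ≤ (C0 * (16 * C2) ^ 4) ^ ν := by
      rw [mul_pow C0, ← pow_mul, mul_comm 4 ν, pow_mul, mul_pow (16:ℝ) C2]
      have : C0 ≤ C0 ^ ν := le_self_pow₀ hC0 (by omega)
      have : (16:ℝ) ≤ 16 ^ ν := le_self_pow₀ (by norm_num) (by omega)
      gcongr
    have h3 : (C0 * (16 * C2) ^ 4) ^ ν < M ^ ν := pow_lt_pow_left₀ hM (by positivity) (by omega)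
    linarith

end Ser

namespace Ser

variable {O : Type*} [CommRing O] {N : RingSeminorm O}

lemma ze_num {C0 C2 : ℝ} (hC0 : 1 ≤ C0) (hC2 : 1 ≤ C2) (D0 ν : ℕ) (hν : 1 ≤ ν) :
    ((6 * ν + D0 + 1 : ℕ) : ℝ) * (C0 * (24 * ν * C2 ^ ν) ^ 4) ≤ (2 * (7 + D0) * (C0 * (48 * C2) ^ 4)) ^ ν := by
  have h2 : (ν:ℝ) ≤ 2 ^ ν := by exact_mod_cast (Nat.lt_two_pow_self).le
  have hν' : (1:ℝ) ≤ ν := by exact_mod_cast hν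
  have a1 : ((6 * ν + D0 + 1 : ℕ) : ℝ) ≤ (2 * (7 + D0)) ^ ν := by
    have : (7 + (D0:ℝ)) ≤ (7 + D0) ^ ν := le_self_pow₀ (by linarith [Nat.cast_nonneg (α := ℝ) D0]) (by omega)
    rw [mul_pow]
    calc ((6 * ν + D0 + 1 : ℕ) : ℝ) ≤ ν * (7 + D0) := by push_cast; nlinarith [Nat.cast_nonneg (α := ℝ) D0]
      _ ≤ _ := by gcongr
  have a2 : C0 ≤ C0 ^ ν := le_self_pow₀ hC0 (by omega)
  have a3 : 24 * ν * C2 ^ ν ≤ (48 * C2) ^ ν := by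
    have h3 : (24:ℝ) ≤ 24 ^ ν := le_self_pow₀ (by norm_num) (by omega)
    rw [show 48 * C2 = 24 * 2 * C2 by ring, mul_pow, mul_pow]
    gcongr
  have e : (2 * (7 + (D0:ℝ)) * (C0 * (48 * C2) ^ 4)) ^ ν = (2 * (7 + D0)) ^ ν * (C0 ^ ν * ((48 * C2) ^ ν) ^ 4) := by
    rw [mul_pow, mul_pow C0, ← pow_mul, ← pow_mul, mul_comm 4 ν]
  rw [e]
  gcongr

theorem core (S P : ℤ) (hg : Polynomial.GoodSP S P) {ρ : O →+* ℂ} (hN1 : N 1 ≤ 1) (hρ : ∀ o, ‖ρ o‖ ≤ N o)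
    (π : Fin 4 → O →+ ℤ) (hπ : ∀ o, (∀ c, π c o = 0) → o = 0) (hπN : ∀ c o, |(π c o : ℝ)| ≤ N o)
    {R : ℝ} (hR : 0 < R) (hR1 : R ≤ 1) (y : PowerSeries O) {Y : ℝ} (hY : 1 ≤ Y) (hy : Bd N R y Y) {δ : ℕ} (hδ : 1 ≤ δ)
    (hbr : ∀ m : ℂ, m ≠ 0 → ‖1 / ((δ : ℂ) * m)‖ ≤ R → Polynomial.EV m (Xf ρ y δ m) (Polynomial.FP S P) = 0)
    (hpts : ∀ B : ℝ, ∃ m x : ℤ, B ≤ m ∧ Xf ρ y δ m = x ∧ Polynomial.EV m x (Polynomial.QQ S P x) ≠ 0) : False := by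
  classical
  obtain ⟨C2, hC2, hsieg⟩ := siegel_step hN1 π hπ hπN hR hR1 y hY hy hδ
  obtain ⟨C3, hC3, hup⟩ := upper hN1 hρ hR hR1 y hY hy hδ hC2
  obtain ⟨C5, hC5, hQ⟩ := Q_bound S P hY
  obtain ⟨C0, hC0, hnv⟩ := Polynomial.nonvan S P hg
  obtain ⟨C4, D0, hC4, hze⟩ := Polynomial.zero_est S P hg (J := JJ)
  generalize Fintype.card (Fin 4 → JJ) = K at hze
  set U : ℝ := 2 * (7 + D0) * (C4 * (48 * C2) ^ 4) with hU
  have hU1 : 1 ≤ U := by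
    have h1 : (1:ℝ) ≤ (48 * C2) ^ 4 := one_le_pow₀ (by linarith)
    have h2 : (1:ℝ) ≤ 2 * (7 + D0) := by linarith [Nat.cast_nonneg (α := ℝ) D0]
    exact one_le_mul_of_one_le_of_one_le h2 (one_le_mul_of_one_le_of_one_le hC4 h1)
  set V := U ^ (4 ^ K) with hV
  have hV1 : 1 ≤ V := one_le_pow₀ hU1
  have hV2 : 1 ≤ 2 * C5 * C3 := by nlinarith
  have gy : y ∈ good N R hR.le := ⟨_, hy⟩
  -- first point
  obtain ⟨m1, x1, hm1, hx1, hq1⟩ := hpts (3 / R + C0 * (16 * C2) ^ 4 + V ^ 20 + (2 * C5 * C3) ^ 4 + 2)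
  set M : ℝ := (m1 : ℝ) with hM
  have p1 : 0 < 3 / R := by positivity
  have p2 : 0 ≤ C0 * (16 * C2) ^ 4 := by positivity
  have p3 : 0 ≤ V ^ 20 := by positivity
  have p4 : 0 ≤ (2 * C5 * C3) ^ 4 := by positivity
  have M2 : 2 ≤ M := by linarith
  have M3 : 2 / R < M := by
    have : 2 / R < 3 / R := by gcongr; norm_num
    linarith
  have hM0 : 0 < M := by linarith
  -- second point
  set ν0 := 48 + 20 * (K + 1) with hν0
  obtain ⟨m2, x2, hm2, hx2, -⟩ := hpts (M ^ ν0)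
  have hm21 : (1:ℝ) ≤ m2 := (one_le_pow₀ (by linarith)).trans hm2
  obtain ⟨ν, hν1, hν2⟩ := exists_nat_pow_near hm21 (by linarith : 1 < M)
  have hνν : ν0 ≤ ν := by
    by_contra hlt
    have : M ^ (ν + 1) ≤ M ^ ν0 := pow_le_pow_right₀ (by linarith) (by omega)
    linarith
  have hνpos : 1 ≤ ν := by omega
  obtain ⟨t, ht0, ht, htv⟩ := hsieg ν hνpos
  have hm2norm : ‖(m2 : ℂ)‖ = m2 := by
    rw [Complex.norm_intCast, abs_of_pos (by linarith)]
  have hm1norm : ‖(m1 : ℂ)‖ = M := by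
    rw [Complex.norm_intCast, abs_of_pos hM0]
  have htau : ∀ m : ℂ, M / 2 ≤ ‖m‖ → m ≠ 0 ∧ ‖1 / ((δ : ℂ) * m)‖ < R := by
    intro m hm
    refine ⟨by rw [← norm_pos_iff]; linarith, ?_⟩
    have h1 := tau_bound hR hδ (b := M / 2) (by positivity) hm
    have h2 : 1 / (M / 2 * R) < 1 := by
      rw [div_lt_one (by positivity)]
      rw [div_lt_iff₀ hR] at M3; linarith
    have := h1.trans_lt h2
    rwa [div_lt_one hR] at this
  have hF1 : Polynomial.EV m1 x1 (Polynomial.FP S P) = 0 := by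
    apply EV_int_zero
    rw [← hx1]
    obtain ⟨a1, a2⟩ := htau m1 (by rw [hm1norm]; linarith)
    exact hbr _ a1 a2.le
  have hMν : M ≤ M ^ ν := le_self_pow₀ (by linarith) (by omega)
  have hF2 : Polynomial.EV m2 x2 (Polynomial.FP S P) = 0 := by
    apply EV_int_zero
    rw [← hx2]
    obtain ⟨a1, a2⟩ := htau m2 (by rw [hm2norm]; linarith)
    exact hbr _ a1 a2.le
  set γ : JJ → ℤ := fun j => m2 ^ (j.1.2 : ℕ) * x2 ^ (j.1.1 : ℕ) with hγ
  set A : JJ → Polynomial (Polynomial ℤ) := fun j => Polynomial.bip (fun s => (s.1 : ℕ)) (fun s => (s.2 : ℕ)) (t j) with hA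
  set h := ∑ j, Polynomial.C (Polynomial.C (γ j)) * A j with hh
  have hne : h ≠ 0 := h_ne_zero S P hC0 hC2 hnv hνpos t ht0 ht m2 x2 hF2 (M := M) (by linarith) hν1
  have hEV : ∀ m : ℂ, Polynomial.EV m (Xf ρ y δ m) h =
      ∑ j, ∑ s, (t j s : ℂ) * ((m2:ℂ) ^ (j.1.2 : ℕ) * Xf ρ y δ m2 ^ (j.1.1 : ℕ)) * (m ^ (s.2 : ℕ) * Xf ρ y δ m ^ (s.1 : ℕ)) := by
    intro m
    rw [hh, map_sum]
    refine Finset.sum_congr rfl fun j _ => ?_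
    rw [map_mul, Polynomial.EV_CC, hA, Polynomial.EV_bip, Finset.mul_sum]
    refine Finset.sum_congr rfl fun s _ => ?_
    rw [hγ, hx2]
    push_cast
    ring
  have hhb : ∀ m : ℂ, M / 2 ≤ ‖m‖ → ‖m‖ ≤ 2 * M → ‖Polynomial.EV m (Xf ρ y δ m) h‖ ≤ C3 ^ ν * M ^ 12 / M ^ ν := by
    intro m b1 b2
    rw [le_div_iff₀ (by positivity), hEV]
    exact hup ν hνpos t ht htv M m m2 M3.le b1 b2 (by rw [hm2norm]; exact hν1) (by rw [hm2norm]; exact hν2.le)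
  have hdiff : ∀ m : ℂ, M / 2 ≤ ‖m‖ → DifferentiableAt ℂ (Xf ρ y δ) m := by
    intro m hm
    obtain ⟨a1, a2⟩ := htau m hm
    exact Xf_diff hρ hR gy hδ a1 a2
  rcases Polynomial.div_chain S P m1 x1 hF1 h (ν / 10) with ⟨e, he, h', hdv, hne'⟩ | ⟨h', hdv⟩
  · have hx1n : ‖(x1 : ℂ)‖ ≤ 4 * Y * M ^ 2 := by
      rw [← hx1]
      obtain ⟨a1, a2⟩ := htau m1 (by rw [hm1norm]; linarith)
      exact Xf_norm hρ hR hy (by rw [hm1norm]; linarith) a2.le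
    have key := maxmod S P m1 x1 (Xf ρ y δ) h h' e rfl hM0 hdiff hx1
      (fun m b1 b2 => hbr m (htau m b1).1 (htau m b1).2.le) hdv hne' (Bq := C5 * M ^ 6)
      (fun m b1 b2 => hQ M m _ x1 (by linarith) b2 (Xf_norm hρ hR hy b2 (htau m b1).2.le) hx1n) hhb
    have key2 : M ^ ν ≤ M ^ (5 * e + 12) * (2 * C5 * C3) ^ ν := by
      rw [mul_div_assoc', le_div_iff₀ (by positivity), div_pow] at key
      have k2 : M ^ e * M ^ ν ≤ M ^ e * (M ^ (5 * e + 12) * ((2 * C5) ^ e * C3 ^ ν)) := by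
        have : M ^ e * M ^ ν = 2 ^ e * (M ^ e / 2 ^ e * M ^ ν) := by field_simp
        rw [this]
        calc 2 ^ e * (M ^ e / 2 ^ e * M ^ ν) ≤ 2 ^ e * ((C5 * M ^ 6) ^ e * (C3 ^ ν * M ^ 12)) := by gcongr
          _ = _ := by rw [mul_pow, mul_pow, ← pow_mul]; ring
      have k3 := le_of_mul_le_mul_left k2 (by positivity)
      refine k3.trans ?_
      have : (2 * C5) ^ e ≤ (2 * C5) ^ ν := pow_le_pow_right₀ (by linarith) (by omega)
      rw [mul_pow (2 * C5)]
      gcongr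
    have := num_lemma (by linarith : 1 ≤ M) hV2 hνpos key2 (p := 4) (by omega)
    linarith
  · have hnear : ∀ᶠ m : ℂ in nhds (m1 : ℂ), M / 2 ≤ ‖m‖ := by
      have : Filter.Tendsto (fun m : ℂ => ‖m‖) (nhds (m1 : ℂ)) (nhds M) := by
        rw [← hm1norm]; exact continuous_norm.continuousAt
      exact this.eventually_const_le (by linarith)
    have hord := Polynomial.order_det S P m1 x1 h h' (ν / 10) (Xf ρ y δ) hdv (hdiff m1 (by rw [hm1norm]; linarith)).continuousAt hx1
      (hnear.mono fun m hm => hbr m (htau m hm).1 (htau m hm).2.le) hq1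
    have habs : |(m1 : ℝ)| = M := abs_of_pos hM0
    have hB : ∀ (j : JJ) (k : ℕ), ((A j).coeff k).L1 ≤ 24 * ν * C2 ^ ν := by
      intro j k
      have := Polynomial.L1_bip (k := fun s : Fin 4 × Fin (6 * ν) => (s.1 : ℕ)) (l := fun s => (s.2 : ℕ)) (c := t j) (ht j) k
      refine this.trans (le_of_eq ?_)
      rw [Fintype.card_prod, Fintype.card_fin, Fintype.card_fin]; push_cast; ring
    have hν' : (1:ℝ) ≤ ν := by exact_mod_cast hνpos
    have hB1 : 1 ≤ 24 * ν * C2 ^ ν := one_le_mul_of_one_le_of_one_le (by linarith) (one_le_pow₀ hC2)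
    have key := hze A γ (6 * ν) (24 * ν * C2 ^ ν) m1 (ν / 10) hB1 (by rw [habs]; linarith)
      (fun j => Polynomial.natDegree_bip (fun s => s.1.2)) hB (fun j k => Polynomial.natDegree_bip_coeff (fun s => s.2.2.le) k) hne hord
    rw [habs] at key
    have key2 : M ^ (ν / 10) ≤ M ^ K * V ^ ν := by
      refine key.trans ?_
      have : (((6 * ν + D0 + 1 : ℕ) : ℝ) * (C4 * (24 * ν * C2 ^ ν) ^ 4)) ^ (4 ^ K) ≤ V ^ ν := by
        rw [hV, ← pow_mul, mul_comm (4 ^ K) ν, pow_mul]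
        exact pow_le_pow_left₀ (by positivity) (ze_num hC4 hC2 D0 ν hνpos) _
      gcongr
    have := num_lemma (by linarith : 1 ≤ M) hV1 hνpos key2 (p := 20) (by omega)
    linarith

end Ser

namespace Ser
open scoped QuadraticAlgebra

/-- seminorm on a quadratic extension. -/
noncomputable def qsemi {R : Type*} [CommRing R] (N : RingSeminorm R) (a : R) (A : ℝ) (hA : 0 ≤ A) (ha : N a ≤ A ^ 2) :
    RingSeminorm (QuadraticAlgebra R a 0) where
  toFun x := N x.re + A * N x.im
  map_zero' := by simp
  add_le' x y := by
    have h1 := map_add_le_add N x.re y.re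
    have h2 := mul_le_mul_of_nonneg_left (map_add_le_add N x.im y.im) hA
    simp only [QuadraticAlgebra.re_add, QuadraticAlgebra.im_add]
    linarith
  neg' x := by simp
  mul_le' x y := by
    simp only [QuadraticAlgebra.re_mul, QuadraticAlgebra.im_mul, zero_mul, add_zero]
    have h1 := map_add_le_add N (x.re * y.re) (a * x.im * y.im)
    have h2 := mul_le_mul_of_nonneg_left (map_add_le_add N (x.re * y.im) (x.im * y.re)) hA
    have h3 := map_mul_le_mul N x.re y.re
    have h4 := map_mul_le_mul N (a * x.im) y.im
    have h5 := map_mul_le_mul N a x.im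
    have h6 := mul_le_mul_of_nonneg_left (map_mul_le_mul N x.re y.im) hA
    have h7 := mul_le_mul_of_nonneg_left (map_mul_le_mul N x.im y.re) hA
    have n1 := apply_nonneg N x.im
    have n2 := apply_nonneg N y.im
    have h8 : N (a * x.im) * N y.im ≤ A ^ 2 * N x.im * N y.im :=
      mul_le_mul_of_nonneg_right (h5.trans (mul_le_mul_of_nonneg_right ha n1)) n2
    nlinarith

lemma qsemi_apply {R : Type*} [CommRing R] (N : RingSeminorm R) (a : R) (A : ℝ) (hA : 0 ≤ A) (ha : N a ≤ A ^ 2) (x : QuadraticAlgebra R a 0) :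
    qsemi N a A hA ha x = N x.re + A * N x.im := rfl

/-- homomorphism from a quadratic extension. -/
noncomputable def qhom {R : Type*} [CommRing R] (a : R) (f : R →+* ℂ) (c : ℂ) (hc : c ^ 2 = f a) : QuadraticAlgebra R a 0 →+* ℂ where
  toFun x := f x.re + f x.im * c
  map_zero' := by simp
  map_one' := by simp
  map_add' x y := by simp; ring
  map_mul' x y := by
    simp only [QuadraticAlgebra.re_mul, QuadraticAlgebra.im_mul, zero_mul, add_zero, map_add, map_mul, ← hc]
    ring

lemma qhom_apply {R : Type*} [CommRing R] (a : R) (f : R →+* ℂ) (c : ℂ) (hc : c ^ 2 = f a) (x : QuadraticAlgebra R a 0) :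
    qhom a f c hc x = f x.re + f x.im * c := rfl

lemma qhom_bound {R : Type*} [CommRing R] (N : RingSeminorm R) (a : R) (A : ℝ) (hA : 0 ≤ A) (ha : N a ≤ A ^ 2) (f : R →+* ℂ)
    (hf : ∀ o, ‖f o‖ ≤ N o) (c : ℂ) (hc : c ^ 2 = f a) (x : QuadraticAlgebra R a 0) : ‖qhom a f c hc x‖ ≤ qsemi N a A hA ha x := by
  have h1 : ‖c‖ ≤ A := by
    have : ‖c‖ ^ 2 ≤ A ^ 2 := by rw [← norm_pow, hc]; exact (hf a).trans ha
    exact le_of_sq_le_sq this hA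
  rw [qhom_apply, qsemi_apply]
  refine (norm_add_le _ _).trans (add_le_add (hf _) ?_)
  rw [norm_mul, mul_comm A]
  exact mul_le_mul (hf _) h1 (norm_nonneg _) (apply_nonneg N _)

/-- All the data about the coefficient ring. -/
theorem ring_data (S : ℤ) (hS : S ≠ 0) : ∃ (O : Type) (_ : CommRing O) (N : RingSeminorm O) (π : Fin 4 → O →+ ℤ) (s θ : O) (ρ : Fin 4 → O →+* ℂ),
    N 1 ≤ 1 ∧ (∀ o, (∀ c, π c o = 0) → o = 0) ∧ (∀ c o, |(π c o : ℝ)| ≤ N o) ∧ s ^ 2 = 3 ∧ θ ^ 2 = S * (2 * s - 3) ∧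
    (∀ i o, ‖ρ i o‖ ≤ N o) ∧ (∀ i, ρ i s ≠ 0) ∧ (∀ i j, i ≠ j → ρ i s ≠ ρ j s ∨ (ρ i s = ρ j s ∧ ρ i θ ≠ ρ j θ)) := by
  set a : QuadraticAlgebra ℤ 3 0 := ⟨-3 * S, 2 * S⟩ with ha
  set N0 : RingSeminorm ℤ := normRingSeminorm ℤ with hN0
  have N0a : ∀ z : ℤ, N0 z = |(z:ℝ)| := fun z => Int.norm_eq_abs z
  have h3 : N0 3 ≤ 2 ^ 2 := by rw [N0a]; norm_num
  set N1 := qsemi N0 3 2 (by norm_num) h3 with hN1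
  set A : ℝ := 7 * |(S:ℝ)| with hA
  have hS1 : (1:ℝ) ≤ |(S:ℝ)| := by exact_mod_cast Int.one_le_abs hS
  have hA1 : 1 ≤ A := by linarith
  have haA : N1 a ≤ A ^ 2 := by
    rw [hN1, qsemi_apply, N0a, N0a, ha]
    push_cast
    rw [abs_mul, abs_mul]
    norm_num
    nlinarith
  set N2 := qsemi N1 a A (by linarith) haA with hN2
  have r3 : ((Real.sqrt 3 : ℝ) : ℂ) ^ 2 = 3 := by
    rw [← Complex.ofReal_pow, Real.sq_sqrt (by norm_num)]; norm_num
  have hσ : ∀ ε : ℤˣ, ((ε : ℤ) * ((Real.sqrt 3 : ℝ) : ℂ)) ^ 2 = Int.castRingHom ℂ 3 := by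
    intro ε
    rw [mul_pow, r3, ← Int.cast_pow, ← Units.val_pow_eq_pow_val, Int.units_sq]; simp
  set f : ℤˣ → QuadraticAlgebra ℤ 3 0 →+* ℂ := fun ε => qhom 3 (Int.castRingHom ℂ) _ (hσ ε) with hf
  have hsq : ∀ ε : ℤˣ, ∃ c : ℂ, c ^ 2 = f ε a := fun ε => IsAlgClosed.exists_pow_nat_eq _ (by norm_num)
  choose c hc using hsq
  have hc2 : ∀ ε η : ℤˣ, ((η : ℤ) * c ε) ^ 2 = f ε a := by
    intro ε η
    rw [mul_pow, hc, ← Int.cast_pow, ← Units.val_pow_eq_pow_val, Int.units_sq]; simp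
  have r3ne : ((Real.sqrt 3 : ℝ) : ℂ) ≠ 0 := by
    intro h; rw [h] at r3; norm_num at r3
  have hcne : ∀ ε, c ε ≠ 0 := by
    intro ε h
    have h1 := hc ε
    rw [h, hf, qhom_apply, ha] at h1
    have hS' : (S:ℂ) ≠ 0 := by exact_mod_cast hS
    have h2 : (S:ℂ) * (2 * ((ε : ℤ) * ((Real.sqrt 3 : ℝ) : ℂ)) - 3) = 0 := by
      simp only [eq_intCast] at h1
      push_cast at h1
      linear_combination -h1
    have h3 := (mul_eq_zero.mp h2).resolve_left hS'
    have h4 := hσ ε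
    simp only [eq_intCast] at h4
    have h5 : (12 : ℂ) = 9 := by
      push_cast at h4
      linear_combination (2 * ((ε : ℤ) * ((Real.sqrt 3 : ℝ) : ℂ)) + 3) * h3 - 4 * h4
    norm_num at h5
  set e1 : Fin 4 → ℤˣ := ![1, 1, -1, -1]
  set e2 : Fin 4 → ℤˣ := ![1, -1, 1, -1]
  have f1 : ∀ (ε : ℤˣ) o, ‖f ε o‖ ≤ N1 o := fun ε o => qhom_bound N0 3 2 (by norm_num) h3 (Int.castRingHom ℂ) (fun z => by
    rw [N0a]; simp) _ (hσ ε) o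
  refine ⟨QuadraticAlgebra (QuadraticAlgebra ℤ 3 0) a 0, inferInstance, N2,
    ![AddMonoidHom.mk' (fun x => x.re.re) (by intros; rfl), AddMonoidHom.mk' (fun x => x.re.im) (by intros; rfl),
      AddMonoidHom.mk' (fun x => x.im.re) (by intros; rfl), AddMonoidHom.mk' (fun x => x.im.im) (by intros; rfl)],
    ⟨⟨0, 1⟩, 0⟩, ⟨0, 1⟩, fun i => qhom a (f (e1 i)) _ (hc2 (e1 i) (e2 i)), ?_, ?_, ?_, ?_, ?_, ?_, ?_, ?_⟩
  · rw [hN2, qsemi_apply, hN1, qsemi_apply, qsemi_apply]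
    simp [N0a]
  · intro o h
    have h0 := h 0
    have h1 := h 1
    have h2 := h 2
    have h3 := h 3
    simp at h0 h1 h2 h3
    ext <;> simp [h0, h1, h2, h3]
  · intro cc o
    rw [hN2, qsemi_apply, hN1, qsemi_apply, qsemi_apply]
    simp only [N0a]
    have q1 := abs_nonneg (o.re.re : ℝ)
    have q2 := abs_nonneg (o.re.im : ℝ)
    have q3 := abs_nonneg (o.im.re : ℝ)
    have q4 := abs_nonneg (o.im.im : ℝ)
    have q5 : |(o.im.re : ℝ)| + 2 * |(o.im.im : ℝ)| ≤ A * (|(o.im.re : ℝ)| + 2 * |(o.im.im : ℝ)|) := by nlinarith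
    fin_cases cc <;> simp <;> linarith
  · ext <;> simp [pow_two]
  · ext <;> simp [pow_two, ha]
    all_goals ring
  · intro i o
    exact qhom_bound N1 a A (by linarith) haA (f (e1 i)) (f1 _) _ _ o
  · intro i
    simp [qhom_apply, hf, r3ne]
  · intro i j hij
    have hs : ∀ i, (qhom a (f (e1 i)) _ (hc2 (e1 i) (e2 i))) ⟨⟨0, 1⟩, 0⟩ = ((e1 i : ℤ) : ℂ) * ((Real.sqrt 3 : ℝ) : ℂ) := by
      intro i; simp [qhom_apply, hf]
    have ht : ∀ i, (qhom a (f (e1 i)) _ (hc2 (e1 i) (e2 i))) ⟨0, 1⟩ = ((e2 i : ℤ) : ℂ) * c (e1 i) := by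
      intro i; simp [qhom_apply]
    rw [hs, hs, ht, ht]
    by_cases h : e1 i = e1 j
    · right
      refine ⟨by rw [h], ?_⟩
      rw [h]
      intro h2
      have h3 := mul_right_cancel₀ (hcne _) h2
      have h4 : e2 i = e2 j := Units.ext (by exact_mod_cast h3)
      have : ∀ i j : Fin 4, e1 i = e1 j → e2 i = e2 j → i = j := by decide
      exact hij (this i j h h4)
    · left
      intro h2
      have h3 := mul_right_cancel₀ r3ne h2
      exact h (Units.ext (by exact_mod_cast h3))
end Ser

namespace Ser

lemma branch_alg {A : Type*} [CommRing A] (s θ S z ϖ e q1 : A) (hs : s ^ 2 = 3) (hθ : θ ^ 2 = S * (2 * s - 3))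
    (v T : A) (hv : v = θ + 24 * S * z) (hT : T = (24 * S) ^ 2 * ϖ)
    (hz : z = -4 * θ * (2 * s + 3) * z ^ 2 + ϖ * (θ * (2 * s + 3) * (4 * (3 - 2 * s) * q1 + 4 * (v * (6 - 2 * s) + 3 * T * v ^ 2) * (-S + T * q1)
      - 4 * v * (v ^ 2 + e) - T * (v ^ 2 + e) ^ 2))) :
    (2 * v + T * (v ^ 2 + e)) ^ 2 = 4 * (1 + T * v) * (3 * (1 + T * v) - 2 * s) * (-S + T * q1) := by
  have h3 : θ ^ 2 * (2 * s + 3) = 3 * S := by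
    rw [hθ]; linear_combination 4 * S * hs
  set Λ := 4 * (3 - 2 * s) * q1 + 4 * (v * (6 - 2 * s) + 3 * T * v ^ 2) * (-S + T * q1)
      - 4 * v * (v ^ 2 + e) - T * (v ^ 2 + e) ^ 2 with hΛ
  have h4 : 8 * θ * z + 4 * (24 * S) * z ^ 2 = 24 * S * ϖ * Λ := by
    linear_combination 8 * θ * hz - (32 * z ^ 2 - 8 * ϖ * Λ) * h3
  have h5 : 4 * (v ^ 2 - θ ^ 2) = T * Λ := by
    rw [hv, hT]; linear_combination (24 * S) * h4
  rw [hΛ] at h5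
  linear_combination h5 + 4 * hθ

variable {O : Type*} [CommRing O] {N : RingSeminorm O}

lemma int_good {R : ℝ} (hR : 0 ≤ R) (n : ℤ) : (n : PowerSeries O) ∈ good N R hR := intCast_mem _ n

theorem branch (h1 : N 1 ≤ 1) (s θ : O) (S : ℤ) (hs : s ^ 2 = 3) (hθ : θ ^ 2 = S * (2 * s - 3)) (w e q1 : PowerSeries O)
    (hw : w ∈ good N 1 zero_le_one) (he : e ∈ good N 1 zero_le_one) (hq : q1 ∈ good N 1 zero_le_one) (T : PowerSeries O)
    (hT : T = (24 * (S : PowerSeries O)) ^ 2 * (PowerSeries.X * w)) :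
    ∃ v : PowerSeries O, ∃ R : ℝ, ∃ hR : 0 < R, R ≤ 1 ∧ v ∈ good N R hR.le ∧ PowerSeries.coeff 0 v = θ ∧
      (2 * v + T * (v ^ 2 + e)) ^ 2 = 4 * (1 + T * v) * (3 * (1 + T * v) - 2 * PowerSeries.C s) * (-(S : PowerSeries O) + T * q1) := by
  set G := good N 1 zero_le_one with hG
  let sG : G := ⟨PowerSeries.C s, good_C _ s⟩
  let tG : G := ⟨PowerSeries.C θ, good_C _ θ⟩
  let xG : G := ⟨PowerSeries.X, good_X _⟩
  let wG : G := ⟨w, hw⟩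
  let eG : G := ⟨e, he⟩
  let qG : G := ⟨q1, hq⟩
  let TG : G := (24 * (S : G)) ^ 2 * (xG * wG)
  let V : Polynomial G := Polynomial.C tG + Polynomial.C (24 * (S : G)) * Polynomial.X
  let L0 : Polynomial G := Polynomial.C (tG * (2 * sG + 3)) * (Polynomial.C (4 * (3 - 2 * sG) * qG) +
    Polynomial.C 4 * (V * Polynomial.C (6 - 2 * sG) + Polynomial.C (3 * TG) * V ^ 2) * Polynomial.C (-(S : G) + TG * qG) -
    Polynomial.C 4 * V * (V ^ 2 + Polynomial.C eG) - Polynomial.C TG * (V ^ 2 + Polynomial.C eG) ^ 2)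
  obtain ⟨z, R, hR, hR1, ⟨z', hz'⟩, hz, hzg⟩ := fix h1 (-4 * θ * (2 * s + 3)) w (L0.map G.subtype) hw
    (fun i => by rw [Polynomial.coeff_map]; exact (L0.coeff i).2)
  have hTG : G.subtype TG = T := by
    rw [hT]; simp only [TG, map_mul, map_pow, map_ofNat, map_intCast]; rfl
  have hev : (L0.map G.subtype).eval z = PowerSeries.C θ * (2 * PowerSeries.C s + 3) * (4 * (3 - 2 * PowerSeries.C s) * q1 +
      4 * ((PowerSeries.C θ + 24 * (S : PowerSeries O) * z) * (6 - 2 * PowerSeries.C s) + 3 * T * (PowerSeries.C θ + 24 * (S : PowerSeries O) * z) ^ 2) * (-(S : PowerSeries O) + T * q1)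
      - 4 * (PowerSeries.C θ + 24 * (S : PowerSeries O) * z) * ((PowerSeries.C θ + 24 * (S : PowerSeries O) * z) ^ 2 + e) - T * ((PowerSeries.C θ + 24 * (S : PowerSeries O) * z) ^ 2 + e) ^ 2) := by
    rw [Polynomial.eval_map, ← hTG]
    simp only [L0, V, Polynomial.eval₂_add, Polynomial.eval₂_mul, Polynomial.eval₂_sub, Polynomial.eval₂_pow, Polynomial.eval₂_C, Polynomial.eval₂_X]
    simp only [map_mul, map_add, map_sub, map_neg, map_ofNat, map_intCast]
    rfl
  rw [hev] at hz
  refine ⟨PowerSeries.C θ + 24 * (S : PowerSeries O) * z, R, hR, hR1, ?_, ?_, ?_⟩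
  · refine add_mem (good_C _ _) (mul_mem (mul_mem ?_ (int_good _ _)) hzg)
    exact_mod_cast int_good hR.le 24
  · rw [hz']; simp [← mul_assoc, mul_comm _ PowerSeries.X]
  · refine branch_alg (PowerSeries.C s) (PowerSeries.C θ) (S : PowerSeries O) z (PowerSeries.X * w) e q1 ?_ ?_ _ T rfl hT ?_
    · rw [← map_pow, hs, map_ofNat]
    · rw [← map_pow, hθ]; simp only [map_mul, map_sub, map_intCast, map_ofNat]
    · refine hz.trans ?_
      simp only [map_mul, map_add, map_neg, map_ofNat]
end Ser

namespace Ser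

lemma G_alg {A : Type*} [CommRing A] (s S' S P v T T' e q1 y t : A) (hs : s ^ 2 = 3) (hy : y = s * (1 + T' * v)) (ht : t = 3 * T)
    (he : T' * T' * e = 27 * P * T ^ 4) (hq : T' ^ 2 * (-S' + T' * q1) = 9 * P * T ^ 4 - S * T ^ 2)
    (h : (2 * v + T' * (v ^ 2 + e)) ^ 2 = 4 * (1 + T' * v) * (3 * (1 + T' * v) - 2 * s) * (-S' + T' * q1)) :
    (y ^ 2 - 3 + P * t ^ 4) ^ 2 = 4 * y * (y - 2) * (P * t ^ 4 - S * t ^ 2) := by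
  have h1 : y ^ 2 - 3 + P * t ^ 4 = 3 * T' * (2 * v + T' * (v ^ 2 + e)) := by
    rw [hy, ht]; linear_combination (1 + T' * v) ^ 2 * hs - 3 * he
  have h2 : y * (y - 2) = (1 + T' * v) * (3 * (1 + T' * v) - 2 * s) := by
    rw [hy]; linear_combination (1 + T' * v) ^ 2 * hs
  rw [h1, mul_assoc 4, h2, ht]
  linear_combination 9 * T' ^ 2 * h + 36 * (1 + T' * v) * (3 * (1 + T' * v) - 2 * s) * hq

variable {O : Type*} [CommRing O] {N : RingSeminorm O}

lemma hbr_of_G (S P : ℤ) {ρ : O →+* ℂ} (hρ : ∀ o, ‖ρ o‖ ≤ N o) {R : ℝ} (hR : 0 < R) (y : PowerSeries O) (hy : y ∈ good N R hR.le) {δ : ℕ} (hδ : 1 ≤ δ)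
    (hG : (y ^ 2 - 3 + (P : PowerSeries O) * ((δ : PowerSeries O) * PowerSeries.X) ^ 4) ^ 2 = 4 * y * (y - 2) *
      ((P : PowerSeries O) * ((δ : PowerSeries O) * PowerSeries.X) ^ 4 - (S : PowerSeries O) * ((δ : PowerSeries O) * PowerSeries.X) ^ 2))
    (m : ℂ) (hm : m ≠ 0) (hτ : ‖1 / ((δ : ℂ) * m)‖ ≤ R) : Polynomial.EV m (Xf ρ y δ m) (Polynomial.FP S P) = 0 := by
  let yG : good N R hR.le := ⟨y, hy⟩
  let xG : good N R hR.le := ⟨PowerSeries.X, good_X _⟩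
  have h : (yG ^ 2 - 3 + (P : good N R hR.le) * ((δ : good N R hR.le) * xG) ^ 4) ^ 2 = 4 * yG * (yG - 2) *
      ((P : good N R hR.le) * ((δ : good N R hR.le) * xG) ^ 4 - (S : good N R hR.le) * ((δ : good N R hR.le) * xG) ^ 2) :=
    Subtype.ext hG
  have h2 := congrArg (evHom hρ hR.le hτ) h
  simp only [map_mul, map_pow, map_sub, map_add, map_ofNat, map_intCast, map_natCast] at h2
  rw [evHom_apply, evHom_apply] at h2
  simp only [yG, xG, ev_X] at h2
  have hδ' : (δ : ℂ) ≠ 0 := by exact_mod_cast (by omega : δ ≠ 0)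
  have h3 : (δ : ℂ) * (1 / ((δ : ℂ) * m)) = m⁻¹ := by field_simp
  rw [h3] at h2
  rw [Polynomial.EV_FP, Xf]
  set Y := ev ρ (1 / ((δ : ℂ) * m)) y
  have h4 := congrArg (fun x => m ^ 8 * x) h2
  field_simp at h4
  linear_combination h4

lemma ev_zero (ρ : O →+* ℂ) (p : PowerSeries O) : ev ρ 0 p = ρ (PowerSeries.coeff 0 p) := by
  rw [ev, tsum_eq_single 0]
  · simp
  · intro i hi; simp [hi]

open Filter Topology in
lemma ev_tendsto {ρ : O →+* ℂ} (hρ : ∀ o, ‖ρ o‖ ≤ N o) {R : ℝ} (hR : 0 < R) (p : PowerSeries O) (hp : p ∈ good N R hR.le) :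
    Tendsto (fun τ => ev ρ τ p) (𝓝[≠] 0) (𝓝 (ρ (PowerSeries.coeff 0 p))) := by
  rw [← ev_zero]
  have := ((ev_differentiableOn hρ hR.le hp).differentiableAt (Metric.ball_mem_nhds 0 hR)).continuousAt
  exact this.tendsto.mono_left nhdsWithin_le_nhds

open Filter Topology in
lemma distinct {ρ ρ' : O →+* ℂ} (hρ : ∀ o, ‖ρ o‖ ≤ N o) (hρ' : ∀ o, ‖ρ' o‖ ≤ N o) {R : ℝ} (hR : 0 < R) (s : O) (hs : ρ s ≠ 0) (v T y : PowerSeries O)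
    (hv : v ∈ good N R hR.le) (hy : y = PowerSeries.C s * (1 + T * v)) (S : ℤ) (hS : S ≠ 0) (k : ℕ)
    (hT : T = (24 * (S : PowerSeries O)) ^ 2 * (PowerSeries.X * PowerSeries.X ^ k))
    (hne : ρ s ≠ ρ' s ∨ (ρ s = ρ' s ∧ ρ (PowerSeries.coeff 0 v) ≠ ρ' (PowerSeries.coeff 0 v))) :
    ∀ᶠ τ in 𝓝[≠] (0 : ℂ), ev ρ τ y ≠ ev ρ' τ y := by
  have hTC : T = PowerSeries.C ((24 * (S : O)) ^ 2) * PowerSeries.X ^ (k + 1) := by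
    rw [hT, pow_succ' _ k]; simp only [map_mul, map_pow, map_intCast, map_ofNat]
  have hTg : T ∈ good N R hR.le := by
    rw [hTC]; exact mul_mem (good_C _ _) (pow_mem (good_X _) _)
  have hyg : y ∈ good N R hR.le := by
    rw [hy]; exact mul_mem (good_C _ _) (add_mem (one_mem _) (mul_mem hTg hv))
  rcases hne with hne | ⟨he, hne⟩
  · have hc : PowerSeries.coeff 0 y = s := by
      rw [hy, hTC]; simp
    have h1 := ev_tendsto hρ hR y hyg
    have h2 := ev_tendsto hρ' hR y hyg
    rw [hc] at h1 h2
    filter_upwards [(h1.sub h2).eventually_ne (sub_ne_zero.mpr hne)] with τ hτ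
    exact sub_ne_zero.mp hτ
  · have h1 := ev_tendsto hρ hR v hv
    have h2 := ev_tendsto hρ' hR v hv
    have h3 : ∀ᶠ τ in 𝓝[≠] (0 : ℂ), ‖τ‖ < R := by
      have := Metric.ball_mem_nhds (0 : ℂ) hR
      filter_upwards [nhdsWithin_le_nhds this] with τ hτ
      simpa using hτ
    filter_upwards [(h1.sub h2).eventually_ne (sub_ne_zero.mpr hne), h3, self_mem_nhdsWithin] with τ a1 a2 a3 a4
    have key : ∀ {σ : O →+* ℂ} (hσ : ∀ o, ‖σ o‖ ≤ N o), ev σ τ y = σ s * (1 + (24 * (S : ℂ)) ^ 2 * τ ^ (k + 1) * ev σ τ v) := by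
      intro σ hσ
      have o1 : ev σ τ 1 = 1 := by
        have := ev_C σ τ 1
        rwa [map_one, map_one] at this
      rw [hy, ev_mul hσ hR.le a2.le (good_C _ _) (add_mem (one_mem _) (mul_mem hTg hv)), ev_add hσ hR.le a2.le (one_mem _) (mul_mem hTg hv),
        ev_mul hσ hR.le a2.le hTg hv, hTC, ev_mul hσ hR.le a2.le (good_C _ _) (pow_mem (good_X _) _), ev_pow hσ hR.le a2.le (good_X _),
        ev_C, ev_C, ev_X, o1]
      simp only [map_mul, map_pow, map_intCast, map_ofNat]
    rw [key hρ, key hρ', ← he] at a4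
    have hS' : (S : ℂ) ≠ 0 := by exact_mod_cast hS
    have a5 := add_left_cancel (mul_left_cancel₀ hs a4)
    have h0 : (24 * (S : ℂ)) ^ 2 * τ ^ (k + 1) ≠ 0 := mul_ne_zero (pow_ne_zero _ (mul_ne_zero (by norm_num) hS')) (pow_ne_zero _ a3)
    exact sub_ne_zero.mp a1 (mul_left_cancel₀ h0 a5)

/-- All the analytic data. -/
theorem all_data (S P : ℤ) (hSP : S ≠ 0 ∨ (S = 0 ∧ P = -1)) : ∃ (O : Type) (_ : CommRing O) (N : RingSeminorm O) (π : Fin 4 → O →+ ℤ)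
    (ρ : Fin 4 → O →+* ℂ) (R : ℝ) (hR : 0 < R) (y : PowerSeries O) (δ : ℕ),
    N 1 ≤ 1 ∧ (∀ o, (∀ c, π c o = 0) → o = 0) ∧ (∀ c o, |(π c o : ℝ)| ≤ N o) ∧ (∀ i o, ‖ρ i o‖ ≤ N o) ∧ R ≤ 1 ∧ y ∈ good N R hR.le ∧ 1 ≤ δ ∧
    (∀ i, ∀ m : ℂ, m ≠ 0 → ‖1 / ((δ : ℂ) * m)‖ ≤ R → Polynomial.EV m (Xf (ρ i) y δ m) (Polynomial.FP S P) = 0) ∧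
    (∃ r > 0, ∀ τ : ℂ, τ ≠ 0 → ‖τ‖ < r → ∀ i j, i ≠ j → ev (ρ i) τ y ≠ ev (ρ j) τ y) := by
  obtain ⟨S', k, Tc, hS', hTc, hprop⟩ : ∃ (S' : ℤ) (k : ℕ) (Tc : ℕ), S' ≠ 0 ∧ 1 ≤ Tc ∧ ∀ (A : Type) [CommRing A] (x : A), ∃ e q : Polynomial ℤ,
      ((24 * (S' : A)) ^ 2 * (x * x ^ k)) * ((24 * (S' : A)) ^ 2 * (x * x ^ k)) * Polynomial.eval₂ (Int.castRingHom A) x e = 27 * P * ((Tc : A) * x) ^ 4 ∧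
      ((24 * (S' : A)) ^ 2 * (x * x ^ k)) ^ 2 * (-(S' : A) + ((24 * (S' : A)) ^ 2 * (x * x ^ k)) * Polynomial.eval₂ (Int.castRingHom A) x q) =
        9 * P * ((Tc : A) * x) ^ 4 - S * ((Tc : A) * x) ^ 2 := by
    rcases hSP with hS | ⟨hS, hP⟩
    · refine ⟨S, 0, ((24 * S) ^ 2).natAbs, hS, ?_, ?_⟩
      · have : (24 * S) ^ 2 ≠ 0 := pow_ne_zero _ (by omega)
        omega
      · intro A _ x
        have hn : ((((24 * S) ^ 2).natAbs : ℕ) : A) = (24 * (S : A)) ^ 2 := by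
          have : ((((24 * S) ^ 2).natAbs : ℕ) : ℤ) = (24 * S) ^ 2 := Int.natAbs_of_nonneg (sq_nonneg _)
          calc ((((24 * S) ^ 2).natAbs : ℕ) : A) = (((((24 * S) ^ 2).natAbs : ℕ) : ℤ) : A) := by rw [Int.cast_natCast]
            _ = _ := by rw [this]; push_cast; ring
        refine ⟨Polynomial.C (27 * P * ((24 * S) ^ 2) ^ 2) * Polynomial.X ^ 2, Polynomial.C (9 * P * (24 * S) ^ 2) * Polynomial.X, ?_, ?_⟩
        · rw [hn]; simp only [Polynomial.eval₂_mul, Polynomial.eval₂_pow, Polynomial.eval₂_C, Polynomial.eval₂_X, Polynomial.eval₂_zero]; simp only [eq_intCast]; push_cast; ring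
        · rw [hn]; simp only [Polynomial.eval₂_mul, Polynomial.eval₂_pow, Polynomial.eval₂_C, Polynomial.eval₂_X, Polynomial.eval₂_zero]; simp only [eq_intCast]; push_cast; ring
    · refine ⟨9, 1, 216, by norm_num, by norm_num, ?_⟩
      intro A _ x
      refine ⟨Polynomial.C (27 * P), 0, ?_, ?_⟩
      · simp only [Polynomial.eval₂_mul, Polynomial.eval₂_pow, Polynomial.eval₂_C, Polynomial.eval₂_X, Polynomial.eval₂_zero]; simp only [eq_intCast]; push_cast; ring
      · rw [hS, hP]; simp only [Polynomial.eval₂_zero]; push_cast; ring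
  obtain ⟨O, _, N, π, s, θ, ρ, hN1, hπ, hπN, hs, hθ, hρ, hρs, hdis⟩ := ring_data S' hS'
  obtain ⟨e, q, heg, hqg, he, hq⟩ : ∃ e q : PowerSeries O, e ∈ good N 1 zero_le_one ∧ q ∈ good N 1 zero_le_one ∧
      ((24 * (S' : PowerSeries O)) ^ 2 * (PowerSeries.X * PowerSeries.X ^ k)) * ((24 * (S' : PowerSeries O)) ^ 2 * (PowerSeries.X * PowerSeries.X ^ k)) * e
        = 27 * (P : PowerSeries O) * ((Tc : PowerSeries O) * PowerSeries.X) ^ 4 ∧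
      ((24 * (S' : PowerSeries O)) ^ 2 * (PowerSeries.X * PowerSeries.X ^ k)) ^ 2 * (-(S' : PowerSeries O) + ((24 * (S' : PowerSeries O)) ^ 2 * (PowerSeries.X * PowerSeries.X ^ k)) * q) =
        9 * (P : PowerSeries O) * ((Tc : PowerSeries O) * PowerSeries.X) ^ 4 - (S : PowerSeries O) * ((Tc : PowerSeries O) * PowerSeries.X) ^ 2 := by
    obtain ⟨e, q, he, hq⟩ := hprop (PowerSeries O) PowerSeries.X
    have hae : ∀ p : Polynomial ℤ, Polynomial.eval₂ (Int.castRingHom (PowerSeries O)) PowerSeries.X p ∈ good N 1 zero_le_one := by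
      intro p
      rw [Polynomial.eval₂_eq_sum_range]
      refine sum_mem fun i _ => ?_
      exact mul_mem (int_good _ _) (pow_mem (good_X _) _)
    exact ⟨_, _, hae e, hae q, he, hq⟩
  obtain ⟨v, R, hR, hR1, hv, hv0, hbr⟩ := branch hN1 s θ S' hs hθ (PowerSeries.X ^ k) e q
    (pow_mem (good_X _) _) heg hqg _ rfl
  set T' : PowerSeries O := (24 * (S' : PowerSeries O)) ^ 2 * (PowerSeries.X * PowerSeries.X ^ k) with hT'
  have hT'g : T' ∈ good N R hR.le := by
    rw [hT']
    refine mul_mem (pow_mem ?_ _) (mul_mem (good_X _) (pow_mem (good_X _) _))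
    exact_mod_cast int_good hR.le (24 * S')
  have hyg : PowerSeries.C s * (1 + T' * v) ∈ good N R hR.le := mul_mem (good_C _ _) (add_mem (one_mem _) (mul_mem hT'g hv))
  have hsC : (PowerSeries.C s : PowerSeries O) ^ 2 = 3 := by rw [← map_pow, hs, map_ofNat]
  refine ⟨O, _, N, π, ρ, R, hR, PowerSeries.C s * (1 + T' * v), 3 * Tc, hN1, hπ, hπN, hρ, hR1, hyg, by omega, ?_, ?_⟩
  · intro i
    refine hbr_of_G S P (hρ i) hR _ hyg (by omega) ?_
    have ht : ((3 * Tc : ℕ) : PowerSeries O) * PowerSeries.X = 3 * ((Tc : PowerSeries O) * PowerSeries.X) := by push_cast; ring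
    have := G_alg (PowerSeries.C s) (S' : PowerSeries O) (S : PowerSeries O) (P : PowerSeries O) v ((Tc : PowerSeries O) * PowerSeries.X) T' e q
      (PowerSeries.C s * (1 + T' * v)) (((3 * Tc : ℕ) : PowerSeries O) * PowerSeries.X) hsC rfl ht he hq hbr
    exact this
  · have h1 : ∀ᶠ τ in nhdsWithin (0 : ℂ) {0}ᶜ, ∀ i j, i ≠ j → ev (ρ i) τ (PowerSeries.C s * (1 + T' * v)) ≠ ev (ρ j) τ (PowerSeries.C s * (1 + T' * v)) := by
      rw [Filter.eventually_all]; intro i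
      rw [Filter.eventually_all]; intro j
      by_cases hij : i = j
      · simp [hij]
      · have := distinct (hρ i) (hρ j) hR s (hρs i) v T' _ hv rfl S' hS' k hT' (by rw [hv0]; exact hdis i j hij)
        filter_upwards [this] with τ h _
        exact h
    rw [eventually_nhdsWithin_iff, Metric.eventually_nhds_iff] at h1
    obtain ⟨r, hr, h⟩ := h1
    exact ⟨r, hr, fun τ h0 hτ => h (by simpa using hτ) h0⟩
end Ser

namespace Ser

lemma quartic {K : Type*} [Field K] (q2 q1 q0 z0 z1 z2 z3 x : K) (f : K → K) (hf : ∀ z, f z = z ^ 4 + q2 * z ^ 2 + q1 * z + q0)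
    (h0 : f z0 = 0) (h1 : f z1 = 0) (h2 : f z2 = 0) (h3 : f z3 = 0) (h01 : z0 ≠ z1) (h02 : z0 ≠ z2) (h03 : z0 ≠ z3) (h12 : z1 ≠ z2) (h13 : z1 ≠ z3)
    (h23 : z2 ≠ z3) (hx : f x = 0) : (x = z0 ∨ x = z1 ∨ x = z2 ∨ x = z3) ∧ 4 * x ^ 3 + 2 * q2 * x + q1 ≠ 0 := by
  rw [hf] at h0 h1 h2 h3 hx
  have d1 : ∀ z w : K, z ≠ w → z ^ 4 + q2 * z ^ 2 + q1 * z + q0 = 0 → w ^ 4 + q2 * w ^ 2 + q1 * w + q0 = 0 →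
      z ^ 3 + z ^ 2 * w + z * w ^ 2 + w ^ 3 + q2 * (z + w) + q1 = 0 := by
    intro z w hzw hz hw
    apply mul_left_cancel₀ (sub_ne_zero.mpr hzw)
    linear_combination hz - hw
  have e1 := d1 z0 z1 h01 h0 h1
  have e2 := d1 z0 z2 h02 h0 h2
  have e3 := d1 z0 z3 h03 h0 h3
  have d2 : ∀ z w u : K, w ≠ u → z ^ 3 + z ^ 2 * w + z * w ^ 2 + w ^ 3 + q2 * (z + w) + q1 = 0 → z ^ 3 + z ^ 2 * u + z * u ^ 2 + u ^ 3 + q2 * (z + u) + q1 = 0 →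
      z ^ 2 + w ^ 2 + u ^ 2 + z * w + z * u + w * u + q2 = 0 := by
    intro z w u hwu hw hu
    apply mul_left_cancel₀ (sub_ne_zero.mpr hwu)
    linear_combination hw - hu
  have f1 := d2 z0 z1 z2 h12 e1 e2
  have f2 := d2 z0 z1 z3 h13 e1 e3
  have g : z0 + z1 + z2 + z3 = 0 := by
    apply mul_left_cancel₀ (sub_ne_zero.mpr h23)
    linear_combination f1 - f2
  have k3 : z3 = -(z0 + z1 + z2) := by linear_combination g
  have k2 : q2 = -(z0 ^ 2 + z1 ^ 2 + z2 ^ 2 + z0 * z1 + z0 * z2 + z1 * z2) := by linear_combination f1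
  have k1 : q1 = -(z0 ^ 3 + z0 ^ 2 * z1 + z0 * z1 ^ 2 + z1 ^ 3 + q2 * (z0 + z1)) := by linear_combination e1
  have k0 : q0 = -(z0 ^ 4 + q2 * z0 ^ 2 + q1 * z0) := by linear_combination h0
  have hprod : (x - z0) * ((x - z1) * ((x - z2) * (x - z3))) = 0 := by
    rw [← hx, k0, k1, k2, k3]; ring
  have hder : 4 * x ^ 3 + 2 * q2 * x + q1 = (x - z1) * (x - z2) * (x - z3) + (x - z0) * (x - z2) * (x - z3) + (x - z0) * (x - z1) * (x - z3)
      + (x - z0) * (x - z1) * (x - z2) := by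
    rw [k1, k2, k3]; ring
  rw [hder]
  rcases mul_eq_zero.mp hprod with h | h
  · have : x = z0 := sub_eq_zero.mp h
    refine ⟨Or.inl this, ?_⟩
    rw [this]
    simp [sub_eq_zero, h01, h02, h03]
  rcases mul_eq_zero.mp h with h | h
  · have : x = z1 := sub_eq_zero.mp h
    refine ⟨Or.inr (Or.inl this), ?_⟩
    rw [this]
    simp [sub_eq_zero, h01.symm, h12, h13]
  rcases mul_eq_zero.mp h with h | h
  · have : x = z2 := sub_eq_zero.mp h
    refine ⟨Or.inr (Or.inr (Or.inl this)), ?_⟩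
    rw [this]
    simp [sub_eq_zero, h02.symm, h12.symm, h23]
  · have : x = z3 := sub_eq_zero.mp h
    refine ⟨Or.inr (Or.inr (Or.inr this)), ?_⟩
    rw [this]
    simp [sub_eq_zero, h03.symm, h13.symm, h23.symm]

lemma fiber_finite (S P m : ℤ) : {x : ℤ | Polynomial.EV m x (Polynomial.FP S P) = 0}.Finite := by
  set p : Polynomial ℤ := Polynomial.X ^ 4 + (Polynomial.C (4 * S * m ^ 2 - 6 * m ^ 4 - 2 * P) * Polynomial.X ^ 2 + Polynomial.C (8 * P * m ^ 2 - 8 * S * m ^ 4) * Polynomial.X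
    + Polynomial.C (9 * m ^ 8 - 6 * P * m ^ 4 + P ^ 2)) with hp
  have hp0 : p ≠ 0 := by
    have h4 : p.coeff 4 = 1 := by
      rw [hp]
      generalize 4 * S * m ^ 2 - 6 * m ^ 4 - 2 * P = u2
      generalize 8 * P * m ^ 2 - 8 * S * m ^ 4 = u1
      generalize 9 * m ^ 8 - 6 * P * m ^ 4 + P ^ 2 = u0
      simp only [Polynomial.coeff_add, Polynomial.coeff_C_mul, Polynomial.coeff_X_pow, Polynomial.coeff_X, Polynomial.coeff_C]
      norm_num
    intro h
    rw [h] at h4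
    simp at h4
  refine (Polynomial.finite_setOf_isRoot hp0).subset ?_
  intro x hx
  rw [Set.mem_setOf_eq, Polynomial.EV_FP] at hx
  rw [Set.mem_setOf_eq, Polynomial.IsRoot.def, hp]
  simp only [Polynomial.eval_add, Polynomial.eval_mul, Polynomial.eval_pow, Polynomial.eval_X, Polynomial.eval_C]
  push_cast at hx
  linear_combination hx

lemma large_points (S P : ℤ) (hinf : ¬ {p : ℤ × ℤ | Polynomial.EV p.2 p.1 (Polynomial.FP S P) = 0}.Finite) (B : ℝ) :
    ∃ m x : ℤ, B ≤ m ∧ Polynomial.EV m x (Polynomial.FP S P) = 0 := by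
  by_contra hcon
  push Not at hcon
  apply hinf
  obtain ⟨n, hn⟩ := exists_nat_ge B
  have h2 : (⋃ m ∈ Set.Icc (-(n : ℤ)) n, (fun x : ℤ => (x, m)) '' {x : ℤ | Polynomial.EV m x (Polynomial.FP S P) = 0}).Finite :=
    (Set.finite_Icc _ _).biUnion (fun m _ => (fiber_finite S P m).image _)
  refine h2.subset ?_
  rintro ⟨x, m⟩ hx
  simp only [Set.mem_setOf_eq] at hx
  simp only [Set.mem_iUnion]
  have hneg : Polynomial.EV (-m) x (Polynomial.FP S P) = 0 := by
    rw [Polynomial.EV_FP] at hx ⊢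
    rw [← hx]; ring
  refine ⟨m, ⟨?_, ?_⟩, x, hx, rfl⟩
  · by_contra h
    refine hcon (-m) x (hn.trans ?_) hneg
    exact_mod_cast (by omega : (n : ℤ) ≤ -m)
  · by_contra h
    refine hcon m x (hn.trans ?_) hx
    exact_mod_cast (by omega : (n : ℤ) ≤ m)

theorem final (S P : ℤ) (hSP : S ≠ 0 ∨ (S = 0 ∧ P = -1)) (hg : Polynomial.GoodSP S P) :
    {p : ℤ × ℤ | Polynomial.EV p.2 p.1 (Polynomial.FP S P) = 0}.Finite := by
  by_contra hinf
  have hlp := large_points S P hinf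
  obtain ⟨O, _, N, π, ρ, R, hR, y, δ, hN1, hπ, hπN, hρ, hR1, ⟨c, hc⟩, hδ, hbr, r, hr, hdis⟩ := all_data S P hSP
  have hall : ∀ B : ℝ, ∃ i, ∃ m x : ℤ, B ≤ m ∧ Xf (ρ i) y δ m = x ∧ Polynomial.EV m x (Polynomial.QQ S P x) ≠ 0 := by
    intro B
    obtain ⟨m, x, hm, hx⟩ := hlp (max B (1 + 1 / R + 1 / r))
    have hmB := (le_max_left _ _).trans hm
    have hm2 := (le_max_right _ _).trans hm
    have hR' : 0 < 1 / R := by positivity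
    have hr' : 0 < 1 / r := by positivity
    have hm0 : (0 : ℝ) < m := by linarith
    have hmC : (m : ℂ) ≠ 0 := by
      intro h
      have : m = 0 := by exact_mod_cast h
      rw [this] at hm0; simp at hm0
    have hδC : (δ : ℂ) ≠ 0 := by exact_mod_cast (by omega : δ ≠ 0)
    have hδ1 : (1 : ℝ) ≤ δ := by exact_mod_cast hδ
    have hnorm : ‖1 / ((δ : ℂ) * m)‖ ≤ 1 / m := by
      rw [norm_div, norm_mul, norm_one, Complex.norm_natCast, Complex.norm_intCast, abs_of_pos hm0]
      apply one_div_le_one_div_of_le hm0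
      nlinarith
    have hτR : ‖1 / ((δ : ℂ) * m)‖ ≤ R := by
      refine hnorm.trans ?_
      rw [one_div_le hm0 hR]; linarith
    have hτr : ‖1 / ((δ : ℂ) * m)‖ < r := by
      refine hnorm.trans_lt ?_
      rw [one_div_lt hm0 hr]; linarith
    have hτ0 : 1 / ((δ : ℂ) * m) ≠ 0 := one_div_ne_zero (mul_ne_zero hδC hmC)
    have hd : ∀ i j, i ≠ j → Xf (ρ i) y δ m ≠ Xf (ρ j) y δ m := by
      intro i j hij h
      rw [Xf, Xf] at h
      exact hdis _ hτ0 hτr i j hij (mul_left_cancel₀ (pow_ne_zero 2 hmC) h)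
    have hroot : ∀ i, Polynomial.EV (m : ℂ) (Xf (ρ i) y δ m) (Polynomial.FP S P) = 0 := fun i => hbr i m hmC hτR
    have hxC : Polynomial.EV (m : ℂ) (x : ℂ) (Polynomial.FP S P) = 0 := by
      have := Polynomial.EV_map (Int.castRingHom ℂ) m x (Polynomial.FP S P)
      rw [hx, map_zero] at this
      simpa using this.symm
    obtain ⟨hor, hQ⟩ := quartic (4 * S * m ^ 2 - 6 * m ^ 4 - 2 * P : ℂ) (8 * P * m ^ 2 - 8 * S * m ^ 4) (9 * m ^ 8 - 6 * P * m ^ 4 + P ^ 2)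
      _ _ _ _ _ (fun z => Polynomial.EV (m : ℂ) z (Polynomial.FP S P)) (fun z => Polynomial.EV_FP _ _ _ _) (hroot 0) (hroot 1) (hroot 2) (hroot 3)
      (hd 0 1 (by decide)) (hd 0 2 (by decide)) (hd 0 3 (by decide)) (hd 1 2 (by decide)) (hd 1 3 (by decide)) (hd 2 3 (by decide)) hxC
    have hQZ : Polynomial.EV m x (Polynomial.QQ S P x) ≠ 0 := by
      intro h
      apply hQ
      have h1 : Polynomial.EV m x (Polynomial.QQ S P x) = 4 * x ^ 3 + 2 * (4 * S * m ^ 2 - 6 * m ^ 4 - 2 * P) * x + (8 * P * m ^ 2 - 8 * S * m ^ 4) := by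
        simp only [Polynomial.QQ, Polynomial.q2, Polynomial.q1, map_add, map_sub, map_mul, map_pow, Polynomial.EV_X, Polynomial.EV_CX, Polynomial.EV_CC]
        push_cast
        simp
        ring
      rw [h] at h1
      exact_mod_cast h1.symm
    rcases hor with h | h | h | h
    · exact ⟨0, m, x, hmB, h.symm, hQZ⟩
    · exact ⟨1, m, x, hmB, h.symm, hQZ⟩
    · exact ⟨2, m, x, hmB, h.symm, hQZ⟩
    · exact ⟨3, m, x, hmB, h.symm, hQZ⟩
  have hpig : ∃ i, ∀ B : ℝ, ∃ m x : ℤ, B ≤ m ∧ Xf (ρ i) y δ m = x ∧ Polynomial.EV m x (Polynomial.QQ S P x) ≠ 0 := by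
    by_contra hcon
    push Not at hcon
    choose B hB using hcon
    obtain ⟨i, m, x, hm, h1, h2⟩ := hall (∑ i, |B i|)
    refine h2 (hB i m x ?_ h1)
    refine le_trans ?_ hm
    exact (le_abs_self _).trans (Finset.single_le_sum (f := fun i => |B i|) (fun _ _ => abs_nonneg _) (Finset.mem_univ i))
  obtain ⟨i, hi⟩ := hpig
  exact core S P hg hN1 (hρ i) π hπ hπN hR hR1 y (le_max_left 1 c) (hc.mono (le_max_right 1 c)) hδ (hbr i) hi
end Ser

/-- If `a` and `b` are distinct coprime nonzero integers and `F_{a,b}(x, m)` is irreducible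
in `ℚ[x, m]`, then there are only finitely many integer pairs `(x, m)` with
`F_{a,b}(x, m) = 0`. -/
theorem stmt_4 (a b : ℤ) (hne : a ≠ b) (ha : a ≠ 0) (hb : b ≠ 0) (hcop : IsCoprime a b)
    (hirr : Irreducible (Fab a b)) :
    {p : ℤ × ℤ | p.1 ^ 4
      + (4 * a * p.2 ^ 2 + 4 * b * p.2 ^ 2 - 6 * p.2 ^ 4 - 2 * a * b) * p.1 ^ 2
      + (8 * a * b * p.2 ^ 2 - 8 * a * p.2 ^ 4 - 8 * b * p.2 ^ 4) * p.1
      + (9 * p.2 ^ 8 - 6 * a * b * p.2 ^ 4 + a ^ 2 * b ^ 2) = 0}.Finite := by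
  have hSP : a + b ≠ 0 ∨ (a + b = 0 ∧ a * b = -1) := by
    by_cases h : a + b = 0
    · right
      refine ⟨h, ?_⟩
      have hb' : b = -a := by omega
      rw [hb', IsCoprime.neg_right_iff, isCoprime_self, Int.isUnit_iff] at hcop
      rcases hcop with h1 | h1 <;> rw [hb', h1] <;> norm_num
    · exact Or.inl h
  refine (Ser.final (a + b) (a * b) hSP (Polynomial.goodSP a b hirr)).subset ?_
  rintro ⟨x, m⟩ hx
  simp only [Set.mem_setOf_eq] at hx ⊢
  rw [Polynomial.EV_FP, ← hx]
  push_cast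
  ring
end
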